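/- arXiv:1110.0124 — 2 statements merged into one kernel-verified Lean document; each statement's English description precedes it below -/
import Mathlib

section
/- (Theorem 1, inner bound for Class I channels.) Let P1 be the set of all joint pmfs p1 on (W,V1,V2,X,Y1,Y2) of the form p1(w,v1,v2,x,y1,y2) = p(w) p(v1,v2|w) p(x|w,v1,v2) p(y1,y2|x,w), where p(w) is the given state pmf and p(y1,y2|x,w) is the given channel law; in particular (V1,V2) → (X,W) → (Y1,Y2) is a Markov chain. For p1 ∈ P1, let R_{1,in}(p1) be the convex hull of the set of nonnegative rate pairs (R1,R2) satisfying R1 ≤ I(V1;Y1) − I(V1;W), R2 ≤ I(V2;Y2) − I(V2;W), and R1 + R2 ≤ I(V1;Y1) + I(V2;Y2) − I(V1;V2) − I(V1,V2;W). Then the union ⋃_{p1∈P1} R_{1,in}(p1) is contained in the capacity region C1. -/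
open scoped Classical BigOperators
open Real

noncomputable section

/-- `p` is a probability mass function on a finite type. -/
def IsPMF {α : Type*} [Fintype α] (p : α → ℝ) : Prop :=
  (∀ a, 0 ≤ p a) ∧ ∑ a, p a = 1

/-- Base-2 Shannon entropy of a pmf on a finite type. -/
def entPMF {α : Type*} [Fintype α] (p : α → ℝ) : ℝ :=
  ∑ a, -(p a * Real.logb 2 (p a))

/-- Distribution (pushforward pmf) of a random variable `X` under the pmf `p`. -/
def distRV {Ω α : Type*} [Fintype Ω] (p : Ω → ℝ) (X : Ω → α) : α → ℝ :=
  fun a => ∑ ω, if X ω = a then p ω else 0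

/-- Shannon entropy `H(X)` of a random variable (base 2). -/
def entRV {Ω α : Type*} [Fintype Ω] [Fintype α] (p : Ω → ℝ) (X : Ω → α) : ℝ :=
  entPMF (distRV p X)

/-- Conditional entropy `H(X|Y)` (base 2). -/
def condEnt {Ω α β : Type*} [Fintype Ω] [Fintype α] [Fintype β]
    (p : Ω → ℝ) (X : Ω → α) (Y : Ω → β) : ℝ :=
  entRV p (fun ω => (X ω, Y ω)) - entRV p Y

/-- Mutual information `I(X;Y)` (base 2). -/
def mutInfo {Ω α β : Type*} [Fintype Ω] [Fintype α] [Fintype β]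
    (p : Ω → ℝ) (X : Ω → α) (Y : Ω → β) : ℝ :=
  entRV p X + entRV p Y - entRV p (fun ω => (X ω, Y ω))

/-- Conditional mutual information `I(X;Y|Z)` (base 2). -/
def condMutInfo {Ω α β γ : Type*} [Fintype Ω] [Fintype α] [Fintype β] [Fintype γ]
    (p : Ω → ℝ) (X : Ω → α) (Y : Ω → β) (Z : Ω → γ) : ℝ :=
  entRV p (fun ω => (X ω, Z ω)) + entRV p (fun ω => (Y ω, Z ω))
    - entRV p (fun ω => (X ω, Y ω, Z ω)) - entRV p Z

/-- A two-user state-dependent discrete memoryless broadcast channel: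
state pmf `q` on `𝒲` and channel transition pmf `Q x w (y1,y2)`. -/
structure SDBC (𝒳 𝒴1 𝒴2 𝒲 : Type) [Fintype 𝒳] [Fintype 𝒴1] [Fintype 𝒴2] [Fintype 𝒲] where
  q : 𝒲 → ℝ
  q_pmf : IsPMF q
  Q : 𝒳 → 𝒲 → 𝒴1 × 𝒴2 → ℝ
  Q_nonneg : ∀ x w y, 0 ≤ Q x w y
  Q_sum : ∀ x w, ∑ y, Q x w y = 1

/-- A Class I code: deterministic encoder with noncausal knowledge of the whole
state sequence, and two separate decoders. -/
structure CodeI (𝒳 𝒴1 𝒴2 𝒲 : Type) (N K1 K2 : ℕ) where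
  enc : Fin K1 → Fin K2 → (Fin N → 𝒲) → Fin N → 𝒳
  dec1 : (Fin N → 𝒴1) → Fin K1
  dec2 : (Fin N → 𝒴2) → Fin K2

variable {𝒳 𝒴1 𝒴2 𝒲 : Type} [Fintype 𝒳] [Fintype 𝒴1] [Fintype 𝒴2] [Fintype 𝒲]

/-- Joint pmf of `(M1, M2, W^N, Y1^N, Y2^N)` induced by uniform independent messages,
the i.i.d. state, the encoder and the memoryless channel. -/
def jointI (ch : SDBC 𝒳 𝒴1 𝒴2 𝒲) {N K1 K2 : ℕ} (c : CodeI 𝒳 𝒴1 𝒴2 𝒲 N K1 K2) :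
    Fin K1 × Fin K2 × (Fin N → 𝒲) × (Fin N → 𝒴1) × (Fin N → 𝒴2) → ℝ :=
  fun ω => (K1 : ℝ)⁻¹ * (K2 : ℝ)⁻¹ * (∏ n, ch.q (ω.2.2.1 n)) *
    ∏ n, ch.Q (c.enc ω.1 ω.2.1 ω.2.2.1 n) (ω.2.2.1 n) (ω.2.2.2.1 n, ω.2.2.2.2 n)

/-- Maximal probability of decoding error of a Class I code. -/
def PeI (ch : SDBC 𝒳 𝒴1 𝒴2 𝒲) {N K1 K2 : ℕ} (c : CodeI 𝒳 𝒴1 𝒴2 𝒲 N K1 K2) : ℝ :=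
  max (∑ ω, if c.dec1 ω.2.2.2.1 ≠ ω.1 then jointI ch c ω else 0)
      (∑ ω, if c.dec2 ω.2.2.2.2 ≠ ω.2.1 then jointI ch c ω else 0)

/-- Achievability of a nonnegative rate pair for the Class I channel. -/
def AchievableI (ch : SDBC 𝒳 𝒴1 𝒴2 𝒲) (R1 R2 : ℝ) : Prop :=
  0 ≤ R1 ∧ 0 ≤ R2 ∧
    ∀ ε : ℝ, 0 < ε → ∃ N0 : ℕ, ∀ N : ℕ, N0 ≤ N →
      ∃ (K1 K2 : ℕ) (c : CodeI 𝒳 𝒴1 𝒴2 𝒲 N K1 K2),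
        (2 : ℝ) ^ ((N : ℝ) * R1) ≤ (K1 : ℝ) ∧ (2 : ℝ) ^ ((N : ℝ) * R2) ≤ (K2 : ℝ) ∧
        PeI ch c ≤ ε

/-- The capacity region `C1`: closure of the set of achievable rate pairs. -/
def CapacityI (ch : SDBC 𝒳 𝒴1 𝒴2 𝒲) : Set (ℝ × ℝ) :=
  closure {R : ℝ × ℝ | AchievableI ch R.1 R.2}

/-- The single-letter joint pmf `p(w) p(v1,v2|w) p(x|w,v1,v2) p(y1,y2|x,w)`
on `𝒲 × 𝒱1 × 𝒱2 × 𝒳 × 𝒴1 × 𝒴2` determined by auxiliary conditional pmfs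
`pV = p(v1,v2|w)` and `pX = p(x|w,v1,v2)`; this makes
`(V1,V2) → (X,W) → (Y1,Y2)` a Markov chain. -/
def jointP1 (ch : SDBC 𝒳 𝒴1 𝒴2 𝒲) {𝒱1 𝒱2 : Type}
    (pV : 𝒲 → 𝒱1 × 𝒱2 → ℝ) (pX : 𝒲 → 𝒱1 → 𝒱2 → 𝒳 → ℝ) :
    𝒲 × 𝒱1 × 𝒱2 × 𝒳 × 𝒴1 × 𝒴2 → ℝ :=
  fun ω => ch.q ω.1 * pV ω.1 (ω.2.1, ω.2.2.1) * pX ω.1 ω.2.1 ω.2.2.1 ω.2.2.2.1 *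
    ch.Q ω.2.2.2.1 ω.1 (ω.2.2.2.2.1, ω.2.2.2.2.2)


/-! ### Finite product measures -/

/-- Real-valued indicator of a proposition. -/
def ind (P : Prop) : ℝ := if P then 1 else 0

lemma ind_nonneg (P : Prop) : 0 ≤ ind P := by unfold ind; split_ifs <;> norm_num

lemma ind_le_one (P : Prop) : ind P ≤ 1 := by unfold ind; split_ifs <;> norm_num

lemma ind_true {P : Prop} (h : P) : ind P = 1 := by simp [ind, h]

lemma ind_false {P : Prop} (h : ¬ P) : ind P = 0 := by simp [ind, h]

lemma ind_le {P : Prop} {x : ℝ} (h0 : 0 ≤ x) (h : P → 1 ≤ x) : ind P ≤ x := by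
  unfold ind; split_ifs with hp
  · exact h hp
  · exact h0

/-- Product weight of a function. -/
def prodW {ι β : Type*} [Fintype ι] (p : β → ℝ) (f : ι → β) : ℝ := ∏ i, p (f i)

section prod
variable {ι β : Type*} [Fintype ι] [DecidableEq ι] [Fintype β]

lemma sum_prod_fun (g : ι → β → ℝ) :
    ∑ f : ι → β, ∏ i, g i (f i) = ∏ i, ∑ b, g i b := by
  rw [Finset.prod_univ_sum, Fintype.piFinset_univ]

lemma prodW_nonneg {p : β → ℝ} (hp : IsPMF p) (f : ι → β) : 0 ≤ prodW p f :=
  Finset.prod_nonneg fun i _ => hp.1 _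

lemma prodW_pmf {p : β → ℝ} (hp : IsPMF p) : IsPMF (prodW (ι := ι) p) := by
  refine ⟨prodW_nonneg hp, ?_⟩
  unfold prodW
  rw [sum_prod_fun]; simp [hp.2]

lemma marg_mul {p : β → ℝ} (hp : IsPMF p) {i j : ι} (hij : i ≠ j) (F H : β → ℝ) :
    ∑ f : ι → β, prodW p f * (F (f i) * H (f j)) = (∑ u, p u * F u) * ∑ v, p v * H v := by
  have h1 : ∀ f : ι → β, prodW p f * (F (f i) * H (f j)) =
      ∏ k, (p (f k) * ((if k = i then F (f k) else 1) * (if k = j then H (f k) else 1))) := by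
    intro f
    rw [Finset.prod_mul_distrib, Finset.prod_mul_distrib]
    simp [prodW]
  simp_rw [h1]
  rw [sum_prod_fun (fun k b => p b * ((if k = i then F b else 1) * (if k = j then H b else 1)))]
  have h2 : ∀ k : ι, ∑ b, p b * ((if k = i then F b else 1) * (if k = j then H b else 1)) =
      (if k = i then (∑ u, p u * F u) else 1) * (if k = j then (∑ v, p v * H v) else 1) := by
    intro k
    by_cases hk : k = i
    · subst hk; simp [hij]
    · by_cases hk' : k = j
      · subst hk'; simp [hk]
      · simp [hk, hk', hp.2]
  simp_rw [h2]
  rw [Finset.prod_mul_distrib]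
  simp

lemma marg1 {p : β → ℝ} (hp : IsPMF p) (i : ι) (F : β → ℝ) :
    ∑ f : ι → β, prodW p f * F (f i) = ∑ u, p u * F u := by
  have h1 : ∀ f : ι → β, prodW p f * F (f i) =
      ∏ k, (p (f k) * (if k = i then F (f k) else 1)) := by
    intro f
    rw [Finset.prod_mul_distrib]
    simp [prodW]
  simp_rw [h1]
  rw [sum_prod_fun (fun k b => p b * (if k = i then F b else 1))]
  have h2 : ∀ k : ι, ∑ b, p b * (if k = i then F b else 1) =
      (if k = i then (∑ u, p u * F u) else 1) := by
    intro k
    by_cases hk : k = i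
    · subst hk; simp
    · simp [hk, hp.2]
  simp_rw [h2]
  simp

lemma marg2 {p : β → ℝ} (hp : IsPMF p) {i j : ι} (hij : i ≠ j) (F : β → β → ℝ) :
    ∑ f : ι → β, prodW p f * F (f i) (f j) = ∑ u, ∑ v, p u * p v * F u v := by
  have h1 : ∀ f : ι → β, prodW p f * F (f i) (f j) =
      ∑ u, prodW p f * (ind (f i = u) * F u (f j)) := by
    intro f
    rw [← Finset.mul_sum]
    congr 1
    simp [ind]
  simp_rw [h1]
  rw [Finset.sum_comm]
  refine Finset.sum_congr rfl fun u _ => ?_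
  rw [marg_mul hp hij (fun b => ind (b = u)) (F u)]
  have : ∑ b, p b * ind (b = u) = p u := by simp [ind]
  rw [this, Finset.mul_sum]
  exact Finset.sum_congr rfl fun v _ => by ring

/-- second moment of an i.i.d. sum of centred variables -/
lemma second_moment {p : β → ℝ} (hp : IsPMF p) (h : β → ℝ) (hz : ∑ b, p b * h b = 0) :
    ∑ f : ι → β, prodW p f * (∑ k, h (f k)) ^ 2 = Fintype.card ι * ∑ b, p b * h b ^ 2 := by
  have h1 : ∀ f : ι → β, prodW p f * (∑ k, h (f k)) ^ 2 =
      ∑ k, ∑ l, prodW p f * (h (f k) * h (f l)) := by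
    intro f
    rw [sq, Finset.sum_mul_sum, Finset.mul_sum]
    simp_rw [Finset.mul_sum]
  simp_rw [h1]
  rw [Finset.sum_comm]
  have h2 : ∀ k : ι, ∑ f : ι → β, ∑ l, prodW p f * (h (f k) * h (f l)) = ∑ b, p b * h b ^ 2 := by
    intro k
    rw [Finset.sum_comm, Finset.sum_eq_single k]
    · rw [marg1 hp k (fun b => h b * h b)]
      simp_rw [sq]
    · intro l _ hl
      rw [marg_mul hp (Ne.symm hl), hz, zero_mul]
    · simp
  simp_rw [h2]
  simp

end prod

/-- One-sided typicality estimate (Chebyshev). -/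
lemma aep {Ω : Type*} [Fintype Ω] {p : Ω → ℝ} (hp : IsPMF p) (num den : Ω → ℝ)
    (hnum : ∀ ω, 0 < p ω → 0 < num ω) (hden : ∀ ω, 0 < p ω → 0 < den ω)
    (μ : ℝ) (hμ : ∑ ω, p ω * (Real.logb 2 (num ω) - Real.logb 2 (den ω)) = μ) (δ : ℝ) (hδ : 0 < δ) :
    ∃ C : ℝ, 0 ≤ C ∧ ∀ n : ℕ, 0 < n →
      ∑ f : Fin n → Ω, prodW p f *
        ind ((2 : ℝ) ^ ((n : ℝ) * (μ + δ)) * ∏ k, den (f k) ≤ ∏ k, num (f k)) ≤ C / n := by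
  set h : Ω → ℝ := fun ω => Real.logb 2 (num ω) - Real.logb 2 (den ω) - μ with hh
  have hz : ∑ ω, p ω * h ω = 0 := by
    simp only [hh, mul_sub] at hμ ⊢
    rw [Finset.sum_sub_distrib, ← Finset.sum_mul, hp.2, hμ]; ring
  refine ⟨(∑ b, p b * h b ^ 2) / δ ^ 2, ?_, ?_⟩
  · refine div_nonneg (Finset.sum_nonneg fun b _ => mul_nonneg (hp.1 b) (sq_nonneg _)) (sq_nonneg _)
  intro n hn
  have hn' : (0 : ℝ) < n := by exact_mod_cast hn
  have key : ∀ f : Fin n → Ω, prodW p f *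
        ind ((2 : ℝ) ^ ((n : ℝ) * (μ + δ)) * ∏ k, den (f k) ≤ ∏ k, num (f k)) ≤
      (prodW p f * (∑ k, h (f k)) ^ 2) * ((n * δ) ^ 2)⁻¹ := by
    intro f
    rcases (prodW_nonneg hp f).eq_or_lt with h0 | h0
    · rw [← h0]; simp
    rw [mul_assoc]
    refine mul_le_mul_of_nonneg_left (ind_le (by positivity) fun hle => ?_) h0.le
    have hpos : ∀ k, 0 < p (f k) := by
      intro k
      refine lt_of_le_of_ne (hp.1 _) fun he => h0.ne' ?_
      exact Finset.prod_eq_zero (Finset.mem_univ k) he.symm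
    have hd : 0 < ∏ k, den (f k) := Finset.prod_pos fun k _ => hden _ (hpos k)
    have hl := Real.logb_le_logb_of_le (b := 2) (by norm_num) (by positivity) hle
    rw [Real.logb_mul (by positivity) hd.ne', Real.logb_rpow (by norm_num) (by norm_num),
      Real.logb_prod _ _ fun k _ => (hden _ (hpos k)).ne',
      Real.logb_prod _ _ fun k _ => (hnum _ (hpos k)).ne'] at hl
    have hs : ∑ k, h (f k) =
        ∑ k, Real.logb 2 (num (f k)) - ∑ k, Real.logb 2 (den (f k)) - n * μ := by
      simp [hh, Finset.sum_sub_distrib]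
    have hge : n * δ ≤ ∑ k, h (f k) := by rw [hs]; linarith
    rw [← div_eq_mul_inv, one_le_div (by positivity)]
    exact pow_le_pow_left₀ (by positivity) hge 2
  refine (Finset.sum_le_sum fun f _ => key f).trans ?_
  rw [← Finset.sum_mul, second_moment hp h hz, Fintype.card_fin]
  apply le_of_eq
  field_simp


/-! ### Mutual covering -/

section cover
variable {A B : Type*} [Fintype A] [Fintype B] {L1 L2 : ℕ}

lemma pair_term {PA : A → ℝ} {PB : B → ℝ} (hA : IsPMF PA) (hB : IsPMF PB)
    (f : A → B → ℝ) (hf : ∀ a b, 0 ≤ f a b) (g : ℝ)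
    (hg : ∑ a, PA a * ∑ b, PB b * f a b = g) (hg1 : g ≤ 1)
    {c12 c1 c2 : ℝ} (h12 : 0 ≤ c12) (h1 : 0 ≤ c1) (h2 : 0 ≤ c2)
    (hf12 : ∀ a b, f a b ≤ c12) (hr1 : ∀ a, ∑ b, PB b * f a b ≤ c1)
    (hr2 : ∀ b, ∑ a, PA a * f a b ≤ c2) (i i' : Fin L1) (j j' : Fin L2) :
    ∑ α : Fin L1 → A, prodW PA α * ∑ β : Fin L2 → B, prodW PB β *
      (f (α i) (β j) * f (α i') (β j')) ≤
    g ^ 2 + ind (i = i') * c1 + ind (j = j') * c2 + ind (i = i') * ind (j = j') * c12 := by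
  set r : A → ℝ := fun a => ∑ b, PB b * f a b with hr
  have hrn : ∀ a, 0 ≤ r a := fun a => Finset.sum_nonneg fun b _ => mul_nonneg (hB.1 b) (hf a b)
  have hg2 : ∑ b, PB b * ∑ a, PA a * f a b = g := by
    rw [← hg]
    simp_rw [Finset.mul_sum]
    rw [Finset.sum_comm]
    exact Finset.sum_congr rfl fun a _ => Finset.sum_congr rfl fun b _ => by ring
  by_cases hj : j = j'
  · subst hj
    have hin : ∀ α : Fin L1 → A, ∑ β : Fin L2 → B, prodW PB β * (f (α i) (β j) * f (α i') (β j)) =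
        ∑ b, PB b * (f (α i) b * f (α i') b) := fun α =>
      marg1 hB j (fun b => f (α i) b * f (α i') b)
    simp_rw [hin]
    by_cases hi : i = i'
    · subst hi
      rw [marg1 hA i (fun a => ∑ b, PB b * (f a b * f a b))]
      have : ∑ a, PA a * ∑ b, PB b * (f a b * f a b) ≤ c12 * g := by
        rw [← hg, Finset.mul_sum]
        refine Finset.sum_le_sum fun a _ => ?_
        rw [mul_left_comm c12]
        refine mul_le_mul_of_nonneg_left ?_ (hA.1 a)
        rw [Finset.mul_sum]
        refine Finset.sum_le_sum fun b _ => ?_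
        rw [mul_left_comm c12]
        refine mul_le_mul_of_nonneg_left ?_ (hB.1 b)
        exact mul_le_mul_of_nonneg_right (hf12 a b) (hf a b)
      have h3 : c12 * g ≤ c12 := mul_le_of_le_one_right h12 hg1
      rw [show ind (i = i) = 1 from ind_true rfl, show ind True = 1 from ind_true trivial]
      nlinarith [sq_nonneg g]
    · rw [marg2 hA hi (fun a a' => ∑ b, PB b * (f a b * f a' b))]
      have : ∑ u, ∑ v, PA u * PA v * ∑ b, PB b * (f u b * f v b) =
          ∑ b, PB b * ((∑ a, PA a * f a b) * (∑ a, PA a * f a b)) := by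
        simp_rw [Finset.sum_mul_sum, Finset.mul_sum]
        rw [Finset.sum_comm' (t' := Finset.univ) (s' := fun _ => Finset.univ) (by simp)]
        rw [Finset.sum_comm]
        conv_rhs => rw [Finset.sum_comm]
        refine Finset.sum_congr rfl fun u _ => ?_
        rw [Finset.sum_comm' (t' := Finset.univ) (s' := fun _ => Finset.univ) (by simp)]
        conv_rhs => rw [Finset.sum_comm]
        rw [Finset.sum_comm]
        refine Finset.sum_congr rfl fun v _ => Finset.sum_congr rfl fun b _ => by ring
      rw [this]
      have : ∑ b, PB b * ((∑ a, PA a * f a b) * (∑ a, PA a * f a b)) ≤ c2 * g := by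
        rw [← hg2, Finset.mul_sum]
        refine Finset.sum_le_sum fun b _ => ?_
        rw [mul_left_comm c2]
        refine mul_le_mul_of_nonneg_left ?_ (hB.1 b)
        exact mul_le_mul_of_nonneg_right (hr2 b)
          (Finset.sum_nonneg fun a _ => mul_nonneg (hA.1 a) (hf a b))
      have h3 : c2 * g ≤ c2 := mul_le_of_le_one_right h2 hg1
      rw [show ind True = 1 from ind_true trivial, ind_false hi]
      nlinarith [sq_nonneg g]
  · have hin : ∀ α : Fin L1 → A, ∑ β : Fin L2 → B, prodW PB β * (f (α i) (β j) * f (α i') (β j')) =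
        r (α i) * r (α i') := fun α =>
      marg_mul hB hj (f (α i)) (f (α i'))
    simp_rw [hin]
    by_cases hi : i = i'
    · subst hi
      rw [marg1 hA i (fun a => r a * r a)]
      have : ∑ a, PA a * (r a * r a) ≤ c1 * g := by
        rw [← hg, Finset.mul_sum]
        refine Finset.sum_le_sum fun a _ => ?_
        rw [mul_left_comm c1]
        refine mul_le_mul_of_nonneg_left ?_ (hA.1 a)
        exact mul_le_mul_of_nonneg_right (hr1 a) (hrn a)
      have h3 : c1 * g ≤ c1 := mul_le_of_le_one_right h1 hg1
      rw [show ind (i = i) = 1 from ind_true rfl, ind_false hj]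
      nlinarith [sq_nonneg g]
    · rw [marg_mul hA hi, hg, ind_false hi, ind_false hj]
      apply le_of_eq; ring

lemma sum_ind_fin {L : ℕ} (i : Fin L) : ∑ i' : Fin L, ind (i = i') = 1 := by
  rw [Finset.sum_eq_single i]
  · exact ind_true rfl
  · intro b _ hb
    exact ind_false (Ne.symm hb)
  · simp

lemma covering (hL1 : 0 < L1) (hL2 : 0 < L2) {PA : A → ℝ} {PB : B → ℝ}
    (hA : IsPMF PA) (hB : IsPMF PB)
    (f : A → B → ℝ) (hf : ∀ a b, 0 ≤ f a b) (g : ℝ)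
    (hg : ∑ a, PA a * ∑ b, PB b * f a b = g) (hg1 : g ≤ 1)
    {c12 c1 c2 : ℝ} (h12 : 0 ≤ c12) (h1 : 0 ≤ c1) (h2 : 0 ≤ c2)
    (hf12 : ∀ a b, f a b ≤ c12) (hr1 : ∀ a, ∑ b, PB b * f a b ≤ c1)
    (hr2 : ∀ b, ∑ a, PA a * f a b ≤ c2) :
    ∑ α : Fin L1 → A, prodW PA α * ∑ β : Fin L2 → B, prodW PB β *
      ind (∀ i j, f (α i) (β j) = 0) ≤
    (1 - g) + (c12 / (L1 * L2) + c1 / L1 + c2 / L2) := by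
  have hl1 : (0 : ℝ) < L1 := by exact_mod_cast hL1
  have hl2 : (0 : ℝ) < L2 := by exact_mod_cast hL2
  have hg0 : 0 ≤ g := by
    rw [← hg]
    exact Finset.sum_nonneg fun a _ => mul_nonneg (hA.1 a)
      (Finset.sum_nonneg fun b _ => mul_nonneg (hB.1 b) (hf a b))
  set c : ℝ := ((L1 : ℝ) * L2)⁻¹ with hc
  -- pointwise bound
  have hpt : ∀ (α : Fin L1 → A) (β : Fin L2 → B), ind (∀ i j, f (α i) (β j) = 0) ≤
      1 - 2 * c * (∑ i, ∑ j, f (α i) (β j))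
        + c ^ 2 * ∑ i, ∑ j, ∑ i', ∑ j', f (α i) (β j) * f (α i') (β j') := by
    intro α β
    have hsq : 1 - 2 * c * (∑ i, ∑ j, f (α i) (β j))
        + c ^ 2 * ∑ i, ∑ j, ∑ i', ∑ j', f (α i) (β j) * f (α i') (β j') =
        (1 - c * ∑ i, ∑ j, f (α i) (β j)) ^ 2 := by
      have : ∑ i, ∑ j, ∑ i', ∑ j', f (α i) (β j) * f (α i') (β j') =
          (∑ i, ∑ j, f (α i) (β j)) * (∑ i, ∑ j, f (α i) (β j)) := by
        simp_rw [Finset.sum_mul, Finset.mul_sum]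
      rw [this]; ring
    rw [hsq]
    refine ind_le (sq_nonneg _) fun h => ?_
    simp [h]
  -- expectations
  have hmean : ∀ i j, ∑ α : Fin L1 → A, prodW PA α * ∑ β : Fin L2 → B, prodW PB β *
      f (α i) (β j) = g := by
    intro i j
    have : ∀ α : Fin L1 → A, ∑ β : Fin L2 → B, prodW PB β * f (α i) (β j) =
        ∑ b, PB b * f (α i) b := fun α => marg1 hB j (f (α i))
    simp_rw [this]
    rw [marg1 hA i (fun a => ∑ b, PB b * f a b), hg]
  set E : ((Fin L1 → A) → (Fin L2 → B) → ℝ) → ℝ := fun F =>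
    ∑ α : Fin L1 → A, prodW PA α * ∑ β : Fin L2 → B, prodW PB β * F α β with hE
  have Eadd : ∀ F G, E (fun α β => F α β + G α β) = E F + E G := by
    intro F G
    simp only [hE, mul_add, Finset.sum_add_distrib]
  have Esmul : ∀ (t : ℝ) F, E (fun α β => t * F α β) = t * E F := by
    intro t F
    simp only [hE, Finset.mul_sum]
    exact Finset.sum_congr rfl fun a _ => Finset.sum_congr rfl fun b _ => by ring
  have Esum : ∀ {κ : Type} [Fintype κ] (F : κ → (Fin L1 → A) → (Fin L2 → B) → ℝ),
      E (fun α β => ∑ k, F k α β) = ∑ k, E (F k) := by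
    intro κ _ F
    simp only [hE, Finset.mul_sum]
    conv_lhs =>
      enter [2, α]
      rw [Finset.sum_comm]
    rw [Finset.sum_comm]
  have Econst : E (fun _ _ => 1) = 1 := by
    simp only [hE, mul_one]
    rw [(prodW_pmf hB).2]
    simp [(prodW_pmf hA).2]
  have Emono : ∀ F G, (∀ α β, F α β ≤ G α β) → E F ≤ E G := by
    intro F G h
    exact Finset.sum_le_sum fun α _ => mul_le_mul_of_nonneg_left
      (Finset.sum_le_sum fun β _ => mul_le_mul_of_nonneg_left (h α β) (prodW_nonneg hB β))
      (prodW_nonneg hA α)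
  change E (fun α β => ind (∀ i j, f (α i) (β j) = 0)) ≤ _
  refine (Emono _ _ hpt).trans ?_
  have hrew : E (fun α β => 1 - 2 * c * (∑ i, ∑ j, f (α i) (β j))
        + c ^ 2 * ∑ i, ∑ j, ∑ i', ∑ j', f (α i) (β j) * f (α i') (β j')) =
      1 + (-(2 * c)) * (∑ i : Fin L1, ∑ j : Fin L2, g)
        + c ^ 2 * ∑ i, ∑ j, ∑ i', ∑ j', E (fun α β => f (α i) (β j) * f (α i') (β j')) := by
    have e1 : (fun (α : Fin L1 → A) (β : Fin L2 → B) => 1 - 2 * c * (∑ i, ∑ j, f (α i) (β j))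
        + c ^ 2 * ∑ i, ∑ j, ∑ i', ∑ j', f (α i) (β j) * f (α i') (β j')) =
        fun α β => (1 + (-(2 * c)) * (∑ i, ∑ j, f (α i) (β j)))
        + c ^ 2 * ∑ i, ∑ j, ∑ i', ∑ j', f (α i) (β j) * f (α i') (β j') := by
      funext α β; ring
    rw [e1, Eadd, Eadd, Esmul, Esmul, Econst]
    simp_rw [Esum]
    congr 3
    exact Finset.sum_congr rfl fun i _ => Finset.sum_congr rfl fun j _ => hmean i j
  rw [hrew]
  have hsum : ∑ i, ∑ j, ∑ i', ∑ j', E (fun α β => f (α i) (β j) * f (α i') (β j')) ≤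
      ∑ i : Fin L1, ∑ j : Fin L2, ∑ i' : Fin L1, ∑ j' : Fin L2,
      (g ^ 2 + ind (i = i') * c1 + ind (j = j') * c2 + ind (i = i') * ind (j = j') * c12) :=
    Finset.sum_le_sum fun i _ => Finset.sum_le_sum fun j _ => Finset.sum_le_sum fun i' _ =>
      Finset.sum_le_sum fun j' _ =>
        pair_term hA hB f hf g hg hg1 h12 h1 h2 hf12 hr1 hr2 i i' j j'
  have hval : ∑ i : Fin L1, ∑ j : Fin L2, ∑ i' : Fin L1, ∑ j' : Fin L2,
      (g ^ 2 + ind (i = i') * c1 + ind (j = j') * c2 + ind (i = i') * ind (j = j') * c12) =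
      (L1 * L2) ^ 2 * g ^ 2 + L1 * L2 ^ 2 * c1 + L1 ^ 2 * L2 * c2 + L1 * L2 * c12 := by
    simp only [Finset.sum_add_distrib, ← Finset.sum_mul, ← Finset.mul_sum, sum_ind_fin,
      Finset.sum_const, Finset.card_univ, Fintype.card_fin, nsmul_eq_mul, mul_one]
    ring
  rw [hval] at hsum
  have hfin := mul_le_mul_of_nonneg_left hsum (sq_nonneg c)
  have h3 : c ^ 2 * ((L1 * L2) ^ 2 * g ^ 2 + L1 * L2 ^ 2 * c1 + L1 ^ 2 * L2 * c2 + L1 * L2 * c12)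
      = g ^ 2 + (c12 / (L1 * L2) + c1 / L1 + c2 / L2) := by
    rw [hc]; field_simp; ring
  have h4 : (-(2 * c)) * (∑ i : Fin L1, ∑ j : Fin L2, g) = - 2 * g := by
    simp only [Finset.sum_const, Finset.card_univ, Fintype.card_fin, nsmul_eq_mul]
    rw [hc]; field_simp
  rw [h4]
  rw [h3] at hfin
  nlinarith

end cover


/-! ### One-shot random coding -/

lemma exists_le_of_avg {Ω : Type*} [Fintype Ω] {p : Ω → ℝ} (hp : IsPMF p) (F : Ω → ℝ) (c : ℝ)
    (h : ∑ ω, p ω * F ω ≤ c) : ∃ ω, F ω ≤ c := by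
  by_contra hcon
  push Not at hcon
  have hc : ∑ ω, p ω * c = c := by rw [← Finset.sum_mul, hp.2, one_mul]
  have hle : ∀ ω ∈ Finset.univ, p ω * c ≤ p ω * F ω := fun ω _ =>
    mul_le_mul_of_nonneg_left (hcon ω).le (hp.1 ω)
  have hex : ∃ ω ∈ (Finset.univ : Finset Ω), 0 < p ω := by
    by_contra hn
    push Not at hn
    have : ∑ ω, p ω ≤ 0 := Finset.sum_nonpos fun ω h => hn ω h
    rw [hp.2] at this
    linarith
  obtain ⟨ω, hω, hpos⟩ := hex
  have := Finset.sum_lt_sum hle ⟨ω, hω, mul_lt_mul_of_pos_left (hcon ω) hpos⟩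
  rw [hc] at this
  linarith

lemma decErr {U Y : Type*} [Fintype U] [Fintype Y] {K : ℕ} {p : U → ℝ} (hp : IsPMF p)
    (T : U → Y → Prop) (b : ℝ) (hb : ∀ y, ∑ v, p v * ind (T v y) ≤ b)
    (dec : (Fin K → U) → Y → Fin K)
    (hdec : ∀ (𝒜 : Fin K → U) y, (∃ m, T (𝒜 m) y) → T (𝒜 (dec 𝒜 y)) y)
    (D : U → Y → ℝ) (hD : ∀ u, IsPMF (D u)) (m : Fin K) :
    ∑ 𝒜 : Fin K → U, prodW p 𝒜 * ∑ y, D (𝒜 m) y * ind (dec 𝒜 y ≠ m) ≤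
      ∑ u, p u * ∑ y, D u y * ind (¬ T u y) + ((K : ℝ) - 1) * b := by
  have hpt : ∀ (𝒜 : Fin K → U) y, ind (dec 𝒜 y ≠ m) ≤ ind (¬ T (𝒜 m) y) +
      ∑ m' ∈ Finset.univ.erase m, ind (T (𝒜 m') y) := by
    intro 𝒜 y
    have hnn : 0 ≤ ∑ m' ∈ Finset.univ.erase m, ind (T (𝒜 m') y) :=
      Finset.sum_nonneg fun _ _ => ind_nonneg _
    refine ind_le (add_nonneg (ind_nonneg _) hnn) fun hne => ?_
    by_cases hT : T (𝒜 m) y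
    · have h1 := hdec 𝒜 y ⟨m, hT⟩
      have h2 : ind (T (𝒜 (dec 𝒜 y)) y) ≤ ∑ m' ∈ Finset.univ.erase m, ind (T (𝒜 m') y) :=
        Finset.single_le_sum (f := fun m' => ind (T (𝒜 m') y)) (fun _ _ => ind_nonneg _)
          (Finset.mem_erase.2 ⟨hne, Finset.mem_univ _⟩)
      rw [ind_true h1] at h2
      linarith [ind_nonneg (¬ T (𝒜 m) y)]
    · rw [ind_true hT]; linarith
  have hterm : ∀ m' ∈ (Finset.univ : Finset (Fin K)).erase m,
      ∑ 𝒜 : Fin K → U, prodW p 𝒜 * ∑ y, D (𝒜 m) y * ind (T (𝒜 m') y) ≤ b := by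
    intro m' hm'
    have hne : m ≠ m' := (Finset.ne_of_mem_erase hm').symm
    rw [marg2 hp hne (fun u v => ∑ y, D u y * ind (T v y))]
    have : ∀ u, ∑ v, p u * p v * ∑ y, D u y * ind (T v y) =
        p u * ∑ y, D u y * ∑ v, p v * ind (T v y) := by
      intro u
      simp_rw [Finset.mul_sum]
      rw [Finset.sum_comm]
      exact Finset.sum_congr rfl fun a _ => Finset.sum_congr rfl fun b _ => by ring
    simp_rw [this]
    calc ∑ u, p u * ∑ y, D u y * ∑ v, p v * ind (T v y)
        ≤ ∑ u, p u * ∑ y, D u y * b :=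
          Finset.sum_le_sum fun u _ => mul_le_mul_of_nonneg_left
            (Finset.sum_le_sum fun y _ => mul_le_mul_of_nonneg_left (hb y) ((hD u).1 y)) (hp.1 u)
      _ = b := by
          simp_rw [← Finset.sum_mul, (hD _).2, one_mul]
          rw [← Finset.sum_mul, hp.2, one_mul]
  calc ∑ 𝒜 : Fin K → U, prodW p 𝒜 * ∑ y, D (𝒜 m) y * ind (dec 𝒜 y ≠ m)
      ≤ ∑ 𝒜 : Fin K → U, prodW p 𝒜 * ∑ y, D (𝒜 m) y * (ind (¬ T (𝒜 m) y) +
          ∑ m' ∈ Finset.univ.erase m, ind (T (𝒜 m') y)) :=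
        Finset.sum_le_sum fun 𝒜 _ => mul_le_mul_of_nonneg_left
          (Finset.sum_le_sum fun y _ => mul_le_mul_of_nonneg_left (hpt 𝒜 y) ((hD _).1 y))
          (prodW_nonneg hp 𝒜)
    _ = ∑ 𝒜 : Fin K → U, prodW p 𝒜 * ∑ y, D (𝒜 m) y * ind (¬ T (𝒜 m) y) +
        ∑ m' ∈ Finset.univ.erase m,
          ∑ 𝒜 : Fin K → U, prodW p 𝒜 * ∑ y, D (𝒜 m) y * ind (T (𝒜 m') y) := by
        rw [Finset.sum_comm (s := Finset.univ.erase m), ← Finset.sum_add_distrib]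
        refine Finset.sum_congr rfl fun 𝒜 _ => ?_
        rw [← Finset.mul_sum, Finset.sum_comm, ← mul_add, ← Finset.sum_add_distrib]
        simp_rw [mul_add, Finset.mul_sum]
    _ ≤ ∑ u, p u * ∑ y, D u y * ind (¬ T u y) + ∑ m' ∈ (Finset.univ : Finset (Fin K)).erase m, b := by
        rw [marg1 hp m (fun u => ∑ y, D u y * ind (¬ T u y))]
        exact add_le_add le_rfl (Finset.sum_le_sum hterm)
    _ = _ := by
        rw [Finset.sum_const, Finset.card_erase_of_mem (Finset.mem_univ m), Finset.card_univ,
          Fintype.card_fin, nsmul_eq_mul, Nat.cast_sub (by have := m.2; omega), Nat.cast_one]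

lemma userErr {U V Y : Type*} [Fintype U] [Fintype V] [Fintype Y] {K K' : ℕ}
    {p : U → ℝ} (hp : IsPMF p) {p' : V → ℝ} (hp' : IsPMF p')
    (T : U → Y → Prop) (b : ℝ) (hb : ∀ y, ∑ v, p v * ind (T v y) ≤ b)
    (dec : (Fin K → U) → Y → Fin K)
    (hdec : ∀ (𝒜 : Fin K → U) y, (∃ m, T (𝒜 m) y) → T (𝒜 (dec 𝒜 y)) y)
    (D : U → V → Y → ℝ) (hD : ∀ u v, IsPMF (D u v)) (fail : U → V → Prop) (τ : ℝ) (hτ : 0 ≤ τ)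
    (hfail : ∀ u v, ¬ fail u v → ∑ y, D u v y * ind (¬ T u y) ≤ τ) (m : Fin K) (m' : Fin K') :
    ∑ 𝒜 : Fin K → U, ∑ ℬ : Fin K' → V, prodW p 𝒜 * prodW p' ℬ *
        ∑ y, D (𝒜 m) (ℬ m') y * ind (dec 𝒜 y ≠ m) ≤
      ∑ u, ∑ v, p u * p' v * ind (fail u v) + τ + ((K : ℝ) - 1) * b := by
  have hpt : ∀ u v, ∑ y, D u v y * ind (¬ T u y) ≤ ind (fail u v) + τ := by
    intro u v
    by_cases hf : fail u v
    · rw [ind_true hf]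
      have : ∑ y, D u v y * ind (¬ T u y) ≤ ∑ y, D u v y :=
        Finset.sum_le_sum fun y _ => mul_le_of_le_one_right ((hD u v).1 y) (ind_le_one _)
      rw [(hD u v).2] at this
      linarith
    · rw [ind_false hf, zero_add]; exact hfail u v hf
  calc ∑ 𝒜 : Fin K → U, ∑ ℬ : Fin K' → V, prodW p 𝒜 * prodW p' ℬ *
        ∑ y, D (𝒜 m) (ℬ m') y * ind (dec 𝒜 y ≠ m)
      = ∑ ℬ : Fin K' → V, prodW p' ℬ * ∑ 𝒜 : Fin K → U, prodW p 𝒜 *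
        ∑ y, D (𝒜 m) (ℬ m') y * ind (dec 𝒜 y ≠ m) := by
        rw [Finset.sum_comm]
        refine Finset.sum_congr rfl fun ℬ _ => ?_
        rw [Finset.mul_sum]
        exact Finset.sum_congr rfl fun 𝒜 _ => by ring
    _ ≤ ∑ ℬ : Fin K' → V, prodW p' ℬ *
        (∑ u, p u * ∑ y, D u (ℬ m') y * ind (¬ T u y) + ((K : ℝ) - 1) * b) :=
        Finset.sum_le_sum fun ℬ _ => mul_le_mul_of_nonneg_left
          (decErr hp T b hb dec hdec (fun u => D u (ℬ m')) (fun u => hD u _) m)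
          (prodW_nonneg hp' ℬ)
    _ = ∑ v, p' v *
        (∑ u, p u * ∑ y, D u v y * ind (¬ T u y) + ((K : ℝ) - 1) * b) :=
        marg1 hp' m' (fun v => ∑ u, p u * ∑ y, D u v y * ind (¬ T u y) + ((K : ℝ) - 1) * b)
    _ ≤ ∑ v, p' v *
        (∑ u, p u * (ind (fail u v) + τ) + ((K : ℝ) - 1) * b) :=
        Finset.sum_le_sum fun v _ => mul_le_mul_of_nonneg_left
          (add_le_add (Finset.sum_le_sum fun u _ => mul_le_mul_of_nonneg_left
            (hpt u v) (hp.1 u)) le_rfl) (hp'.1 v)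
    _ = _ := by
        simp_rw [mul_add, Finset.sum_add_distrib, ← Finset.sum_mul, hp.2, hp'.2, one_mul]
        simp_rw [mul_add, Finset.sum_add_distrib, ← Finset.sum_mul, hp'.2, one_mul]
        congr 2
        simp_rw [Finset.mul_sum]
        rw [Finset.sum_comm]
        exact Finset.sum_congr rfl fun u _ => Finset.sum_congr rfl fun v _ => by ring

lemma union_rows {A Y : Type*} [Fintype A] {L : ℕ} {PA : A → ℝ} (hA : IsPMF PA)
    (T : A → Y → Prop) (b : ℝ) (hb : ∀ y, ∑ a, PA a * ind (T a y) ≤ b) (y : Y) :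
    ∑ v : Fin L → A, prodW PA v * ind (∃ l, T (v l) y) ≤ L * b := by
  calc ∑ v : Fin L → A, prodW PA v * ind (∃ l, T (v l) y)
      ≤ ∑ v : Fin L → A, prodW PA v * ∑ l, ind (T (v l) y) := by
        refine Finset.sum_le_sum fun v _ => mul_le_mul_of_nonneg_left ?_ (prodW_nonneg hA v)
        refine ind_le (Finset.sum_nonneg fun _ _ => ind_nonneg _) ?_
        rintro ⟨l, hl⟩
        rw [← ind_true hl]
        exact Finset.single_le_sum (f := fun l => ind (T (v l) y)) (fun _ _ => ind_nonneg _)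
          (Finset.mem_univ l)
    _ = ∑ l : Fin L, ∑ v : Fin L → A, prodW PA v * ind (T (v l) y) := by
        simp_rw [Finset.mul_sum]
        rw [Finset.sum_comm]
    _ ≤ ∑ l : Fin L, b := by
        refine Finset.sum_le_sum fun l _ => ?_
        rw [marg1 hA l (fun a => ind (T a y))]
        exact hb y
    _ = L * b := by simp


lemma exists_select {A B : Type*} {L1 L2 : ℕ} (hL1 : 0 < L1) (hL2 : 0 < L2)
    (G : A → B → Prop) (α : Fin L1 → A) (β : Fin L2 → B) :
    ∃ ij : Fin L1 × Fin L2, G (α ij.1) (β ij.2) ∨ ∀ i j, ¬ G (α i) (β j) := by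
  by_cases h : ∃ i j, G (α i) (β j)
  · obtain ⟨i, j, hij⟩ := h
    exact ⟨(i, j), Or.inl hij⟩
  · push Not at h
    exact ⟨(⟨0, hL1⟩, ⟨0, hL2⟩), Or.inr h⟩

lemma exists_decoder {U Y : Type*} {K : ℕ} (hK : 0 < K) (T : U → Y → Prop) :
    ∃ dec : (Fin K → U) → Y → Fin K,
      ∀ (𝒜 : Fin K → U) y, (∃ m, T (𝒜 m) y) → T (𝒜 (dec 𝒜 y)) y := by
  have : ∀ (𝒜 : Fin K → U) y, ∃ m : Fin K, (∃ m, T (𝒜 m) y) → T (𝒜 m) y := by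
    intro 𝒜 y
    by_cases h : ∃ m, T (𝒜 m) y
    · obtain ⟨m, hm⟩ := h
      exact ⟨m, fun _ => hm⟩
    · exact ⟨⟨0, hK⟩, fun h' => absurd h' h⟩
  choose dec hdec using this
  exact ⟨dec, hdec⟩

/-- The encoder failure probability for a fixed state. -/
lemma fail_bound {A B : Type*} [Fintype A] [Fintype B] {L1 L2 : ℕ}
    (hL1 : 0 < L1) (hL2 : 0 < L2) {PA : A → ℝ} {PB : B → ℝ}
    (hA : IsPMF PA) (hB : IsPMF PB) (r : A → B → ℝ) (hr0 : ∀ a b, 0 ≤ r a b)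
    (hr1 : ∑ a, ∑ b, r a b = 1) (G : A → B → Prop)
    {c12 c1 c2 : ℝ} (h12 : 0 ≤ c12) (h1 : 0 ≤ c1) (h2 : 0 ≤ c2)
    (hG0 : ∀ a b, G a b → 0 < PA a ∧ 0 < PB b)
    (hG1 : ∀ a b, G a b → r a b ≤ c12 * (PA a * PB b))
    (hG2 : ∀ a b, G a b → ∑ b', r a b' ≤ c1 * PA a)
    (hG3 : ∀ a b, G a b → ∑ a', r a' b ≤ c2 * PB b) :
    ∑ α : Fin L1 → A, ∑ β : Fin L2 → B, prodW PA α * prodW PB β *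
      ind (∀ i j, ¬ G (α i) (β j)) ≤
    ∑ a, ∑ b, r a b * ind (¬ G a b) + (c12 / (L1 * L2) + c1 / L1 + c2 / L2) := by
  set f : A → B → ℝ := fun a b => ind (G a b) * (r a b / (PA a * PB b)) with hf
  have hfG : ∀ a b, G a b → f a b = r a b / (PA a * PB b) := fun a b h => by
    simp [hf, ind_true h]
  have hfn : ∀ a b, ¬ G a b → f a b = 0 := fun a b h => by simp [hf, ind_false h]
  have hf0 : ∀ a b, 0 ≤ f a b := fun a b => mul_nonneg (ind_nonneg _)
    (div_nonneg (hr0 a b) (mul_nonneg (hA.1 a) (hB.1 b)))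
  have hrow : ∀ a b, PB b * f a b * PA a = r a b * ind (G a b) := by
    intro a b
    by_cases h : G a b
    · obtain ⟨ha, hb⟩ := hG0 a b h
      rw [hfG a b h, ind_true h]
      field_simp
    · rw [hfn a b h, ind_false h]; ring
  have hg : ∑ a, PA a * ∑ b, PB b * f a b = ∑ a, ∑ b, r a b * ind (G a b) := by
    refine Finset.sum_congr rfl fun a _ => ?_
    rw [Finset.mul_sum]
    refine Finset.sum_congr rfl fun b _ => ?_
    rw [← hrow]; ring
  have hsplit : ∑ a, ∑ b, r a b * ind (G a b) + ∑ a, ∑ b, r a b * ind (¬ G a b) = 1 := by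
    rw [← hr1, ← Finset.sum_add_distrib]
    refine Finset.sum_congr rfl fun a _ => ?_
    rw [← Finset.sum_add_distrib]
    refine Finset.sum_congr rfl fun b _ => ?_
    by_cases h : G a b
    · rw [ind_true h, ind_false (not_not.2 h)]; ring
    · rw [ind_true h, ind_false h]; ring
  have hbad : 0 ≤ ∑ a, ∑ b, r a b * ind (¬ G a b) :=
    Finset.sum_nonneg fun a _ => Finset.sum_nonneg fun b _ => mul_nonneg (hr0 a b) (ind_nonneg _)
  have hcov := covering hL1 hL2 hA hB f hf0 _ hg (by linarith) h12 h1 h2 ?_ ?_ ?_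
  · refine le_trans ?_ (hcov.trans (by linarith))
    refine Finset.sum_le_sum fun α _ => ?_
    rw [Finset.mul_sum]
    refine Finset.sum_le_sum fun β _ => ?_
    rw [mul_assoc]
    refine mul_le_mul_of_nonneg_left (mul_le_mul_of_nonneg_left ?_ (prodW_nonneg hB β))
      (prodW_nonneg hA α)
    refine ind_le (ind_nonneg _) fun h => ?_
    rw [ind_true fun i j => hfn _ _ (h i j)]
  · intro a b
    by_cases h : G a b
    · obtain ⟨ha, hb⟩ := hG0 a b h
      rw [hfG a b h, div_le_iff₀ (mul_pos ha hb)]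
      exact hG1 a b h
    · rw [hfn a b h]; exact h12
  · intro a
    by_cases h : ∃ b, G a b
    · obtain ⟨b, hb⟩ := h
      obtain ⟨ha, -⟩ := hG0 a b hb
      refine le_of_mul_le_mul_right ?_ ha
      rw [Finset.sum_mul]
      simp_rw [hrow]
      refine le_trans (Finset.sum_le_sum fun b' _ => ?_) (hG2 a b hb)
      exact mul_le_of_le_one_right (hr0 _ _) (ind_le_one _)
    · push Not at h
      rw [Finset.sum_eq_zero fun b _ => by rw [hfn a b (h b), mul_zero]]
      exact h1
  · intro b
    by_cases h : ∃ a, G a b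
    · obtain ⟨a, ha⟩ := h
      obtain ⟨-, hb⟩ := hG0 a b ha
      refine le_of_mul_le_mul_right ?_ hb
      rw [Finset.sum_mul]
      refine le_trans (Finset.sum_le_sum fun a' _ => ?_) (hG3 a b ha)
      have := hrow a' b
      calc PA a' * f a' b * PB b = r a' b * ind (G a' b) := by rw [← this]; ring
        _ ≤ _ := mul_le_of_le_one_right (hr0 _ _) (ind_le_one _)
    · push Not at h
      rw [Finset.sum_eq_zero fun a _ => by rw [hfn a b (h a), mul_zero]]
      exact h2

lemma avg_comm {C M1 M2 W : Type*} [Fintype C] [Fintype M1] [Fintype M2] [Fintype W]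
    (P : C → ℝ) (c : ℝ) (q : W → ℝ) (F : C → M1 → M2 → W → ℝ) :
    ∑ cb, P cb * ∑ m1, ∑ m2, c * ∑ w, q w * F cb m1 m2 w =
    ∑ m1, ∑ m2, c * ∑ w, q w * ∑ cb, P cb * F cb m1 m2 w := by
  simp_rw [Finset.mul_sum]
  rw [Finset.sum_comm]
  refine Finset.sum_congr rfl fun m1 _ => ?_
  rw [Finset.sum_comm]
  refine Finset.sum_congr rfl fun m2 _ => ?_
  rw [Finset.sum_comm]
  exact Finset.sum_congr rfl fun w _ => Finset.sum_congr rfl fun cb _ => by ring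

section oneshot
variable {W A B X Y1 Y2 : Type*} [Fintype W] [Fintype A] [Fintype B] [Fintype X]
  [Fintype Y1] [Fintype Y2]

theorem oneshot {K1 K2 L1 L2 : ℕ} (hK1 : 0 < K1) (hK2 : 0 < K2) (hL1 : 0 < L1) (hL2 : 0 < L2)
    (q : W → ℝ) (hq : IsPMF q) (r : W → A → B → ℝ) (hr0 : ∀ w a b, 0 ≤ r w a b)
    (hr1 : ∀ w, ∑ a, ∑ b, r w a b = 1)
    (pX : W → A → B → X → ℝ) (hpX : ∀ w a b, IsPMF (pX w a b))
    (Q : X → W → Y1 → Y2 → ℝ) (hQ0 : ∀ x w y1 y2, 0 ≤ Q x w y1 y2)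
    (hQ1 : ∀ x w, ∑ y1, ∑ y2, Q x w y1 y2 = 1)
    {PA : A → ℝ} {PB : B → ℝ} (hA : IsPMF PA) (hB : IsPMF PB)
    (T1 : A → Y1 → Prop) (T2 : B → Y2 → Prop) (b1 b2 : ℝ)
    (hb1 : ∀ y, ∑ a, PA a * ind (T1 a y) ≤ b1) (hb2 : ∀ y, ∑ b, PB b * ind (T2 b y) ≤ b2)
    (G : W → A → B → Prop)
    {c12 c1 c2 τ η : ℝ} (h12 : 0 ≤ c12) (h1 : 0 ≤ c1) (h2 : 0 ≤ c2) (hτ : 0 ≤ τ)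
    (hG0 : ∀ w a b, G w a b → 0 < PA a ∧ 0 < PB b)
    (hG1 : ∀ w a b, G w a b → r w a b ≤ c12 * (PA a * PB b))
    (hG2 : ∀ w a b, G w a b → ∑ b', r w a b' ≤ c1 * PA a)
    (hG3 : ∀ w a b, G w a b → ∑ a', r w a' b ≤ c2 * PB b)
    (hG4 : ∀ w a b, G w a b →
      ∑ x, pX w a b x * ∑ y1, ∑ y2, Q x w y1 y2 * ind (¬ T1 a y1) ≤ τ)
    (hG5 : ∀ w a b, G w a b →
      ∑ x, pX w a b x * ∑ y1, ∑ y2, Q x w y1 y2 * ind (¬ T2 b y2) ≤ τ)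
    (hη : ∑ w, q w * ∑ a, ∑ b, r w a b * ind (¬ G w a b) ≤ η) :
    ∃ (enc : Fin K1 → Fin K2 → W → X) (dec1 : Y1 → Fin K1) (dec2 : Y2 → Fin K2),
      ∑ m1, ∑ m2, (K1 : ℝ)⁻¹ * (K2 : ℝ)⁻¹ * ∑ w, q w *
        ∑ y1, ∑ y2, Q (enc m1 m2 w) w y1 y2 * (ind (dec1 y1 ≠ m1) + ind (dec2 y2 ≠ m2)) ≤
      2 * (η + (c12 / (L1 * L2) + c1 / L1 + c2 / L2)) + 2 * τ
        + ((K1 : ℝ) - 1) * (L1 * b1) + ((K2 : ℝ) - 1) * (L2 * b2) := by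
  have hk1 : (0 : ℝ) < K1 := by exact_mod_cast hK1
  have hk2 : (0 : ℝ) < K2 := by exact_mod_cast hK2
  choose sel hsel using fun (w : W) (α : Fin L1 → A) (β : Fin L2 → B) =>
    exists_select hL1 hL2 (G w) α β
  obtain ⟨dec1, hdec1⟩ := exists_decoder (U := Fin L1 → A) hK1 (fun u y => ∃ l, T1 (u l) y)
  obtain ⟨dec2, hdec2⟩ := exists_decoder (U := Fin L2 → B) hK2 (fun u y => ∃ l, T2 (u l) y)
  set sa : W → (Fin L1 → A) → (Fin L2 → B) → A := fun w α β => α (sel w α β).1 with hsa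
  set sb : W → (Fin L1 → A) → (Fin L2 → B) → B := fun w α β => β (sel w α β).2 with hsb
  set pS : W → (Fin L1 → A) → (Fin L2 → B) → X → ℝ := fun w α β => pX w (sa w α β) (sb w α β)
    with hpS
  -- output kernels
  set D1 : W → (Fin L1 → A) → (Fin L2 → B) → Y1 → ℝ := fun w α β y1 =>
    ∑ x, pS w α β x * ∑ y2, Q x w y1 y2 with hD1
  set D2 : W → (Fin L1 → A) → (Fin L2 → B) → Y2 → ℝ := fun w α β y2 =>
    ∑ x, pS w α β x * ∑ y1, Q x w y1 y2 with hD2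
  have e1 : ∀ w α β (F : Y1 → ℝ), ∑ y, D1 w α β y * F y =
      ∑ x, pS w α β x * ∑ y1, ∑ y2, Q x w y1 y2 * F y1 := by
    intro w α β F
    simp only [hD1, Finset.sum_mul, Finset.mul_sum]
    rw [Finset.sum_comm]
    simp_rw [mul_assoc]
  have e2 : ∀ w α β (F : Y2 → ℝ), ∑ y, D2 w α β y * F y =
      ∑ x, pS w α β x * ∑ y1, ∑ y2, Q x w y1 y2 * F y2 := by
    intro w α β F
    simp only [hD2, Finset.sum_mul, Finset.mul_sum]
    rw [Finset.sum_comm]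
    refine Finset.sum_congr rfl fun x _ => ?_
    rw [Finset.sum_comm]
    simp_rw [mul_assoc]
  have hD1p : ∀ w α β, IsPMF (D1 w α β) := by
    intro w α β
    refine ⟨fun y => Finset.sum_nonneg fun x _ => mul_nonneg ((hpX _ _ _).1 x)
      (Finset.sum_nonneg fun y2 _ => hQ0 _ _ _ _), ?_⟩
    have := e1 w α β (fun _ => 1)
    simp only [mul_one] at this
    rw [this]
    simp_rw [hQ1, mul_one]
    exact (hpX _ _ _).2
  have hD2p : ∀ w α β, IsPMF (D2 w α β) := by
    intro w α β
    refine ⟨fun y => Finset.sum_nonneg fun x _ => mul_nonneg ((hpX _ _ _).1 x)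
      (Finset.sum_nonneg fun y2 _ => hQ0 _ _ _ _), ?_⟩
    have := e2 w α β (fun _ => 1)
    simp only [mul_one] at this
    rw [this]
    simp_rw [hQ1, mul_one]
    exact (hpX _ _ _).2
  set fail : W → (Fin L1 → A) → (Fin L2 → B) → Prop := fun w α β => ∀ i j, ¬ G w (α i) (β j)
    with hfail
  have hgood : ∀ w α β, ¬ fail w α β → G w (sa w α β) (sb w α β) := fun w α β h =>
    (hsel w α β).resolve_right h
  set V : ℝ := c12 / (L1 * L2) + c1 / L1 + c2 / L2 with hV
  set Φ : W → ℝ := fun w => ∑ a, ∑ b, r w a b * ind (¬ G w a b) with hΦ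
  have hF : ∀ w, ∑ α : Fin L1 → A, ∑ β : Fin L2 → B, prodW PA α * prodW PB β *
      ind (fail w α β) ≤ Φ w + V := fun w =>
    fail_bound hL1 hL2 hA hB (r w) (hr0 w) (hr1 w) (G w) h12 h1 h2 (hG0 w) (hG1 w) (hG2 w) (hG3 w)
  have hu1 : ∀ w m1 m2, ∑ 𝒜 : Fin K1 → Fin L1 → A, ∑ ℬ : Fin K2 → Fin L2 → B,
      prodW (prodW PA) 𝒜 * prodW (prodW PB) ℬ *
        ∑ y, D1 w (𝒜 m1) (ℬ m2) y * ind (dec1 𝒜 y ≠ m1) ≤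
      Φ w + V + τ + ((K1 : ℝ) - 1) * (L1 * b1) := by
    intro w m1 m2
    refine (userErr (prodW_pmf hA) (prodW_pmf hB) (fun u y => ∃ l, T1 (u l) y) (L1 * b1)
      (union_rows hA T1 b1 hb1) dec1 hdec1 (D1 w) (hD1p w) (fail w) τ hτ ?_ m1 m2).trans ?_
    · intro α β h
      rw [e1]
      refine le_trans ?_ (hG4 w _ _ (hgood w α β h))
      refine Finset.sum_le_sum fun x _ => mul_le_mul_of_nonneg_left ?_ ((hpX _ _ _).1 x)
      refine Finset.sum_le_sum fun y1 _ => Finset.sum_le_sum fun y2 _ =>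
        mul_le_mul_of_nonneg_left ?_ (hQ0 _ _ _ _)
      refine ind_le (ind_nonneg _) fun hn => ?_
      rw [ind_true fun ht => hn ⟨_, ht⟩]
    · have := hF w
      gcongr
  have hu2 : ∀ w m1 m2, ∑ 𝒜 : Fin K1 → Fin L1 → A, ∑ ℬ : Fin K2 → Fin L2 → B,
      prodW (prodW PA) 𝒜 * prodW (prodW PB) ℬ *
        ∑ y, D2 w (𝒜 m1) (ℬ m2) y * ind (dec2 ℬ y ≠ m2) ≤
      Φ w + V + τ + ((K2 : ℝ) - 1) * (L2 * b2) := by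
    intro w m1 m2
    have := userErr (prodW_pmf hB) (prodW_pmf hA) (fun u y => ∃ l, T2 (u l) y) (L2 * b2)
      (union_rows hB T2 b2 hb2) dec2 hdec2 (fun β α => D2 w α β) (fun β α => hD2p w α β)
      (fun β α => fail w α β) τ hτ ?_ m2 m1
    · rw [Finset.sum_comm]
      have hF' := hF w
      rw [Finset.sum_comm] at hF'
      simp only [mul_comm (prodW (prodW PA) _) (prodW (prodW PB) _)]
      simp only [mul_comm (prodW PA _) (prodW PB _)] at hF'
      refine this.trans ?_
      gcongr
    · intro β α h
      rw [e2]
      refine le_trans ?_ (hG5 w _ _ (hgood w α β h))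
      refine Finset.sum_le_sum fun x _ => mul_le_mul_of_nonneg_left ?_ ((hpX _ _ _).1 x)
      refine Finset.sum_le_sum fun y1 _ => Finset.sum_le_sum fun y2 _ =>
        mul_le_mul_of_nonneg_left ?_ (hQ0 _ _ _ _)
      refine ind_le (ind_nonneg _) fun hn => ?_
      rw [ind_true fun ht => hn ⟨_, ht⟩]
  -- codebook average
  set Bd : ℝ := 2 * (η + V) + 2 * τ
        + ((K1 : ℝ) - 1) * (L1 * b1) + ((K2 : ℝ) - 1) * (L2 * b2) with hBd
  set S : ((Fin K1 → Fin L1 → A) × (Fin K2 → Fin L2 → B)) → ℝ := fun cb =>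
    ∑ m1, ∑ m2, (K1 : ℝ)⁻¹ * (K2 : ℝ)⁻¹ * ∑ w, q w *
      (∑ y, D1 w (cb.1 m1) (cb.2 m2) y * ind (dec1 cb.1 y ≠ m1) +
       ∑ y, D2 w (cb.1 m1) (cb.2 m2) y * ind (dec2 cb.2 y ≠ m2)) with hS
  set P : ((Fin K1 → Fin L1 → A) × (Fin K2 → Fin L2 → B)) → ℝ := fun cb =>
    prodW (prodW PA) cb.1 * prodW (prodW PB) cb.2 with hP
  have hPp : IsPMF P := by
    refine ⟨fun cb => mul_nonneg (prodW_nonneg (prodW_pmf hA) _) (prodW_nonneg (prodW_pmf hB) _), ?_⟩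
    rw [Fintype.sum_prod_type]
    simp only [hP, ← Finset.mul_sum]
    rw [(prodW_pmf (prodW_pmf hB)).2]
    simp [(prodW_pmf (prodW_pmf hA)).2]
  have hES : ∑ cb, P cb * S cb ≤ Bd := by
    have hcomm : ∑ cb, P cb * S cb = ∑ m1, ∑ m2, (K1 : ℝ)⁻¹ * (K2 : ℝ)⁻¹ * ∑ w, q w *
        (∑ cb, P cb * (∑ y, D1 w (cb.1 m1) (cb.2 m2) y * ind (dec1 cb.1 y ≠ m1)) +
         ∑ cb, P cb * (∑ y, D2 w (cb.1 m1) (cb.2 m2) y * ind (dec2 cb.2 y ≠ m2))) := by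
      simp_rw [← Finset.sum_add_distrib, ← mul_add]
      exact avg_comm P _ q (fun cb m1 m2 w =>
        ∑ y, D1 w (cb.1 m1) (cb.2 m2) y * ind (dec1 cb.1 y ≠ m1) +
        ∑ y, D2 w (cb.1 m1) (cb.2 m2) y * ind (dec2 cb.2 y ≠ m2))
    rw [hcomm]
    have hinner : ∀ m1 m2, ∑ w, q w *
        (∑ cb, P cb * (∑ y, D1 w (cb.1 m1) (cb.2 m2) y * ind (dec1 cb.1 y ≠ m1)) +
         ∑ cb, P cb * (∑ y, D2 w (cb.1 m1) (cb.2 m2) y * ind (dec2 cb.2 y ≠ m2))) ≤ Bd := by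
      intro m1 m2
      calc _ ≤ ∑ w, q w * ((Φ w + V + τ + ((K1 : ℝ) - 1) * (L1 * b1)) +
              (Φ w + V + τ + ((K2 : ℝ) - 1) * (L2 * b2))) := by
            refine Finset.sum_le_sum fun w _ => mul_le_mul_of_nonneg_left ?_ (hq.1 w)
            rw [Fintype.sum_prod_type, Fintype.sum_prod_type]
            exact add_le_add (hu1 w m1 m2) (hu2 w m1 m2)
        _ = 2 * (∑ w, q w * Φ w) + (∑ w, q w) * (2 * V + 2 * τ
              + ((K1 : ℝ) - 1) * (L1 * b1) + ((K2 : ℝ) - 1) * (L2 * b2)) := by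
            rw [Finset.mul_sum, Finset.sum_mul, ← Finset.sum_add_distrib]
            exact Finset.sum_congr rfl fun w _ => by ring
        _ ≤ Bd := by
            rw [hq.2, hBd]; linarith
    calc _ ≤ ∑ m1 : Fin K1, ∑ m2 : Fin K2, (K1 : ℝ)⁻¹ * (K2 : ℝ)⁻¹ * Bd :=
          Finset.sum_le_sum fun m1 _ => Finset.sum_le_sum fun m2 _ =>
            mul_le_mul_of_nonneg_left (hinner m1 m2) (by positivity)
      _ = Bd := by
          simp only [Finset.sum_const, Finset.card_univ, Fintype.card_fin, nsmul_eq_mul]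
          field_simp
  obtain ⟨cb, hcb⟩ := exists_le_of_avg hPp S Bd hES
  -- derandomise the channel input
  have hx : ∀ m1 m2 w, ∃ x : X,
      ∑ y1, ∑ y2, Q x w y1 y2 * (ind (dec1 cb.1 y1 ≠ m1) + ind (dec2 cb.2 y2 ≠ m2)) ≤
      (∑ y, D1 w (cb.1 m1) (cb.2 m2) y * ind (dec1 cb.1 y ≠ m1) +
       ∑ y, D2 w (cb.1 m1) (cb.2 m2) y * ind (dec2 cb.2 y ≠ m2)) := by
    intro m1 m2 w
    refine exists_le_of_avg (p := pS w (cb.1 m1) (cb.2 m2)) (hpX _ _ _) (fun x => _) _ ?_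
    rw [e1, e2, ← Finset.sum_add_distrib]
    apply le_of_eq
    refine Finset.sum_congr rfl fun x _ => ?_
    rw [← mul_add]
    congr 1
    simp_rw [mul_add, Finset.sum_add_distrib]
  choose enc henc using hx
  refine ⟨enc, dec1 cb.1, dec2 cb.2, le_trans ?_ hcb⟩
  exact Finset.sum_le_sum fun m1 _ => Finset.sum_le_sum fun m2 _ =>
    mul_le_mul_of_nonneg_left (Finset.sum_le_sum fun w _ =>
      mul_le_mul_of_nonneg_left (henc m1 m2 w) (hq.1 w)) (by positivity)

end oneshot


/-! ### Entropy and marginals -/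

section ent
variable {Ω α β : Type*} [Fintype Ω] [Fintype α] [Fintype β]

lemma dist_nonneg' {p : Ω → ℝ} (hp : IsPMF p) (X : Ω → α) (a : α) : 0 ≤ distRV p X a :=
  Finset.sum_nonneg fun ω _ => by split_ifs; exacts [hp.1 ω, le_rfl]

lemma dist_pos' {p : Ω → ℝ} (hp : IsPMF p) (X : Ω → α) (ω : Ω) (h : 0 < p ω) :
    0 < distRV p X (X ω) := by
  refine h.trans_le ?_
  have := Finset.single_le_sum (f := fun ω' => if X ω' = X ω then p ω' else 0)
    (fun ω' _ => by split_ifs; exacts [hp.1 ω', le_rfl]) (Finset.mem_univ ω)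
  simpa [distRV] using this

lemma sum_dist (p : Ω → ℝ) (X : Ω → α) (F : α → ℝ) :
    ∑ a, distRV p X a * F a = ∑ ω, p ω * F (X ω) := by
  unfold distRV
  simp_rw [Finset.sum_mul]
  rw [Finset.sum_comm]
  refine Finset.sum_congr rfl fun ω _ => ?_
  simp [ite_mul]

lemma dist_pmf {p : Ω → ℝ} (hp : IsPMF p) (X : Ω → α) : IsPMF (distRV p X) := by
  refine ⟨dist_nonneg' hp X, ?_⟩
  have := sum_dist p X (fun _ => 1)
  simpa [hp.2] using this

lemma sum_log (p : Ω → ℝ) (X : Ω → α) :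
    ∑ ω, p ω * Real.logb 2 (distRV p X (X ω)) = - entRV p X := by
  rw [← sum_dist p X (fun a => Real.logb 2 (distRV p X a))]
  simp [entRV, entPMF]

lemma dist_marg (p : Ω → ℝ) (X : Ω → α) (Y : Ω → β) (y : β) :
    ∑ a, distRV p (fun ω => (X ω, Y ω)) (a, y) = distRV p Y y := by
  unfold distRV
  rw [Finset.sum_comm]
  refine Finset.sum_congr rfl fun ω _ => ?_
  simp only [Prod.mk.injEq]
  by_cases h : Y ω = y <;> simp [h]

lemma mutInfo_eq (p : Ω → ℝ) (X : Ω → α) (Y : Ω → β) :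
    ∑ ω, p ω * (Real.logb 2 (distRV p (fun ω => (X ω, Y ω)) (X ω, Y ω)) -
      Real.logb 2 (distRV p X (X ω)) - Real.logb 2 (distRV p Y (Y ω))) = mutInfo p X Y := by
  simp_rw [mul_sub, Finset.sum_sub_distrib]
  rw [sum_log p X, sum_log p Y, sum_log p (fun ω => (X ω, Y ω))]
  unfold mutInfo
  ring

lemma mutInfo_nonneg {p : Ω → ℝ} (hp : IsPMF p) (X : Ω → α) (Y : Ω → β) :
    0 ≤ mutInfo p X Y := by
  rw [← mutInfo_eq]
  set d := distRV p (fun ω => (X ω, Y ω)) with hd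
  have hl : 0 < Real.log 2 := Real.log_pos (by norm_num)
  have key : ∀ ω, p ω * (1 - distRV p X (X ω) * distRV p Y (Y ω) / d (X ω, Y ω)) / Real.log 2 ≤
      p ω * (Real.logb 2 (d (X ω, Y ω)) -
      Real.logb 2 (distRV p X (X ω)) - Real.logb 2 (distRV p Y (Y ω))) := by
    intro ω
    rcases (hp.1 ω).eq_or_lt with h0 | h0
    · rw [← h0]; simp
    have h1 := dist_pos' hp X ω h0
    have h2 := dist_pos' hp Y ω h0
    have h3 : 0 < d (X ω, Y ω) := dist_pos' hp (fun ω => (X ω, Y ω)) ω h0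
    rw [mul_div_assoc]
    refine mul_le_mul_of_nonneg_left ?_ h0.le
    have h4 := Real.log_le_sub_one_of_pos (div_pos (mul_pos h1 h2) h3)
    rw [Real.log_div (mul_pos h1 h2).ne' h3.ne', Real.log_mul h1.ne' h2.ne'] at h4
    rw [div_le_iff₀ hl]
    simp only [Real.logb]
    rw [sub_mul, sub_mul, div_mul_cancel₀ _ hl.ne', div_mul_cancel₀ _ hl.ne',
      div_mul_cancel₀ _ hl.ne']
    linarith
  refine le_trans ?_ (Finset.sum_le_sum fun ω _ => key ω)
  rw [← Finset.sum_div]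
  refine div_nonneg ?_ hl.le
  simp_rw [mul_sub, mul_one, Finset.sum_sub_distrib]
  rw [hp.2, ← sum_dist p (fun ω => (X ω, Y ω))
    (fun z => distRV p X z.1 * distRV p Y z.2 / d z), Fintype.sum_prod_type]
  have : ∑ x, ∑ y, distRV p (fun ω => (X ω, Y ω)) (x, y) *
      (distRV p X x * distRV p Y y / d (x, y)) ≤ ∑ x, ∑ y, distRV p X x * distRV p Y y := by
    refine Finset.sum_le_sum fun x _ => Finset.sum_le_sum fun y _ => ?_
    rw [← hd]
    have h1 := mul_nonneg (dist_nonneg' hp X x) (dist_nonneg' hp Y y)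
    rcases eq_or_ne (d (x, y)) 0 with h0 | h0
    · rw [h0, zero_mul]; exact h1
    · rw [mul_div_cancel₀ _ h0]
  simp_rw [← Finset.mul_sum, (dist_pmf hp Y).2, mul_one] at this
  rw [(dist_pmf hp X).2] at this
  linarith

/-- packing bound -/
lemma packing {p : Ω → ℝ} (hp : IsPMF p) (X : Ω → α) (Y : Ω → β) {n : ℕ} (t : ℝ) (ht : 0 ≤ t)
    (y : Fin n → β) :
    ∑ a : Fin n → α, prodW (distRV p X) a *
      ind (¬ (t * ∏ k, distRV p (fun ω => (X ω, Y ω)) (a k, y k) ≤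
        ∏ k, (distRV p X (a k) * distRV p Y (y k)))) ≤ t := by
  set d := distRV p (fun ω => (X ω, Y ω)) with hd
  have hdn : ∀ z, 0 ≤ d z := dist_nonneg' hp _
  have hY0 : 0 ≤ ∏ k, distRV p Y (y k) := Finset.prod_nonneg fun k _ => dist_nonneg' hp Y _
  have hm : ∑ a : Fin n → α, ∏ k, d (a k, y k) = ∏ k, distRV p Y (y k) := by
    rw [sum_prod_fun (fun k a => d (a, y k))]
    exact Finset.prod_congr rfl fun k _ => dist_marg p X Y (y k)
  rcases hY0.eq_or_lt with h0 | h0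
  · rw [Finset.sum_eq_zero]
    · exact ht
    intro a _
    have : ∏ k, d (a k, y k) = 0 := by
      have h1 := Finset.single_le_sum (f := fun a : Fin n → α => ∏ k, d (a k, y k))
        (fun a _ => Finset.prod_nonneg fun k _ => hdn _) (Finset.mem_univ a)
      rw [hm, ← h0] at h1
      exact le_antisymm h1 (Finset.prod_nonneg fun k _ => hdn _)
    rw [ind_false, mul_zero]
    rw [not_not, this, mul_zero]
    exact Finset.prod_nonneg fun k _ => mul_nonneg (dist_nonneg' hp X _) (dist_nonneg' hp Y _)
  · refine le_of_mul_le_mul_right ?_ h0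
    rw [Finset.sum_mul, ← hm, Finset.mul_sum, hm]
    refine Finset.sum_le_sum fun a _ => ?_
    by_cases h : t * ∏ k, d (a k, y k) ≤ ∏ k, (distRV p X (a k) * distRV p Y (y k))
    · rw [ind_false (not_not.2 h), mul_zero, zero_mul]
      exact mul_nonneg ht (Finset.prod_nonneg fun k _ => hdn _)
    · rw [ind_true h, mul_one]
      rw [not_le, Finset.prod_mul_distrib] at h
      exact h.le

end ent

lemma sum_fun_prod {ι α β : Type*} [Fintype ι] [DecidableEq ι] [Fintype α] [Fintype β]
    (F : (ι → α × β) → ℝ) :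
    ∑ f : ι → α × β, F f = ∑ a : ι → α, ∑ b : ι → β, F (fun i => (a i, b i)) := by
  rw [← Fintype.sum_prod_type' (f := fun (a : ι → α) (b : ι → β) => F (fun i => (a i, b i)))]
  exact Fintype.sum_equiv (Equiv.arrowProdEquivProdArrow ι (fun _ => α) (fun _ => β)) _ _
    (fun f => rfl)


/-! ### The memoryless setting -/

section core
variable (ch : SDBC 𝒳 𝒴1 𝒴2 𝒲) {𝒱1 𝒱2 : Type} [Fintype 𝒱1] [Fintype 𝒱2]
  (pV : 𝒲 → 𝒱1 × 𝒱2 → ℝ) (pX : 𝒲 → 𝒱1 → 𝒱2 → 𝒳 → ℝ)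

lemma Q_sum' (x : 𝒳) (w : 𝒲) : ∑ y1, ∑ y2, ch.Q x w (y1, y2) = 1 := by
  rw [← ch.Q_sum x w, Fintype.sum_prod_type]

lemma pV_sum' (hpV : ∀ w, IsPMF (pV w)) (w : 𝒲) : ∑ a, ∑ b, pV w (a, b) = 1 := by
  rw [← (hpV w).2, Fintype.sum_prod_type]

lemma sum_jointP1 (F : 𝒲 → 𝒱1 → 𝒱2 → ℝ) (hpX : ∀ w v1 v2, IsPMF (pX w v1 v2)) :
    ∑ ω, jointP1 ch pV pX ω * F ω.1 ω.2.1 ω.2.2.1 =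
      ∑ w, ∑ a, ∑ b, ch.q w * pV w (a, b) * F w a b := by
  simp only [Fintype.sum_prod_type, jointP1]
  refine Finset.sum_congr rfl fun w _ => Finset.sum_congr rfl fun a _ =>
    Finset.sum_congr rfl fun b _ => ?_
  simp_rw [← Finset.sum_mul, ← Finset.mul_sum, Q_sum', mul_one, ← Finset.mul_sum, (hpX _ _ _).2,
    mul_one]

lemma jointP1_pmf (hpV : ∀ w, IsPMF (pV w)) (hpX : ∀ w v1 v2, IsPMF (pX w v1 v2)) :
    IsPMF (jointP1 ch pV pX) := by
  constructor
  · intro ω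
    exact mul_nonneg (mul_nonneg (mul_nonneg (ch.q_pmf.1 _) ((hpV _).1 _)) ((hpX _ _ _).1 _))
      (ch.Q_nonneg _ _ _)
  · have := sum_jointP1 ch pV pX (fun _ _ _ => 1) hpX
    simp only [mul_one] at this
    rw [this]
    simp_rw [← Finset.mul_sum, pV_sum' pV hpV, mul_one]
    exact ch.q_pmf.2

lemma dist_eq_sum {Ω α : Type*} [Fintype Ω] (p : Ω → ℝ) (X : Ω → α) (a : α) :
    distRV p X a = ∑ ω, p ω * ind (X ω = a) := by
  unfold distRV ind
  refine Finset.sum_congr rfl fun ω _ => ?_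
  split_ifs <;> simp

lemma dist_W (hpV : ∀ w, IsPMF (pV w)) (hpX : ∀ w v1 v2, IsPMF (pX w v1 v2)) (w : 𝒲) :
    distRV (jointP1 ch pV pX) (fun ω => ω.1) w = ch.q w := by
  rw [dist_eq_sum, sum_jointP1 ch pV pX (fun w' _ _ => ind (w' = w)) hpX]
  simp_rw [← Finset.sum_mul, ← Finset.mul_sum, pV_sum' pV hpV]
  simp [ind]

lemma dist_ABW (hpX : ∀ w v1 v2, IsPMF (pX w v1 v2)) (a : 𝒱1) (b : 𝒱2)
    (w : 𝒲) :
    distRV (jointP1 ch pV pX) (fun ω => ((ω.2.1, ω.2.2.1), ω.1)) ((a, b), w) =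
      ch.q w * pV w (a, b) := by
  rw [dist_eq_sum,
    sum_jointP1 ch pV pX (fun w' a' b' => ind (((a', b'), w') = ((a, b), w))) hpX,
    Finset.sum_eq_single w, Finset.sum_eq_single a, Finset.sum_eq_single b]
  · simp [ind]
  all_goals simp +contextual [ind]

lemma dist_AW (hpX : ∀ w v1 v2, IsPMF (pX w v1 v2)) (a : 𝒱1)
    (w : 𝒲) :
    distRV (jointP1 ch pV pX) (fun ω => (ω.2.1, ω.1)) (a, w) =
      ch.q w * ∑ b, pV w (a, b) := by
  rw [dist_eq_sum,
    sum_jointP1 ch pV pX (fun w' a' b' => ind ((a', w') = (a, w))) hpX,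
    Finset.sum_eq_single w, Finset.sum_eq_single a, Finset.mul_sum]
  · simp [ind]
  all_goals simp +contextual [ind]

lemma dist_BW (hpX : ∀ w v1 v2, IsPMF (pX w v1 v2)) (b : 𝒱2)
    (w : 𝒲) :
    distRV (jointP1 ch pV pX) (fun ω => (ω.2.2.1, ω.1)) (b, w) =
      ch.q w * ∑ a, pV w (a, b) := by
  rw [dist_eq_sum,
    sum_jointP1 ch pV pX (fun w' a' b' => ind ((b', w') = (b, w))) hpX,
    Finset.sum_eq_single w, Finset.mul_sum]
  · refine Finset.sum_congr rfl fun a _ => ?_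
    rw [Finset.sum_eq_single b]
    · simp [ind]
    all_goals simp +contextual [ind]
  all_goals simp +contextual [ind]

/-! n-fold quantities -/

/-- n-fold conditional law of the auxiliaries. -/
def rn {n : ℕ} (w : Fin n → 𝒲) (a : Fin n → 𝒱1) (b : Fin n → 𝒱2) : ℝ :=
  ∏ k, pV (w k) (a k, b k)

/-- n-fold conditional law of the input. -/
def xn {n : ℕ} (w : Fin n → 𝒲) (a : Fin n → 𝒱1) (b : Fin n → 𝒱2) (x : Fin n → 𝒳) : ℝ :=
  ∏ k, pX (w k) (a k) (b k) (x k)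

/-- n-fold channel. -/
def Qn {n : ℕ} (x : Fin n → 𝒳) (w : Fin n → 𝒲) (y1 : Fin n → 𝒴1) (y2 : Fin n → 𝒴2) : ℝ :=
  ∏ k, ch.Q (x k) (w k) (y1 k, y2 k)

lemma rn_sum {n : ℕ} (hpV : ∀ w, IsPMF (pV w)) (w : Fin n → 𝒲) :
    ∑ a, ∑ b, rn pV w a b = 1 := by
  unfold rn
  rw [← sum_fun_prod (fun f : Fin n → 𝒱1 × 𝒱2 => ∏ k, pV (w k) (f k)),
    sum_prod_fun (fun k z => pV (w k) z)]
  simp [(hpV _).2]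

lemma Qn_sum {n : ℕ} (x : Fin n → 𝒳) (w : Fin n → 𝒲) : ∑ y1, ∑ y2, Qn ch x w y1 y2 = 1 := by
  unfold Qn
  rw [← sum_fun_prod (fun f : Fin n → 𝒴1 × 𝒴2 => ∏ k, ch.Q (x k) (w k) (f k)),
    sum_prod_fun (fun k z => ch.Q (x k) (w k) z)]
  simp [ch.Q_sum]

lemma xn_pmf {n : ℕ} (hpX : ∀ w v1 v2, IsPMF (pX w v1 v2)) (w : Fin n → 𝒲) (a : Fin n → 𝒱1)
    (b : Fin n → 𝒱2) : IsPMF (xn pX w a b) := by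
  refine ⟨fun x => Finset.prod_nonneg fun k _ => (hpX _ _ _).1 _, ?_⟩
  unfold xn
  rw [sum_prod_fun (fun k z => pX (w k) (a k) (b k) z)]
  simp [(hpX _ _ _).2]

lemma sum_nfold {n : ℕ} (F : (Fin n → 𝒲) → (Fin n → 𝒱1) → (Fin n → 𝒱2) → (Fin n → 𝒴1) →
      (Fin n → 𝒴2) → ℝ) :
    ∑ f : Fin n → 𝒲 × 𝒱1 × 𝒱2 × 𝒳 × 𝒴1 × 𝒴2, prodW (jointP1 ch pV pX) f *
      F (fun k => (f k).1) (fun k => (f k).2.1) (fun k => (f k).2.2.1)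
        (fun k => (f k).2.2.2.2.1) (fun k => (f k).2.2.2.2.2) =
    ∑ w, prodW ch.q w * ∑ a, ∑ b, rn pV w a b * ∑ x, xn pX w a b x *
      ∑ y1, ∑ y2, Qn ch x w y1 y2 * F w a b y1 y2 := by
  rw [sum_fun_prod]
  refine Finset.sum_congr rfl fun w _ => ?_
  rw [sum_fun_prod, Finset.mul_sum]
  refine Finset.sum_congr rfl fun a _ => ?_
  rw [sum_fun_prod, Finset.mul_sum]
  refine Finset.sum_congr rfl fun b _ => ?_
  rw [sum_fun_prod]
  simp_rw [Finset.mul_sum]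
  refine Finset.sum_congr rfl fun x _ => ?_
  rw [sum_fun_prod]
  refine Finset.sum_congr rfl fun y1 _ => Finset.sum_congr rfl fun y2 _ => ?_
  simp only [prodW, jointP1, rn, xn, Qn, Finset.prod_mul_distrib]
  ring

lemma sum_nfold' {n : ℕ} (hpX : ∀ w v1 v2, IsPMF (pX w v1 v2))
    (F : (Fin n → 𝒲) → (Fin n → 𝒱1) → (Fin n → 𝒱2) → ℝ) :
    ∑ f : Fin n → 𝒲 × 𝒱1 × 𝒱2 × 𝒳 × 𝒴1 × 𝒴2, prodW (jointP1 ch pV pX) f *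
      F (fun k => (f k).1) (fun k => (f k).2.1) (fun k => (f k).2.2.1) =
    ∑ w, prodW ch.q w * ∑ a, ∑ b, rn pV w a b * F w a b := by
  rw [sum_nfold ch pV pX (fun w a b _ _ => F w a b)]
  simp_rw [← Finset.sum_mul, Qn_sum, one_mul, ← Finset.sum_mul, (xn_pmf pX hpX _ _ _).2, one_mul]

lemma PeI_le {N K1 K2 : ℕ} (c : CodeI 𝒳 𝒴1 𝒴2 𝒲 N K1 K2) :
    PeI ch c ≤ ∑ m1, ∑ m2, (K1 : ℝ)⁻¹ * (K2 : ℝ)⁻¹ * ∑ w, prodW ch.q w *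
        ∑ y1, ∑ y2, Qn ch (c.enc m1 m2 w) w y1 y2 *
          (ind (c.dec1 y1 ≠ m1) + ind (c.dec2 y2 ≠ m2)) := by
  have hnn : ∀ ω, 0 ≤ jointI ch c ω := fun ω =>
    mul_nonneg (mul_nonneg (by positivity) (Finset.prod_nonneg fun _ _ => ch.q_pmf.1 _))
      (Finset.prod_nonneg fun _ _ => ch.Q_nonneg _ _ _)
  have htot : ∑ m1, ∑ m2, (K1 : ℝ)⁻¹ * (K2 : ℝ)⁻¹ * ∑ w, prodW ch.q w *
        ∑ y1, ∑ y2, Qn ch (c.enc m1 m2 w) w y1 y2 *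
          (ind (c.dec1 y1 ≠ m1) + ind (c.dec2 y2 ≠ m2)) =
      ∑ ω, jointI ch c ω * (ind (c.dec1 ω.2.2.2.1 ≠ ω.1) + ind (c.dec2 ω.2.2.2.2 ≠ ω.2.1)) := by
    simp only [Fintype.sum_prod_type, Finset.mul_sum]
    refine Finset.sum_congr rfl fun m1 _ => Finset.sum_congr rfl fun m2 _ =>
      Finset.sum_congr rfl fun w _ => Finset.sum_congr rfl fun y1 _ =>
      Finset.sum_congr rfl fun y2 _ => ?_
    simp only [jointI, Qn, prodW]
    ring
  rw [htot]
  unfold PeI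
  refine max_le ?_ ?_
  · refine Finset.sum_le_sum fun ω _ => ?_
    have h2 := mul_nonneg (hnn ω) (ind_nonneg (c.dec2 ω.2.2.2.2 ≠ ω.2.1))
    rw [mul_add]
    split_ifs with h
    · rw [ind_true h]; linarith
    · rw [ind_false h]; linarith
  · refine Finset.sum_le_sum fun ω _ => ?_
    have h2 := mul_nonneg (hnn ω) (ind_nonneg (c.dec1 ω.2.2.2.1 ≠ ω.1))
    rw [mul_add]
    split_ifs with h
    · rw [ind_true h]; linarith
    · rw [ind_false h]; linarith

end core


/-! ### Single-letter expectations and the core coding lemma -/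

section core2

lemma mi_neg {Ω α β : Type*} [Fintype Ω] [Fintype α] [Fintype β] {p : Ω → ℝ} (hp : IsPMF p)
    (X : Ω → α) (Y : Ω → β) :
    ∑ ω, p ω * (Real.logb 2 (distRV p X (X ω) * distRV p Y (Y ω)) -
      Real.logb 2 (distRV p (fun ω => (X ω, Y ω)) (X ω, Y ω))) = - mutInfo p X Y := by
  rw [← mutInfo_eq, ← Finset.sum_neg_distrib]
  refine Finset.sum_congr rfl fun ω _ => ?_
  rcases (hp.1 ω).eq_or_lt with h0 | h0
  · rw [← h0]; simp
  rw [Real.logb_mul (dist_pos' hp X ω h0).ne' (dist_pos' hp Y ω h0).ne']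
  ring

lemma dist_le_map {Ω α β : Type*} [Fintype Ω] {p : Ω → ℝ} (hp : IsPMF p)
    (Z : Ω → α) (X : Ω → β) (z : α) (x : β) (h : ∀ ω, Z ω = z → X ω = x) :
    distRV p Z z ≤ distRV p X x := by
  unfold distRV
  refine Finset.sum_le_sum fun ω _ => ?_
  by_cases hz : Z ω = z
  · rw [if_pos hz, if_pos (h ω hz)]
  · rw [if_neg hz]
    split_ifs
    exacts [hp.1 ω, le_rfl]

variable (ch : SDBC 𝒳 𝒴1 𝒴2 𝒲) {𝒱1 𝒱2 : Type} [Fintype 𝒱1] [Fintype 𝒱2]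
  (pV : 𝒲 → 𝒱1 × 𝒱2 → ℝ) (pX : 𝒲 → 𝒱1 → 𝒱2 → 𝒳 → ℝ)

lemma supp_pos (hpV : ∀ w, IsPMF (pV w)) (hpX : ∀ w v1 v2, IsPMF (pX w v1 v2))
    (ω : 𝒲 × 𝒱1 × 𝒱2 × 𝒳 × 𝒴1 × 𝒴2) (h : 0 < jointP1 ch pV pX ω) :
    0 < ch.q ω.1 ∧ 0 < pV ω.1 (ω.2.1, ω.2.2.1) := by
  constructor
  · refine lt_of_le_of_ne (ch.q_pmf.1 _) fun h0 => ?_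
    unfold jointP1 at h; rw [← h0] at h; simp at h
  · refine lt_of_le_of_ne ((hpV _).1 _) fun h0 => ?_
    unfold jointP1 at h; rw [← h0] at h; simp at h

lemma pVA_pos (hpV : ∀ w, IsPMF (pV w)) (w : 𝒲) (a : 𝒱1) (b : 𝒱2) (h : 0 < pV w (a, b)) :
    0 < ∑ b', pV w (a, b') :=
  h.trans_le (Finset.single_le_sum (f := fun b' => pV w (a, b'))
    (fun b' _ => (hpV w).1 _) (Finset.mem_univ b))

lemma pVB_pos (hpV : ∀ w, IsPMF (pV w)) (w : 𝒲) (a : 𝒱1) (b : 𝒱2) (h : 0 < pV w (a, b)) :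
    0 < ∑ a', pV w (a', b) :=
  h.trans_le (Finset.single_le_sum (f := fun a' => pV w (a', b))
    (fun b' _ => (hpV w).1 _) (Finset.mem_univ a))

lemma mean12 (hpV : ∀ w, IsPMF (pV w)) (hpX : ∀ w v1 v2, IsPMF (pX w v1 v2)) :
    ∑ ω, jointP1 ch pV pX ω * (Real.logb 2 (pV ω.1 (ω.2.1, ω.2.2.1)) -
      Real.logb 2 (distRV (jointP1 ch pV pX) (fun ω => ω.2.1) ω.2.1 *
        distRV (jointP1 ch pV pX) (fun ω => ω.2.2.1) ω.2.2.1)) =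
    mutInfo (jointP1 ch pV pX) (fun ω => ω.2.1) (fun ω => ω.2.2.1)
      + mutInfo (jointP1 ch pV pX) (fun ω => (ω.2.1, ω.2.2.1)) (fun ω => ω.1) := by
  have hp := jointP1_pmf ch pV pX hpV hpX
  rw [← mutInfo_eq, ← mutInfo_eq, ← Finset.sum_add_distrib]
  refine Finset.sum_congr rfl fun ω _ => ?_
  rcases (hp.1 ω).eq_or_lt with h0 | h0
  · rw [← h0]; simp
  obtain ⟨hq, hv⟩ := supp_pos ch pV pX hpV hpX ω h0
  rw [Real.logb_mul (dist_pos' hp (fun ω => ω.2.1) ω h0).ne'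
    (dist_pos' hp (fun ω => ω.2.2.1) ω h0).ne', dist_ABW ch pV pX hpX, dist_W ch pV pX hpV hpX,
    Real.logb_mul hq.ne' hv.ne']
  ring

lemma mean1 (hpV : ∀ w, IsPMF (pV w)) (hpX : ∀ w v1 v2, IsPMF (pX w v1 v2)) :
    ∑ ω, jointP1 ch pV pX ω * (Real.logb 2 (∑ b, pV ω.1 (ω.2.1, b)) -
      Real.logb 2 (distRV (jointP1 ch pV pX) (fun ω => ω.2.1) ω.2.1)) =
    mutInfo (jointP1 ch pV pX) (fun ω => ω.2.1) (fun ω => ω.1) := by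
  have hp := jointP1_pmf ch pV pX hpV hpX
  rw [← mutInfo_eq]
  refine Finset.sum_congr rfl fun ω _ => ?_
  rcases (hp.1 ω).eq_or_lt with h0 | h0
  · rw [← h0]; simp
  obtain ⟨hq, hv⟩ := supp_pos ch pV pX hpV hpX ω h0
  rw [dist_AW ch pV pX hpX, dist_W ch pV pX hpV hpX,
    Real.logb_mul hq.ne' (pVA_pos pV hpV _ _ _ hv).ne']
  ring

lemma mean2 (hpV : ∀ w, IsPMF (pV w)) (hpX : ∀ w v1 v2, IsPMF (pX w v1 v2)) :
    ∑ ω, jointP1 ch pV pX ω * (Real.logb 2 (∑ a, pV ω.1 (a, ω.2.2.1)) -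
      Real.logb 2 (distRV (jointP1 ch pV pX) (fun ω => ω.2.2.1) ω.2.2.1)) =
    mutInfo (jointP1 ch pV pX) (fun ω => ω.2.2.1) (fun ω => ω.1) := by
  have hp := jointP1_pmf ch pV pX hpV hpX
  rw [← mutInfo_eq]
  refine Finset.sum_congr rfl fun ω _ => ?_
  rcases (hp.1 ω).eq_or_lt with h0 | h0
  · rw [← h0]; simp
  obtain ⟨hq, hv⟩ := supp_pos ch pV pX hpV hpX ω h0
  rw [dist_BW ch pV pX hpX, dist_W ch pV pX hpV hpX,
    Real.logb_mul hq.ne' (pVB_pos pV hpV _ _ _ hv).ne']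
  ring

lemma marg_pos (hpV : ∀ w, IsPMF (pV w)) (hpX : ∀ w v1 v2, IsPMF (pX w v1 v2))
    (w : 𝒲) (a : 𝒱1) (b : 𝒱2) (h : 0 < ch.q w * pV w (a, b)) :
    0 < distRV (jointP1 ch pV pX) (fun ω => ω.2.1) a ∧
      0 < distRV (jointP1 ch pV pX) (fun ω => ω.2.2.1) b := by
  have hp := jointP1_pmf ch pV pX hpV hpX
  rw [← dist_ABW ch pV pX hpX] at h
  constructor
  · refine h.trans_le (dist_le_map hp _ _ _ _ fun ω hω => ?_)
    simp only [Prod.mk.injEq] at hω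
    exact hω.1.1
  · refine h.trans_le (dist_le_map hp _ _ _ _ fun ω hω => ?_)
    simp only [Prod.mk.injEq] at hω
    exact hω.1.2

lemma core (hpV : ∀ w, IsPMF (pV w)) (hpX : ∀ w v1 v2, IsPMF (pX w v1 v2))
    {I1 I2 J1 J2 J12 : ℝ}
    (hI1 : I1 = mutInfo (jointP1 ch pV pX) (fun ω => ω.2.1) (fun ω => ω.2.2.2.2.1))
    (hI2 : I2 = mutInfo (jointP1 ch pV pX) (fun ω => ω.2.2.1) (fun ω => ω.2.2.2.2.2))
    (hJ1 : J1 = mutInfo (jointP1 ch pV pX) (fun ω => ω.2.1) (fun ω => ω.1))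
    (hJ2 : J2 = mutInfo (jointP1 ch pV pX) (fun ω => ω.2.2.1) (fun ω => ω.1))
    (hJ12 : J12 = mutInfo (jointP1 ch pV pX) (fun ω => ω.2.1) (fun ω => ω.2.2.1)
      + mutInfo (jointP1 ch pV pX) (fun ω => (ω.2.1, ω.2.2.1)) (fun ω => ω.1))
    {δ τ : ℝ} (hδ : 0 < δ) (hτ : 0 < τ) :
    ∃ C : ℝ, 0 ≤ C ∧ ∀ n : ℕ, 0 < n → ∀ K1 K2 L1 L2 : ℕ, 0 < K1 → 0 < K2 → 0 < L1 → 0 < L2 →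
      ∃ c : CodeI 𝒳 𝒴1 𝒴2 𝒲 n K1 K2, PeI ch c ≤
        2 * (C / n + ((2 : ℝ) ^ ((n : ℝ) * (J12 + δ)) / (L1 * L2) +
          (2 : ℝ) ^ ((n : ℝ) * (J1 + δ)) / L1 + (2 : ℝ) ^ ((n : ℝ) * (J2 + δ)) / L2)) + 2 * τ
        + ((K1 : ℝ) - 1) * (L1 * (2 : ℝ) ^ ((n : ℝ) * (-I1 + δ)))
        + ((K2 : ℝ) - 1) * (L2 * (2 : ℝ) ^ ((n : ℝ) * (-I2 + δ))) := by
  have hp := jointP1_pmf ch pV pX hpV hpX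
  set P := jointP1 ch pV pX with hP
  set dA := distRV P (fun ω => ω.2.1) with hdA
  set dB := distRV P (fun ω => ω.2.2.1) with hdB
  set d1 := distRV P (fun ω => ω.2.2.2.2.1) with hd1
  set d2 := distRV P (fun ω => ω.2.2.2.2.2) with hd2
  set dA1 := distRV P (fun ω => (ω.2.1, ω.2.2.2.2.1)) with hdA1
  set dB2 := distRV P (fun ω => (ω.2.2.1, ω.2.2.2.2.2)) with hdB2
  have pA : ∀ ω, 0 < P ω → 0 < dA ω.2.1 := fun ω h => dist_pos' hp (fun ω => ω.2.1) ω h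
  have pB : ∀ ω, 0 < P ω → 0 < dB ω.2.2.1 := fun ω h => dist_pos' hp (fun ω => ω.2.2.1) ω h
  have p1 : ∀ ω, 0 < P ω → 0 < d1 ω.2.2.2.2.1 :=
    fun ω h => dist_pos' hp (fun ω => ω.2.2.2.2.1) ω h
  have p2 : ∀ ω, 0 < P ω → 0 < d2 ω.2.2.2.2.2 :=
    fun ω h => dist_pos' hp (fun ω => ω.2.2.2.2.2) ω h
  have pA1 : ∀ ω, 0 < P ω → 0 < dA1 (ω.2.1, ω.2.2.2.2.1) :=
    fun ω h => dist_pos' hp (fun ω => (ω.2.1, ω.2.2.2.2.1)) ω h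
  have pB2 : ∀ ω, 0 < P ω → 0 < dB2 (ω.2.2.1, ω.2.2.2.2.2) :=
    fun ω h => dist_pos' hp (fun ω => (ω.2.2.1, ω.2.2.2.2.2)) ω h
  have psV : ∀ ω, 0 < P ω → 0 < pV ω.1 (ω.2.1, ω.2.2.1) :=
    fun ω h => (supp_pos ch pV pX hpV hpX ω h).2
  obtain ⟨C1, hC1, A1⟩ := aep hp (fun ω => dA ω.2.1 * d1 ω.2.2.2.2.1)
    (fun ω => dA1 (ω.2.1, ω.2.2.2.2.1)) (fun ω h => mul_pos (pA ω h) (p1 ω h)) pA1 (-I1)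
    (by rw [hI1]; exact mi_neg hp (fun ω => ω.2.1) (fun ω => ω.2.2.2.2.1)) δ hδ
  obtain ⟨C2, hC2, A2⟩ := aep hp (fun ω => dB ω.2.2.1 * d2 ω.2.2.2.2.2)
    (fun ω => dB2 (ω.2.2.1, ω.2.2.2.2.2)) (fun ω h => mul_pos (pB ω h) (p2 ω h)) pB2 (-I2)
    (by rw [hI2]; exact mi_neg hp (fun ω => ω.2.2.1) (fun ω => ω.2.2.2.2.2)) δ hδ
  obtain ⟨C3, hC3, A3⟩ := aep hp (fun ω => pV ω.1 (ω.2.1, ω.2.2.1))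
    (fun ω => dA ω.2.1 * dB ω.2.2.1) psV (fun ω h => mul_pos (pA ω h) (pB ω h)) J12
    (by rw [hJ12]; exact mean12 ch pV pX hpV hpX) δ hδ
  obtain ⟨C4, hC4, A4⟩ := aep hp (fun ω => ∑ b, pV ω.1 (ω.2.1, b))
    (fun ω => dA ω.2.1) (fun ω h => pVA_pos pV hpV _ _ _ (psV ω h)) pA J1
    (by rw [hJ1]; exact mean1 ch pV pX hpV hpX) δ hδ
  obtain ⟨C5, hC5, A5⟩ := aep hp (fun ω => ∑ a, pV ω.1 (a, ω.2.2.1))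
    (fun ω => dB ω.2.2.1) (fun ω h => pVB_pos pV hpV _ _ _ (psV ω h)) pB J2
    (by rw [hJ2]; exact mean2 ch pV pX hpV hpX) δ hδ
  refine ⟨C3 + C4 + C5 + C1 / τ + C2 / τ, by positivity, ?_⟩
  intro n hn K1 K2 L1 L2 hK1 hK2 hL1 hL2
  have hn' : (0 : ℝ) < n := by exact_mod_cast hn
  -- the five bad events
  set E1 : (Fin n → 𝒱1) → (Fin n → 𝒴1) → Prop := fun a y =>
    (2 : ℝ) ^ ((n : ℝ) * (-I1 + δ)) * ∏ k, dA1 (a k, y k) ≤ ∏ k, (dA (a k) * d1 (y k)) with hE1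
  set E2 : (Fin n → 𝒱2) → (Fin n → 𝒴2) → Prop := fun b y =>
    (2 : ℝ) ^ ((n : ℝ) * (-I2 + δ)) * ∏ k, dB2 (b k, y k) ≤ ∏ k, (dB (b k) * d2 (y k)) with hE2
  set E3 : (Fin n → 𝒲) → (Fin n → 𝒱1) → (Fin n → 𝒱2) → Prop := fun w a b =>
    (2 : ℝ) ^ ((n : ℝ) * (J12 + δ)) * ∏ k, (dA (a k) * dB (b k)) ≤ ∏ k, pV (w k) (a k, b k)
    with hE3
  set E4 : (Fin n → 𝒲) → (Fin n → 𝒱1) → Prop := fun w a =>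
    (2 : ℝ) ^ ((n : ℝ) * (J1 + δ)) * ∏ k, dA (a k) ≤ ∏ k, ∑ b, pV (w k) (a k, b) with hE4
  set E5 : (Fin n → 𝒲) → (Fin n → 𝒱2) → Prop := fun w b =>
    (2 : ℝ) ^ ((n : ℝ) * (J2 + δ)) * ∏ k, dB (b k) ≤ ∏ k, ∑ a, pV (w k) (a, b k) with hE5
  set h1 : (Fin n → 𝒲) → (Fin n → 𝒱1) → (Fin n → 𝒱2) → ℝ := fun w a b =>
    ∑ x, xn pX w a b x * ∑ y1, ∑ y2, Qn ch x w y1 y2 * ind (E1 a y1) with hh1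
  set h2 : (Fin n → 𝒲) → (Fin n → 𝒱1) → (Fin n → 𝒱2) → ℝ := fun w a b =>
    ∑ x, xn pX w a b x * ∑ y1, ∑ y2, Qn ch x w y1 y2 * ind (E2 b y2) with hh2
  have hQ0 : ∀ (x : Fin n → 𝒳) (w : Fin n → 𝒲) y1 y2, 0 ≤ Qn ch x w y1 y2 := fun x w y1 y2 =>
    Finset.prod_nonneg fun k _ => ch.Q_nonneg _ _ _
  have hr0 : ∀ (w : Fin n → 𝒲) a b, 0 ≤ rn pV w a b := fun w a b =>
    Finset.prod_nonneg fun k _ => (hpV _).1 _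
  have hh1n : ∀ w a b, 0 ≤ h1 w a b := fun w a b => Finset.sum_nonneg fun x _ =>
    mul_nonneg ((xn_pmf pX hpX w a b).1 x) (Finset.sum_nonneg fun y1 _ =>
      Finset.sum_nonneg fun y2 _ => mul_nonneg (hQ0 _ _ _ _) (ind_nonneg _))
  have hh2n : ∀ w a b, 0 ≤ h2 w a b := fun w a b => Finset.sum_nonneg fun x _ =>
    mul_nonneg ((xn_pmf pX hpX w a b).1 x) (Finset.sum_nonneg fun y1 _ =>
      Finset.sum_nonneg fun y2 _ => mul_nonneg (hQ0 _ _ _ _) (ind_nonneg _))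
  have B1 : ∑ w, prodW ch.q w * ∑ a, ∑ b, rn pV w a b * h1 w a b ≤ C1 / n := by
    refine le_trans (le_of_eq ?_) (A1 n hn)
    exact (sum_nfold ch pV pX (fun _ a _ y1 _ => ind (E1 a y1))).symm
  have B2 : ∑ w, prodW ch.q w * ∑ a, ∑ b, rn pV w a b * h2 w a b ≤ C2 / n := by
    refine le_trans (le_of_eq ?_) (A2 n hn)
    exact (sum_nfold ch pV pX (fun _ _ b _ y2 => ind (E2 b y2))).symm
  have B3 : ∑ w, prodW ch.q w * ∑ a, ∑ b, rn pV w a b * ind (E3 w a b) ≤ C3 / n := by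
    refine le_trans (le_of_eq ?_) (A3 n hn)
    exact (sum_nfold' ch pV pX hpX (fun w a b => ind (E3 w a b))).symm
  have B4 : ∑ w, prodW ch.q w * ∑ a, ∑ b, rn pV w a b * ind (E4 w a) ≤ C4 / n := by
    refine le_trans (le_of_eq ?_) (A4 n hn)
    exact (sum_nfold' ch pV pX hpX (fun w a _ => ind (E4 w a))).symm
  have B5 : ∑ w, prodW ch.q w * ∑ a, ∑ b, rn pV w a b * ind (E5 w b) ≤ C5 / n := by
    refine le_trans (le_of_eq ?_) (A5 n hn)
    exact (sum_nfold' ch pV pX hpX (fun w _ b => ind (E5 w b))).symm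
  set G : (Fin n → 𝒲) → (Fin n → 𝒱1) → (Fin n → 𝒱2) → Prop := fun w a b =>
    0 < prodW dA a ∧ 0 < prodW dB b ∧ ¬ E3 w a b ∧ ¬ E4 w a ∧ ¬ E5 w b ∧
      h1 w a b ≤ τ ∧ h2 w a b ≤ τ with hG
  have hη : ∑ w, prodW ch.q w * ∑ a, ∑ b, rn pV w a b * ind (¬ G w a b) ≤
      (C3 + C4 + C5 + C1 / τ + C2 / τ) / n := by
    have step : ∀ w a b, prodW ch.q w * (rn pV w a b * ind (¬ G w a b)) ≤
        prodW ch.q w * (rn pV w a b * (ind (E3 w a b) + ind (E4 w a) + ind (E5 w b) +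
          τ⁻¹ * h1 w a b + τ⁻¹ * h2 w a b)) := by
      intro w a b
      have hqn := prodW_nonneg ch.q_pmf w
      rcases (mul_nonneg hqn (hr0 w a b)).eq_or_lt with h0 | h0
      · rw [← mul_assoc, ← mul_assoc, ← h0]; simp
      · refine mul_le_mul_of_nonneg_left (mul_le_mul_of_nonneg_left ?_ (hr0 w a b)) hqn
        have hk : ∀ k, 0 < ch.q (w k) * pV (w k) (a k, b k) := by
          intro k
          refine lt_of_le_of_ne (mul_nonneg (ch.q_pmf.1 _) ((hpV _).1 _)) fun hz => ?_
          have : prodW ch.q w * rn pV w a b = ∏ k, (ch.q (w k) * pV (w k) (a k, b k)) := by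
            rw [Finset.prod_mul_distrib]; rfl
          rw [this, Finset.prod_eq_zero (Finset.mem_univ k) hz.symm] at h0
          exact lt_irrefl _ h0
        have hpa : 0 < prodW dA a := Finset.prod_pos fun k _ =>
          (marg_pos ch pV pX hpV hpX _ _ _ (hk k)).1
        have hpb : 0 < prodW dB b := Finset.prod_pos fun k _ =>
          (marg_pos ch pV pX hpV hpX _ _ _ (hk k)).2
        have i3 := ind_nonneg (E3 w a b)
        have i4 := ind_nonneg (E4 w a)
        have i5 := ind_nonneg (E5 w b)
        have j1 : 0 ≤ τ⁻¹ * h1 w a b := mul_nonneg (by positivity) (hh1n w a b)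
        have j2 : 0 ≤ τ⁻¹ * h2 w a b := mul_nonneg (by positivity) (hh2n w a b)
        refine ind_le (by linarith) fun hnG => ?_
        by_contra hcon
        rw [not_le] at hcon
        apply hnG
        refine ⟨hpa, hpb, fun h => ?_, fun h => ?_, fun h => ?_, ?_, ?_⟩
        · rw [ind_true h] at hcon; linarith
        · rw [ind_true h] at hcon; linarith
        · rw [ind_true h] at hcon; linarith
        · have : τ⁻¹ * h1 w a b ≤ 1 := by linarith
          rwa [inv_mul_le_iff₀ hτ, mul_one] at this
        · have : τ⁻¹ * h2 w a b ≤ 1 := by linarith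
          rwa [inv_mul_le_iff₀ hτ, mul_one] at this
    have e : ∀ F : (Fin n → 𝒲) → (Fin n → 𝒱1) → (Fin n → 𝒱2) → ℝ,
        ∑ w, prodW ch.q w * ∑ a, ∑ b, rn pV w a b * F w a b =
        ∑ w, ∑ a, ∑ b, prodW ch.q w * (rn pV w a b * F w a b) := by
      intro F; simp_rw [Finset.mul_sum]
    rw [e (fun w a b => ind (¬ G w a b))]
    refine (Finset.sum_le_sum fun w _ => Finset.sum_le_sum fun a _ =>
      Finset.sum_le_sum fun b _ => step w a b).trans ?_
    rw [e] at B1 B2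
    rw [e (fun w a b => ind (E3 w a b))] at B3
    rw [e (fun w a b => ind (E4 w a))] at B4
    rw [e (fun w a b => ind (E5 w b))] at B5
    have e2 : ∑ w, ∑ a, ∑ b, prodW ch.q w * (rn pV w a b * (ind (E3 w a b) + ind (E4 w a) +
          ind (E5 w b) + τ⁻¹ * h1 w a b + τ⁻¹ * h2 w a b)) =
        ∑ w, ∑ a, ∑ b, prodW ch.q w * (rn pV w a b * ind (E3 w a b)) +
        ∑ w, ∑ a, ∑ b, prodW ch.q w * (rn pV w a b * ind (E4 w a)) +
        ∑ w, ∑ a, ∑ b, prodW ch.q w * (rn pV w a b * ind (E5 w b)) +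
        τ⁻¹ * ∑ w, ∑ a, ∑ b, prodW ch.q w * (rn pV w a b * h1 w a b) +
        τ⁻¹ * ∑ w, ∑ a, ∑ b, prodW ch.q w * (rn pV w a b * h2 w a b) := by
      simp_rw [Finset.mul_sum, ← Finset.sum_add_distrib]
      refine Finset.sum_congr rfl fun w _ => Finset.sum_congr rfl fun a _ =>
        Finset.sum_congr rfl fun b _ => ?_
      ring
    rw [e2]
    have hti : 0 ≤ τ⁻¹ := by positivity
    have B1' := mul_le_mul_of_nonneg_left B1 hti
    have B2' := mul_le_mul_of_nonneg_left B2 hti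
    have : (C3 + C4 + C5 + C1 / τ + C2 / τ) / n = C3 / n + C4 / n + C5 / n + τ⁻¹ * (C1 / n)
        + τ⁻¹ * (C2 / n) := by
      field_simp
    rw [this]
    linarith
  obtain ⟨enc, dec1, dec2, hcode⟩ := oneshot (K1 := K1) (K2 := K2) (L1 := L1) (L2 := L2)
    hK1 hK2 hL1 hL2 (prodW ch.q) (prodW_pmf ch.q_pmf) (rn pV) hr0
    (fun w => rn_sum pV hpV w) (xn pX) (fun w a b => xn_pmf pX hpX w a b) (Qn ch) hQ0
    (fun x w => Qn_sum ch x w) (PA := prodW dA) (PB := prodW dB)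
    (prodW_pmf (dist_pmf hp _)) (prodW_pmf (dist_pmf hp _))
    (fun a y => ¬ E1 a y) (fun b y => ¬ E2 b y)
    ((2 : ℝ) ^ ((n : ℝ) * (-I1 + δ))) ((2 : ℝ) ^ ((n : ℝ) * (-I2 + δ)))
    (fun y => packing hp (fun ω => ω.2.1) (fun ω => ω.2.2.2.2.1) _ (by positivity) y)
    (fun y => packing hp (fun ω => ω.2.2.1) (fun ω => ω.2.2.2.2.2) _ (by positivity) y)
    G (c12 := (2 : ℝ) ^ ((n : ℝ) * (J12 + δ))) (c1 := (2 : ℝ) ^ ((n : ℝ) * (J1 + δ)))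
    (c2 := (2 : ℝ) ^ ((n : ℝ) * (J2 + δ))) (by positivity) (by positivity) (by positivity) hτ.le
    (fun w a b g => ⟨g.1, g.2.1⟩)
    (fun w a b g => by
      have := (not_le.1 g.2.2.1).le
      rw [Finset.prod_mul_distrib] at this
      exact this)
    (fun w a b g => by
      have := (not_le.1 g.2.2.2.1).le
      refine le_trans (le_of_eq ?_) this
      exact sum_prod_fun (fun k b => pV (w k) (a k, b)))
    (fun w a b g => by
      have := (not_le.1 g.2.2.2.2.1).le
      refine le_trans (le_of_eq ?_) this
      exact sum_prod_fun (fun k a => pV (w k) (a, b k)))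
    (fun w a b g => by simp only [not_not]; exact g.2.2.2.2.2.1)
    (fun w a b g => by simp only [not_not]; exact g.2.2.2.2.2.2) hη
  exact ⟨⟨enc, dec1, dec2⟩, (PeI_le ch ⟨enc, dec1, dec2⟩).trans hcode⟩

end core2

/-! ### Achievability and the main theorem -/

section final
variable (ch : SDBC 𝒳 𝒴1 𝒴2 𝒲) {𝒱1 𝒱2 : Type} [Fintype 𝒱1] [Fintype 𝒱2]
  (pV : 𝒲 → 𝒱1 × 𝒱2 → ℝ) (pX : 𝒲 → 𝒱1 → 𝒱2 → 𝒳 → ℝ)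

lemma two_pow_add (x y : ℝ) : (2 : ℝ) ^ (x + y) = 2 ^ x * 2 ^ y :=
  Real.rpow_add (by norm_num) x y

lemma two_pow_le {x y : ℝ} (h : x ≤ y) : (2 : ℝ) ^ x ≤ 2 ^ y :=
  Real.rpow_le_rpow_of_exponent_le (by norm_num) h

/-- size of the bin-index codebooks. -/
lemma ceil_bounds {x : ℝ} (hx : 0 ≤ x) :
    0 < ⌈(2 : ℝ) ^ x⌉₊ ∧ (2 : ℝ) ^ x ≤ (⌈(2 : ℝ) ^ x⌉₊ : ℝ) ∧ (⌈(2 : ℝ) ^ x⌉₊ : ℝ) ≤ 2 * 2 ^ x ∧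
      (⌈(2 : ℝ) ^ x⌉₊ : ℝ) - 1 ≤ 2 ^ x ∧ (0 : ℝ) ≤ (⌈(2 : ℝ) ^ x⌉₊ : ℝ) - 1 := by
  have h0 : (0 : ℝ) < 2 ^ x := by positivity
  have h1 : (1 : ℝ) ≤ 2 ^ x := Real.one_le_rpow (by norm_num) hx
  have h2 := Nat.ceil_lt_add_one h0.le
  have h3 := Nat.le_ceil ((2 : ℝ) ^ x)
  exact ⟨Nat.ceil_pos.2 h0, h3, by linarith, by linarith, by linarith⟩

lemma user_term {n : ℕ} {R R' I δ : ℝ} (hR : 0 ≤ R) (hR' : 0 ≤ R')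
    (h : R = 0 ∨ R + R' ≤ I - 2 * δ) :
    ((⌈(2 : ℝ) ^ ((n : ℝ) * R)⌉₊ : ℝ) - 1) *
      ((⌈(2 : ℝ) ^ ((n : ℝ) * R')⌉₊ : ℝ) * (2 : ℝ) ^ ((n : ℝ) * (-I + δ))) ≤
      2 * (2 : ℝ) ^ (-((n : ℝ) * δ)) := by
  have hn : (0 : ℝ) ≤ n := Nat.cast_nonneg n
  rcases h with h | h
  · rw [h]
    simp
    positivity
  · obtain ⟨-, -, -, k4, k5⟩ := ceil_bounds (mul_nonneg hn hR)
    obtain ⟨-, -, l3, -, -⟩ := ceil_bounds (mul_nonneg hn hR')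
    calc _ ≤ (2 : ℝ) ^ ((n : ℝ) * R) * ((2 * 2 ^ ((n : ℝ) * R')) *
            (2 : ℝ) ^ ((n : ℝ) * (-I + δ))) := by
          gcongr
      _ = 2 * (2 : ℝ) ^ ((n : ℝ) * R + (n : ℝ) * R' + (n : ℝ) * (-I + δ)) := by
          rw [two_pow_add, two_pow_add]; ring
      _ ≤ _ := by
          refine mul_le_mul_of_nonneg_left (two_pow_le ?_) (by norm_num)
          have := mul_le_mul_of_nonneg_left h hn
          nlinarith

lemma cover_term {n : ℕ} {J S δ L : ℝ} (h : J + 2 * δ ≤ S) (hL : (2 : ℝ) ^ ((n : ℝ) * S) ≤ L) :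
    (2 : ℝ) ^ ((n : ℝ) * (J + δ)) / L ≤ (2 : ℝ) ^ (-((n : ℝ) * δ)) := by
  have hn : (0 : ℝ) ≤ n := Nat.cast_nonneg n
  have h0 : (0 : ℝ) < 2 ^ ((n : ℝ) * S) := by positivity
  rw [div_le_iff₀ (h0.trans_le hL)]
  refine le_trans ?_ (mul_le_mul_of_nonneg_left hL (by positivity))
  rw [← two_pow_add]
  refine two_pow_le ?_
  have := mul_le_mul_of_nonneg_left h hn
  nlinarith

lemma achiev (hpV : ∀ w, IsPMF (pV w)) (hpX : ∀ w v1 v2, IsPMF (pX w v1 v2))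
    {I1 I2 J1 J2 J12 : ℝ}
    (hI1 : I1 = mutInfo (jointP1 ch pV pX) (fun ω => ω.2.1) (fun ω => ω.2.2.2.2.1))
    (hI2 : I2 = mutInfo (jointP1 ch pV pX) (fun ω => ω.2.2.1) (fun ω => ω.2.2.2.2.2))
    (hJ1 : J1 = mutInfo (jointP1 ch pV pX) (fun ω => ω.2.1) (fun ω => ω.1))
    (hJ2 : J2 = mutInfo (jointP1 ch pV pX) (fun ω => ω.2.2.1) (fun ω => ω.1))
    (hJ12 : J12 = mutInfo (jointP1 ch pV pX) (fun ω => ω.2.1) (fun ω => ω.2.2.1)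
      + mutInfo (jointP1 ch pV pX) (fun ω => (ω.2.1, ω.2.2.1)) (fun ω => ω.1))
    {R1 R2 S1 S2 δ : ℝ} (hR1 : 0 ≤ R1) (hR2 : 0 ≤ R2) (hS1 : 0 ≤ S1) (hS2 : 0 ≤ S2) (hδ : 0 < δ)
    (g1 : J1 + 2 * δ ≤ S1) (g2 : J2 + 2 * δ ≤ S2) (g12 : J12 + 2 * δ ≤ S1 + S2)
    (k1 : R1 = 0 ∨ R1 + S1 ≤ I1 - 2 * δ) (k2 : R2 = 0 ∨ R2 + S2 ≤ I2 - 2 * δ) :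
    AchievableI ch R1 R2 := by
  refine ⟨hR1, hR2, fun ε hε => ?_⟩
  obtain ⟨C, hC, hcore⟩ := core ch pV pX hpV hpX hI1 hI2 hJ1 hJ2 hJ12 hδ
    (τ := ε / 4) (by positivity)
  have lim1 : Filter.Tendsto (fun n : ℕ => C / (n : ℝ)) Filter.atTop (nhds 0) :=
    tendsto_const_div_atTop_nhds_zero_nat C
  have lim2 : Filter.Tendsto (fun n : ℕ => (2 : ℝ) ^ (-((n : ℝ) * δ))) Filter.atTop (nhds 0) := by
    have hb : (2 : ℝ) ^ (-δ) < 1 := Real.rpow_lt_one_of_one_lt_of_neg (by norm_num) (by linarith)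
    refine (tendsto_pow_atTop_nhds_zero_of_lt_one (r := (2 : ℝ) ^ (-δ)) (by positivity) hb).congr
      fun n => ?_
    rw [← Real.rpow_natCast, ← Real.rpow_mul (by norm_num)]
    congr 1
    ring
  have lim3 : Filter.Tendsto (fun n : ℕ => 2 * (C / (n : ℝ)) + 10 * (2 : ℝ) ^ (-((n : ℝ) * δ)))
      Filter.atTop (nhds 0) := by
    simpa using (lim1.const_mul 2).add (lim2.const_mul 10)
  have ev := (lim3.eventually (gt_mem_nhds (show (0 : ℝ) < ε / 2 by positivity))).and
    (Filter.eventually_gt_atTop 0)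
  obtain ⟨N0, hN0⟩ := Filter.eventually_atTop.1 ev
  refine ⟨N0, fun n hn => ?_⟩
  obtain ⟨hsmall, hpos⟩ := hN0 n hn
  have hn0 : (0 : ℝ) ≤ n := Nat.cast_nonneg n
  obtain ⟨a1, a2, -, -, -⟩ := ceil_bounds (mul_nonneg hn0 hR1)
  obtain ⟨b1, b2, -, -, -⟩ := ceil_bounds (mul_nonneg hn0 hR2)
  obtain ⟨c1, c2, -, -, -⟩ := ceil_bounds (mul_nonneg hn0 hS1)
  obtain ⟨d1, d2, -, -, -⟩ := ceil_bounds (mul_nonneg hn0 hS2)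
  obtain ⟨c, hc⟩ := hcore n hpos _ _ _ _ a1 b1 c1 d1
  refine ⟨_, _, c, a2, b2, hc.trans ?_⟩
  have t1 := user_term (n := n) hR1 hS1 k1
  have t2 := user_term (n := n) hR2 hS2 k2
  have t3 := cover_term (n := n) g1 c2
  have t4 := cover_term (n := n) g2 d2
  have t5 := cover_term (n := n) (J := J12) (L := (⌈(2 : ℝ) ^ ((n : ℝ) * S1)⌉₊ : ℝ) *
    (⌈(2 : ℝ) ^ ((n : ℝ) * S2)⌉₊ : ℝ)) g12 (by
      rw [mul_add, two_pow_add]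
      exact mul_le_mul c2 d2 (by positivity) (by positivity))
  linarith

/-- choice of the binning rates. -/
lemma exists_rates {I1 I2 J1 J2 J12 R1 R2 : ℝ} (hJ1 : 0 ≤ J1) (hJ2 : 0 ≤ J2)
    (hR1 : 0 ≤ R1) (hR2 : 0 ≤ R2)
    (h1 : 0 < R1 → R1 < I1 - J1) (h2 : 0 < R2 → R2 < I2 - J2)
    (h12 : 0 < R1 → 0 < R2 → R1 + R2 < I1 + I2 - J12) :
    ∃ S1 S2 δ : ℝ, 0 ≤ S1 ∧ 0 ≤ S2 ∧ 0 < δ ∧ J1 + 2 * δ ≤ S1 ∧ J2 + 2 * δ ≤ S2 ∧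
      J12 + 2 * δ ≤ S1 + S2 ∧ (R1 = 0 ∨ R1 + S1 ≤ I1 - 2 * δ) ∧
      (R2 = 0 ∨ R2 + S2 ≤ I2 - 2 * δ) := by
  have habs := le_abs_self J12
  have habs0 := abs_nonneg J12
  rcases hR1.eq_or_lt with e1 | e1
  · rcases hR2.eq_or_lt with e2 | e2
    · exact ⟨J1 + |J12| + 2, J2 + 2, 1, by linarith, by linarith, by norm_num, by linarith,
        by linarith, by linarith, Or.inl e1.symm, Or.inl e2.symm⟩
    · have := h2 e2
      refine ⟨J1 + |J12| + 2 * ((I2 - J2 - R2) / 4), J2 + 2 * ((I2 - J2 - R2) / 4),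
        (I2 - J2 - R2) / 4, by linarith, by linarith, by linarith, by linarith,
        by linarith, by linarith, Or.inl e1.symm, Or.inr (by linarith)⟩
  · have k1 := h1 e1
    rcases hR2.eq_or_lt with e2 | e2
    · refine ⟨J1 + 2 * ((I1 - J1 - R1) / 4), J2 + |J12| + 2 * ((I1 - J1 - R1) / 4),
        (I1 - J1 - R1) / 4, by linarith, by linarith, by linarith, by linarith,
        by linarith, by linarith, Or.inr (by linarith), Or.inl e2.symm⟩
    · have k2 := h2 e2
      have k12 := h12 e1 e2
      obtain ⟨δ, hδ, hδ'⟩ : ∃ δ : ℝ, 0 < δ ∧ δ ≤ (I1 - J1 - R1) / 4 ∧ δ ≤ (I2 - J2 - R2) / 4 ∧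
          δ ≤ (I1 + I2 - J12 - R1 - R2) / 6 :=
        ⟨min ((I1 - J1 - R1) / 4) (min ((I2 - J2 - R2) / 4) ((I1 + I2 - J12 - R1 - R2) / 6)),
          lt_min (by linarith) (lt_min (by linarith) (by linarith)), min_le_left _ _,
          (min_le_right _ _).trans (min_le_left _ _), (min_le_right _ _).trans (min_le_right _ _)⟩
      obtain ⟨d1, d2, d3⟩ := hδ'
      exact ⟨I1 - R1 - 2 * δ, I2 - R2 - 2 * δ, δ, by linarith, by linarith, hδ, by linarith,
        by linarith, by linarith, Or.inr (by linarith), Or.inr (by linarith)⟩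

end final

/-- **Theorem 1 (inner bound for Class I channels).**
For every distribution `p1 ∈ P1` (given by finite auxiliary alphabets `𝒱1, 𝒱2`
and conditional pmfs `p(v1,v2|w)`, `p(x|w,v1,v2)`), the convex hull of the set of
nonnegative rate pairs `(R1,R2)` with
`R1 ≤ I(V1;Y1) − I(V1;W)`, `R2 ≤ I(V2;Y2) − I(V2;W)` and
`R1 + R2 ≤ I(V1;Y1) + I(V2;Y2) − I(V1;V2) − I(V1,V2;W)`
is contained in the capacity region `C1`; equivalently, the union over all
`p1 ∈ P1` of these convex hulls is contained in `C1`. -/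
theorem classI_inner_bound (ch : SDBC 𝒳 𝒴1 𝒴2 𝒲)
    (𝒱1 𝒱2 : Type) [Fintype 𝒱1] [Fintype 𝒱2]
    (pV : 𝒲 → 𝒱1 × 𝒱2 → ℝ) (pX : 𝒲 → 𝒱1 → 𝒱2 → 𝒳 → ℝ)
    (hpV : ∀ w, IsPMF (pV w)) (hpX : ∀ w v1 v2, IsPMF (pX w v1 v2)) :
    convexHull ℝ { R : ℝ × ℝ |
      0 ≤ R.1 ∧ 0 ≤ R.2 ∧
      R.1 ≤ mutInfo (jointP1 ch pV pX) (fun ω => ω.2.1) (fun ω => ω.2.2.2.2.1)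
              - mutInfo (jointP1 ch pV pX) (fun ω => ω.2.1) (fun ω => ω.1) ∧
      R.2 ≤ mutInfo (jointP1 ch pV pX) (fun ω => ω.2.2.1) (fun ω => ω.2.2.2.2.2)
              - mutInfo (jointP1 ch pV pX) (fun ω => ω.2.2.1) (fun ω => ω.1) ∧
      R.1 + R.2 ≤
        mutInfo (jointP1 ch pV pX) (fun ω => ω.2.1) (fun ω => ω.2.2.2.2.1)
          + mutInfo (jointP1 ch pV pX) (fun ω => ω.2.2.1) (fun ω => ω.2.2.2.2.2)
          - mutInfo (jointP1 ch pV pX) (fun ω => ω.2.1) (fun ω => ω.2.2.1)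
          - mutInfo (jointP1 ch pV pX) (fun ω => (ω.2.1, ω.2.2.1)) (fun ω => ω.1) }
      ⊆ CapacityI ch := by
  have hp := jointP1_pmf ch pV pX hpV hpX
  have hJ1 := mutInfo_nonneg hp (fun ω => ω.2.1) (fun ω => ω.1)
  have hJ2 := mutInfo_nonneg hp (fun ω => ω.2.2.1) (fun ω => ω.1)
  obtain ⟨I1, hI1⟩ : ∃ I1, I1 = mutInfo (jointP1 ch pV pX) (fun ω => ω.2.1)
    (fun ω => ω.2.2.2.2.1) := ⟨_, rfl⟩
  obtain ⟨I2, hI2⟩ : ∃ I2, I2 = mutInfo (jointP1 ch pV pX) (fun ω => ω.2.2.1)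
    (fun ω => ω.2.2.2.2.2) := ⟨_, rfl⟩
  obtain ⟨J1, hJ1e⟩ : ∃ J1, J1 = mutInfo (jointP1 ch pV pX) (fun ω => ω.2.1)
    (fun ω => ω.1) := ⟨_, rfl⟩
  obtain ⟨J2, hJ2e⟩ : ∃ J2, J2 = mutInfo (jointP1 ch pV pX) (fun ω => ω.2.2.1)
    (fun ω => ω.1) := ⟨_, rfl⟩
  obtain ⟨A, hA⟩ : ∃ A, A = mutInfo (jointP1 ch pV pX) (fun ω => ω.2.1)
    (fun ω => ω.2.2.1) := ⟨_, rfl⟩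
  obtain ⟨B, hB⟩ : ∃ B, B = mutInfo (jointP1 ch pV pX) (fun ω => (ω.2.1, ω.2.2.1))
    (fun ω => ω.1) := ⟨_, rfl⟩
  have hJ12 : A + B = mutInfo (jointP1 ch pV pX) (fun ω => ω.2.1) (fun ω => ω.2.2.1)
      + mutInfo (jointP1 ch pV pX) (fun ω => (ω.2.1, ω.2.2.1)) (fun ω => ω.1) := by
    rw [hA, hB]
  rw [← hJ1e] at hJ1
  rw [← hJ2e] at hJ2
  rw [← hI1, ← hI2, ← hJ1e, ← hJ2e, ← hA, ← hB]
  have hconv : Convex ℝ { R : ℝ × ℝ | 0 ≤ R.1 ∧ 0 ≤ R.2 ∧ R.1 ≤ I1 - J1 ∧ R.2 ≤ I2 - J2 ∧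
      R.1 + R.2 ≤ I1 + I2 - A - B } := by
    rintro x ⟨x1, x2, x3, x4, x5⟩ y ⟨y1, y2, y3, y4, y5⟩ s t hs ht hst
    have ht' : t = 1 - s := by linarith
    simp only [Set.mem_setOf_eq, Prod.fst_add, Prod.smul_fst, Prod.snd_add, Prod.smul_snd,
      smul_eq_mul]
    subst ht'
    refine ⟨by positivity, by positivity, by nlinarith, by nlinarith, by nlinarith⟩
  rw [hconv.convexHull_eq]
  rintro ⟨R1, R2⟩ ⟨r1, r2, r3, r4, r5⟩
  simp only at r1 r2 r3 r4 r5
  unfold CapacityI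
  have hlim : Filter.Tendsto (fun k : ℕ => ((1 - 1 / ((k : ℝ) + 1)) * R1,
      (1 - 1 / ((k : ℝ) + 1)) * R2)) Filter.atTop (nhds (R1, R2)) := by
    have h0 : Filter.Tendsto (fun k : ℕ => 1 - 1 / ((k : ℝ) + 1)) Filter.atTop (nhds 1) := by
      simpa using (tendsto_one_div_add_atTop_nhds_zero_nat (𝕜 := ℝ)).const_sub 1
    have h1 := h0.mul_const R1
    have h2 := h0.mul_const R2
    rw [one_mul] at h1 h2
    exact h1.prodMk_nhds h2
  refine mem_closure_of_tendsto hlim (Filter.Eventually.of_forall fun k => ?_)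
  have hk : (0 : ℝ) < 1 / ((k : ℝ) + 1) := by positivity
  have hk1 : 1 / ((k : ℝ) + 1) ≤ 1 := by
    rw [div_le_one (by positivity)]
    have : (0 : ℝ) ≤ k := Nat.cast_nonneg k
    linarith
  set t : ℝ := 1 / ((k : ℝ) + 1) with ht
  have hs : 0 ≤ 1 - t := by linarith
  have pos1 : 0 < (1 - t) * R1 → 0 < R1 := fun h => pos_of_mul_pos_right h hs
  have pos2 : 0 < (1 - t) * R2 → 0 < R2 := fun h => pos_of_mul_pos_right h hs
  obtain ⟨S1, S2, δ, s1, s2, hδ, g1, g2, g12, k1, k2⟩ := exists_rates (I1 := I1) (I2 := I2)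
    (J12 := A + B) hJ1 hJ2 (mul_nonneg hs r1) (mul_nonneg hs r2)
    (fun h => by have := mul_pos hk (pos1 h); linarith)
    (fun h => by have := mul_pos hk (pos2 h); linarith)
    (fun h h' => by
      have := mul_pos hk (pos1 h)
      have := mul_pos hk (pos2 h')
      linarith)
  exact achiev ch pV pX hpV hpX hI1 hI2 hJ1e hJ2e hJ12 (mul_nonneg hs r1) (mul_nonneg hs r2)
    s1 s2 hδ g1 g2 g12 k1 k2
end
end

section
/- (Theorem 2, outer bound for Class I channels.) Let P1 be the set of all joint pmfs p1 on (W,V1,V2,X,Y1,Y2) of the form p1(w,v1,v2,x,y1,y2) = p(w) p(v1,v2|w) p(x|w,v1,v2) p(y1,y2|x,w), so that (V1,V2) → (X,W) → (Y1,Y2) is a Markov chain. For p1 ∈ P1, let R_{1,out}(p1) be the set of nonnegative rate pairs (R1,R2) satisfying R1 ≤ I(V1;Y1) − I(V1;W) and R2 ≤ I(V2;Y2) − I(V2;W). Then the capacity region C1 is contained in ⋃_{p1∈P1} R_{1,out}(p1). -/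
open scoped Classical BigOperators
open Real

noncomputable section

variable {𝒳 𝒴1 𝒴2 𝒲 : Type} [Fintype 𝒳] [Fintype 𝒴1] [Fintype 𝒴2] [Fintype 𝒲]

/-- The outer-bound region `R_{1,out}(p1)` for a candidate distribution `p1 ∈ P1`:
nonnegative rate pairs with `R1 ≤ I(V1;Y1) − I(V1;W)` and `R2 ≤ I(V2;Y2) − I(V2;W)`
(empty unless `pV`, `pX` are genuine conditional pmfs). -/
def regionOutI (ch : SDBC 𝒳 𝒴1 𝒴2 𝒲) (𝒱1 𝒱2 : Type)
    (i1 : Fintype 𝒱1) (i2 : Fintype 𝒱2)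
    (pV : 𝒲 → 𝒱1 × 𝒱2 → ℝ) (pX : 𝒲 → 𝒱1 → 𝒱2 → 𝒳 → ℝ) : Set (ℝ × ℝ) :=
  haveI := i1
  haveI := i2
  { R : ℝ × ℝ |
    (∀ w, IsPMF (pV w)) ∧ (∀ w v1 v2, IsPMF (pX w v1 v2)) ∧
    0 ≤ R.1 ∧ 0 ≤ R.2 ∧
    R.1 ≤ mutInfo (jointP1 ch pV pX) (fun ω => ω.2.1) (fun ω => ω.2.2.2.2.1)
            - mutInfo (jointP1 ch pV pX) (fun ω => ω.2.1) (fun ω => ω.1) ∧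
    R.2 ≤ mutInfo (jointP1 ch pV pX) (fun ω => ω.2.2.1) (fun ω => ω.2.2.2.2.2)
            - mutInfo (jointP1 ch pV pX) (fun ω => ω.2.2.1) (fun ω => ω.1) }

/-! ### Basic entropy facts -/

/-- `φ(x) = -x log₂ x`. -/
def phi (x : ℝ) : ℝ := -(x * Real.logb 2 x)

lemma phi_zero : phi 0 = 0 := by simp [phi]

lemma phi_mul (c x : ℝ) : phi (c * x) = c * phi x + x * phi c := by
  unfold phi
  by_cases hc : c = 0
  · simp [hc]
  by_cases hx : x = 0
  · simp [hx]
  rw [Real.logb_mul hc hx]; ring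

lemma phi_continuous : Continuous phi := by
  have : phi = fun x => (Real.log 2)⁻¹ * Real.negMulLog x := by
    funext x
    simp only [phi, Real.logb, Real.negMulLog]
    ring
  rw [this]
  exact continuous_const.mul Real.continuous_negMulLog

lemma gibbs_pointwise {d r : ℝ} (hd : 0 ≤ d) (hr : 0 ≤ r) (h : 0 < d → 0 < r) :
    phi d ≤ d * (-Real.logb 2 r) + (r - d) / Real.log 2 := by
  have hl : 0 < Real.log 2 := Real.log_pos (by norm_num)
  rcases hd.eq_or_lt with h0 | h0
  · rw [← h0, phi_zero]
    have := div_nonneg hr hl.le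
    simpa using this
  · have hr' := h h0
    have h1 := Real.log_le_sub_one_of_pos (div_pos hr' h0)
    rw [Real.log_div hr'.ne' h0.ne'] at h1
    have h2 : d * (Real.log r - Real.log d) ≤ r - d := by
      calc _ ≤ d * (r / d - 1) := mul_le_mul_of_nonneg_left h1 h0.le
        _ = r - d := by field_simp
    have h3 := div_le_div_of_nonneg_right h2 hl.le
    have h4 : phi d - d * (-Real.logb 2 r) = d * (Real.log r - Real.log d) / Real.log 2 := by
      simp only [phi, Real.logb]; ring
    linarith

section Ent
variable {Ω α β : Type*} [Fintype Ω] [Fintype α] [Fintype β]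

lemma sum_distRV_mul (p : Ω → ℝ) (X : Ω → α) (g : α → ℝ) :
    ∑ a, distRV p X a * g a = ∑ ω, p ω * g (X ω) := by
  simp only [distRV, Finset.sum_mul, ite_mul, zero_mul]
  rw [Finset.sum_comm]
  simp

lemma distRV_nonneg {p : Ω → ℝ} (hp : ∀ ω, 0 ≤ p ω) (X : Ω → α) (a : α) :
    0 ≤ distRV p X a :=
  Finset.sum_nonneg fun ω _ => by split_ifs <;> simp [hp ω]

lemma sum_distRV (p : Ω → ℝ) (X : Ω → α) : ∑ a, distRV p X a = ∑ ω, p ω := by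
  simpa using sum_distRV_mul p X (fun _ => 1)

lemma entRV_eq_phi (p : Ω → ℝ) (X : Ω → α) : entRV p X = ∑ a, phi (distRV p X a) := rfl

lemma entRV_eq (p : Ω → ℝ) (X : Ω → α) :
    entRV p X = ∑ ω, p ω * (-Real.logb 2 (distRV p X (X ω))) := by
  rw [← sum_distRV_mul p X (fun a => -Real.logb 2 (distRV p X a))]
  simp [entRV, entPMF]

lemma entRV_congr (p : Ω → ℝ) (X : Ω → α) (Y : Ω → β)
    (h : ∀ ω ω', X ω = X ω' ↔ Y ω = Y ω') : entRV p X = entRV p Y := by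
  rw [entRV_eq, entRV_eq]
  refine Finset.sum_congr rfl fun ω _ => ?_
  simp only [distRV, h]

lemma gibbs {p : Ω → ℝ} (hp : IsPMF p) (X : Ω → α) (r : α → ℝ) (hr : ∀ a, 0 ≤ r a)
    (hr1 : ∑ a, r a ≤ 1) (hs : ∀ ω, 0 < p ω → 0 < r (X ω)) :
    entRV p X ≤ ∑ ω, p ω * (-Real.logb 2 (r (X ω))) := by
  have hl : 0 < Real.log 2 := Real.log_pos (by norm_num)
  rw [← sum_distRV_mul p X (fun a => -Real.logb 2 (r a)), entRV_eq_phi]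
  have h1 : ∀ a, phi (distRV p X a) ≤
      distRV p X a * (-Real.logb 2 (r a)) + (r a - distRV p X a) / Real.log 2 := by
    intro a
    refine gibbs_pointwise (distRV_nonneg hp.1 X a) (hr a) fun hpos => ?_
    obtain ⟨ω, -, hω⟩ := Finset.exists_ne_zero_of_sum_ne_zero hpos.ne'
    split_ifs at hω with hX
    · rw [← hX]; exact hs ω (lt_of_le_of_ne (hp.1 ω) (Ne.symm hω))
    · exact absurd rfl hω
  have h2 := Finset.sum_le_sum fun a (_ : a ∈ Finset.univ) => h1 a
  rw [Finset.sum_add_distrib, ← Finset.sum_div, Finset.sum_sub_distrib, sum_distRV, hp.2] at h2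
  have h3 : (∑ a, r a - 1) / Real.log 2 ≤ 0 := div_nonpos_of_nonpos_of_nonneg (by linarith) hl.le
  linarith

end Ent

/-! ### Convex hulls of compact sets in finite dimension -/

lemma sum_embedding {ι κ A : Type*} [Fintype ι] [Fintype κ] [AddCommMonoid A] (e : ι ↪ κ)
    (f : κ → A) (hf : ∀ j, (¬ ∃ i, e i = j) → f j = 0) : ∑ j, f j = ∑ i, f (e i) := by
  rw [← Finset.sum_map Finset.univ e f]
  symm
  apply Finset.sum_subset (Finset.subset_univ _)
  intro j _ hj
  apply hf
  rintro ⟨i, rfl⟩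
  exact hj (by simp)

lemma isCompact_convexHull_finDim {E : Type*} [AddCommGroup E] [Module ℝ E] [TopologicalSpace E]
    [IsTopologicalAddGroup E] [ContinuousSMul ℝ E] [FiniteDimensional ℝ E] {s : Set E}
    (hs : IsCompact s) : IsCompact (convexHull ℝ s) := by
  rcases s.eq_empty_or_nonempty with rfl | ⟨s0, hs0⟩
  · simp
  set d := Module.finrank ℝ E + 1
  let F : (Fin d → ℝ) × (Fin d → E) → E := fun x => ∑ i, x.1 i • x.2 i
  have hF : Continuous F := by fun_prop
  have hK : IsCompact ((stdSimplex ℝ (Fin d)) ×ˢ (Set.univ.pi fun _ : Fin d => s)) :=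
    (isCompact_stdSimplex ℝ (Fin d)).prod (isCompact_univ_pi fun _ => hs)
  have : convexHull ℝ s = F '' ((stdSimplex ℝ (Fin d)) ×ˢ (Set.univ.pi fun _ : Fin d => s)) := by
    apply Set.Subset.antisymm
    · intro x hx
      obtain ⟨ι, hι, z, w, hz, hai, hw, hw1, rfl⟩ := eq_pos_convex_span_of_mem_convexHull hx
      have hcard : Fintype.card ι ≤ Fintype.card (Fin d) := by
        rw [Fintype.card_fin]
        exact hai.card_le_finrank_succ.trans (by
          have := Submodule.finrank_le (vectorSpan ℝ (Set.range z)); omega)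
      obtain ⟨e⟩ := Function.Embedding.nonempty_of_card_le hcard
      let w' : Fin d → ℝ := Function.extend e w 0
      let z' : Fin d → E := Function.extend e z (fun _ => s0)
      have hwe : ∀ i, w' (e i) = w i := fun i => e.injective.extend_apply _ _ _
      have hze : ∀ i, z' (e i) = z i := fun i => e.injective.extend_apply _ _ _
      have hw0 : ∀ j, (¬ ∃ i, e i = j) → w' j = 0 := fun j hj => by
        simp [w', Function.extend_apply' _ _ _ hj]
      refine ⟨(w', z'), ⟨⟨fun j => ?_, ?_⟩, fun j _ => ?_⟩, ?_⟩
      · by_cases hj : ∃ i, e i = j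
        · obtain ⟨i, rfl⟩ := hj
          show 0 ≤ w' (e i)
          rw [hwe]; exact (hw i).le
        · show 0 ≤ w' j
          rw [hw0 j hj]
      · show ∑ j, w' j = 1
        rw [sum_embedding e w' hw0]; simpa [hwe] using hw1
      · by_cases hj : ∃ i, e i = j
        · obtain ⟨i, rfl⟩ := hj
          show z' (e i) ∈ s
          rw [hze]; exact hz ⟨i, rfl⟩
        · show z' j ∈ s
          simp only [z', Function.extend_apply' _ _ _ hj]; exact hs0
      · show ∑ j, w' j • z' j = _
        rw [sum_embedding e (fun j => w' j • z' j) (fun j hj => by simp [hw0 j hj])]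
        simp [hwe, hze]
    · rintro _ ⟨⟨w, z⟩, ⟨hw, hz⟩, rfl⟩
      exact mem_convexHull_of_exists_fintype w z hw.1 hw.2 (fun i => hz i trivial) rfl
  rw [this]
  exact hK.image hF

/-! ### The single-letter functionals -/

section Single
variable {𝒴 : Type} [Fintype 𝒴]

/-- State marginal. -/
def mW (m : 𝒲 × 𝒳 → ℝ) (w : 𝒲) : ℝ := ∑ x, m (w, x)

/-- Output law. -/
def mY (P : 𝒳 → 𝒲 → 𝒴 → ℝ) (m : 𝒲 × 𝒳 → ℝ) (y : 𝒴) : ℝ := ∑ a : 𝒲 × 𝒳, m a * P a.2 a.1 y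

/-- Difference of state entropy and output entropy. -/
def GG (P : 𝒳 → 𝒲 → 𝒴 → ℝ) (m : 𝒲 × 𝒳 → ℝ) : ℝ :=
  ∑ w, phi (mW m w) - ∑ y, phi (mY P m y)

/-- Convex hull of the graph of `GG P`. -/
def KK (P : 𝒳 → 𝒲 → 𝒴 → ℝ) : Set ((𝒲 × 𝒳 → ℝ) × ℝ) :=
  convexHull ℝ ((fun m => (m, GG P m)) '' stdSimplex ℝ (𝒲 × 𝒳))

/-- The rate functional. -/
def ff (P : 𝒳 → 𝒲 → 𝒴 → ℝ) (q : 𝒲 → ℝ) (k : (𝒲 × 𝒳 → ℝ) × ℝ) : ℝ :=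
  ∑ y, phi (mY P k.1 y) - ∑ w, phi (q w) + k.2

lemma mW_continuous (w : 𝒲) : Continuous fun m : 𝒲 × 𝒳 → ℝ => mW m w := by
  unfold mW; fun_prop

lemma mY_continuous (P : 𝒳 → 𝒲 → 𝒴 → ℝ) (y : 𝒴) :
    Continuous fun m : 𝒲 × 𝒳 → ℝ => mY P m y := by
  unfold mY; fun_prop

lemma GG_continuous (P : 𝒳 → 𝒲 → 𝒴 → ℝ) : Continuous (GG P) := by
  unfold GG
  exact (continuous_finsetSum _ fun w _ => phi_continuous.comp (mW_continuous w)).sub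
    (continuous_finsetSum _ fun y _ => phi_continuous.comp (mY_continuous P y))

lemma ff_continuous (P : 𝒳 → 𝒲 → 𝒴 → ℝ) (q : 𝒲 → ℝ) : Continuous (ff P q) := by
  unfold ff
  exact ((continuous_finsetSum _ fun y _ => phi_continuous.comp
    ((mY_continuous P y).comp continuous_fst)).sub continuous_const).add continuous_snd

lemma KK_compact (P : 𝒳 → 𝒲 → 𝒴 → ℝ) : IsCompact (KK P) :=
  isCompact_convexHull_finDim
    ((isCompact_stdSimplex ℝ _).image (continuous_id.prodMk (GG_continuous P)))

lemma sum_mW (m : 𝒲 × 𝒳 → ℝ) : ∑ w, mW m w = ∑ a, m a := by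
  simp only [mW, Fintype.sum_prod_type]

lemma sum_mY {P : 𝒳 → 𝒲 → 𝒴 → ℝ} (hP : ∀ x w, ∑ y, P x w y = 1) (m : 𝒲 × 𝒳 → ℝ) :
    ∑ y, mY P m y = ∑ a, m a := by
  simp only [mY]
  rw [Finset.sum_comm]
  simp [← Finset.mul_sum, hP]

lemma mW_smul (c : ℝ) (m : 𝒲 × 𝒳 → ℝ) (w : 𝒲) : mW (c • m) w = c * mW m w := by
  simp [mW, Finset.mul_sum]

lemma mY_smul (P : 𝒳 → 𝒲 → 𝒴 → ℝ) (c : ℝ) (m : 𝒲 × 𝒳 → ℝ) (y : 𝒴) :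
    mY P (c • m) y = c * mY P m y := by
  simp [mY, Finset.mul_sum, mul_assoc]

lemma GG_smul {P : 𝒳 → 𝒲 → 𝒴 → ℝ} (hP : ∀ x w, ∑ y, P x w y = 1) (c : ℝ) (m : 𝒲 × 𝒳 → ℝ) :
    GG P (c • m) = c * GG P m := by
  simp only [GG, mW_smul, mY_smul, phi_mul, Finset.sum_add_distrib, ← Finset.mul_sum,
    ← Finset.sum_mul, sum_mW, sum_mY hP]
  ring

lemma mem_KK {ι : Type*} [Fintype ι] {P : 𝒳 → 𝒲 → 𝒴 → ℝ} (hP : ∀ x w, ∑ y, P x w y = 1)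
    (m : ι → 𝒲 × 𝒳 → ℝ) (hm : ∀ i a, 0 ≤ m i a) (h1 : ∑ i, ∑ a, m i a = 1) :
    (∑ i, m i, ∑ i, GG P (m i)) ∈ KK P := by
  have hne : Nonempty (𝒲 × 𝒳) := by
    by_contra h
    rw [not_nonempty_iff] at h
    simp at h1
  obtain ⟨a0⟩ := hne
  let s0 : 𝒲 × 𝒳 → ℝ := Pi.single a0 1
  have hs0 : s0 ∈ stdSimplex ℝ (𝒲 × 𝒳) := single_mem_stdSimplex ℝ a0
  let c : ι → ℝ := fun i => ∑ a, m i a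
  have hc : ∀ i, 0 ≤ c i := fun i => Finset.sum_nonneg fun a _ => hm i a
  let z : ι → 𝒲 × 𝒳 → ℝ := fun i => if c i = 0 then s0 else (c i)⁻¹ • m i
  have hz : ∀ i, z i ∈ stdSimplex ℝ (𝒲 × 𝒳) := by
    intro i
    by_cases h : c i = 0
    · simp only [z, h, if_true]; exact hs0
    · simp only [z, h, if_false]
      refine ⟨fun a => mul_nonneg (inv_nonneg.2 (hc i)) (hm i a), ?_⟩
      simp only [Pi.smul_apply, smul_eq_mul, ← Finset.mul_sum]
      exact inv_mul_cancel₀ h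
  have hcz : ∀ i, c i • z i = m i := by
    intro i
    by_cases h : c i = 0
    · have : m i = 0 := by
        funext a
        exact (Finset.sum_eq_zero_iff_of_nonneg (fun a _ => hm i a)).1 h a (Finset.mem_univ _)
      rw [h, this, zero_smul]
    · simp only [z, h, if_false]
      rw [smul_smul, mul_inv_cancel₀ h, one_smul]
  refine mem_convexHull_of_exists_fintype c (fun i => (z i, GG P (z i))) hc h1
    (fun i => ⟨z i, hz i, rfl⟩) ?_
  have : ∀ i, c i • ((z i, GG P (z i)) : (𝒲 × 𝒳 → ℝ) × ℝ) = (m i, GG P (m i)) := by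
    intro i
    rw [Prod.smul_mk, smul_eq_mul, ← GG_smul hP, hcz]
  simp only [this]
  ext <;> simp [Prod.fst_sum, Prod.snd_sum]

lemma mem_KK_iff {P : 𝒳 → 𝒲 → 𝒴 → ℝ} (hP : ∀ x w, ∑ y, P x w y = 1)
    {k : (𝒲 × 𝒳 → ℝ) × ℝ} (hk : k ∈ KK P) :
    ∃ (ι : Type) (_ : Fintype ι) (m : ι → 𝒲 × 𝒳 → ℝ), (∀ i a, 0 ≤ m i a) ∧
      ∑ i, ∑ a, m i a = 1 ∧ (∀ a, ∑ i, m i a = k.1 a) ∧ ∑ i, GG P (m i) = k.2 := by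
  obtain ⟨ι, hι, w, z, hw, hw1, hz, rfl⟩ := mem_convexHull_iff_exists_fintype.1 hk
  choose p hp hpz using hz
  refine ⟨ι, hι, fun i => w i • p i, fun i a => mul_nonneg (hw i) ((hp i).1 a), ?_, ?_, ?_⟩
  · simp only [Pi.smul_apply, smul_eq_mul, ← Finset.mul_sum]
    simp only [(hp _).2, mul_one, hw1]
  · intro a
    simp [Prod.fst_sum, ← hpz]
  · simp [GG_smul hP, Prod.snd_sum, ← hpz]

end Single

/-! ### From points of the convexified region to auxiliary variables -/

section Direct

/-- Kronecker delta. -/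
def dlt {α : Type*} (a b : α) : ℝ := if a = b then 1 else 0

lemma distRV_eq_mul {Ω α : Type*} [Fintype Ω] (p : Ω → ℝ) (X : Ω → α) (a : α) :
    distRV p X a = ∑ ω, p ω * dlt (X ω) a := by
  simp [distRV, dlt]

lemma dlt_prod {α β : Type*} (a c : α) (b d : β) : dlt (a, b) (c, d) = dlt a c * dlt b d := by
  by_cases h1 : a = c <;> by_cases h2 : b = d <;> simp [dlt, h1, h2]

lemma sum_mul_dlt {α : Type*} [Fintype α] (f : α → ℝ) (b : α) : ∑ a, f a * dlt a b = f b := by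
  simp [dlt]

lemma sum_mul_dlt_right {α : Type*} [Fintype α] (f : α → ℝ) (b : α) :
    ∑ a, f a * dlt b a = f b := by
  simp [dlt]

lemma mutInfo_diff {𝒴 Ω ι : Type} [Fintype 𝒴] [Fintype Ω] [Fintype ι]
    {P : 𝒳 → 𝒲 → 𝒴 → ℝ} (hP : ∀ x w, ∑ y, P x w y = 1) (q : 𝒲 → ℝ)
    (p : Ω → ℝ) (V : Ω → ι) (W : Ω → 𝒲) (Y : Ω → 𝒴) (m : ι → 𝒲 × 𝒳 → ℝ)
    (k : (𝒲 × 𝒳 → ℝ) × ℝ) (hk1 : ∀ a, ∑ i, m i a = k.1 a) (hk2 : ∑ i, GG P (m i) = k.2)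
    (hq : ∀ w, mW k.1 w = q w)
    (hE : ∀ h : ι → 𝒲 → 𝒴 → ℝ, ∑ ω, p ω * h (V ω) (W ω) (Y ω) =
      ∑ i, ∑ a : 𝒲 × 𝒳, m i a * ∑ y, P a.2 a.1 y * h i a.1 y) :
    mutInfo p V Y - mutInfo p V W = ff P q k := by
  have hVW : ∀ i w, distRV p (fun ω => (V ω, W ω)) (i, w) = mW (m i) w := by
    intro i w
    rw [distRV_eq_mul]
    rw [hE (fun i' w' _ => dlt (i', w') (i, w))]
    simp only [← Finset.sum_mul, hP, one_mul, Fintype.sum_prod_type, mW, dlt_prod]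
    simp only [mul_comm (dlt _ i), ← mul_assoc, ← Finset.sum_mul, sum_mul_dlt]
  have hVY : ∀ i y, distRV p (fun ω => (V ω, Y ω)) (i, y) = mY P (m i) y := by
    intro i y
    rw [distRV_eq_mul]
    rw [hE (fun i' _ y' => dlt (i', y') (i, y))]
    simp only [mY, dlt_prod]
    simp only [mul_comm (dlt _ i), ← mul_assoc, ← Finset.sum_mul, sum_mul_dlt]
  have hW : ∀ w, distRV p W w = q w := by
    intro w
    rw [distRV_eq_mul]
    rw [hE (fun _ w' _ => dlt w' w)]
    simp only [← Finset.sum_mul, hP, one_mul]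
    rw [Finset.sum_comm]
    simp only [← Finset.sum_mul, hk1, Fintype.sum_prod_type, ← hq, mW, sum_mul_dlt]
  have hY : ∀ y, distRV p Y y = mY P k.1 y := by
    intro y
    rw [distRV_eq_mul]
    rw [hE (fun _ _ y' => dlt y' y)]
    rw [Finset.sum_comm]
    simp only [← Finset.sum_mul, hk1, mY, sum_mul_dlt]
  simp only [mutInfo, ff, ← hk2, GG, entRV_eq_phi, hW, hY, Fintype.sum_prod_type, hVW, hVY,
    Finset.sum_sub_distrib]
  ring

/-- Marginal channel to user 1. -/
def chP1 (ch : SDBC 𝒳 𝒴1 𝒴2 𝒲) : 𝒳 → 𝒲 → 𝒴1 → ℝ := fun x w y => ∑ y2, ch.Q x w (y, y2)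
/-- Marginal channel to user 2. -/
def chP2 (ch : SDBC 𝒳 𝒴1 𝒴2 𝒲) : 𝒳 → 𝒲 → 𝒴2 → ℝ := fun x w y => ∑ y1, ch.Q x w (y1, y)

lemma chP1_sum (ch : SDBC 𝒳 𝒴1 𝒴2 𝒲) (x : 𝒳) (w : 𝒲) : ∑ y, chP1 ch x w y = 1 := by
  rw [← ch.Q_sum x w, Fintype.sum_prod_type]; rfl

lemma chP2_sum (ch : SDBC 𝒳 𝒴1 𝒴2 𝒲) (x : 𝒳) (w : 𝒲) : ∑ y, chP2 ch x w y = 1 := by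
  rw [← ch.Q_sum x w, Fintype.sum_prod_type_right]; rfl

lemma split_sum {ι κ : Type} [Fintype ι] [Fintype κ] (m1 : ι → ℝ) (m2 : κ → ℝ) (p : ℝ)
    (h1 : ∀ i, 0 ≤ m1 i) (hs1 : ∑ i, m1 i = p) (hs2 : ∑ j, m2 j = p) (i : ι) :
    ∑ j, m1 i * m2 j / p = m1 i := by
  rw [← Finset.sum_div, ← Finset.mul_sum, hs2]
  by_cases hp : p = 0
  · rw [hp] at hs1
    have := (Finset.sum_eq_zero_iff_of_nonneg (fun i _ => h1 i)).1 hs1 i (Finset.mem_univ _)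
    rw [this]; simp
  · exact mul_div_cancel_right₀ _ hp

lemma mem_region (ch : SDBC 𝒳 𝒴1 𝒴2 𝒲) {k1 k2 : (𝒲 × 𝒳 → ℝ) × ℝ}
    (hk1 : k1 ∈ KK (chP1 ch)) (hk2 : k2 ∈ KK (chP2 ch)) (h12 : k1.1 = k2.1)
    (hq : ∀ w, mW k1.1 w = ch.q w) (R : ℝ × ℝ) (h0 : 0 ≤ R.1) (h0' : 0 ≤ R.2)
    (hR1 : R.1 ≤ ff (chP1 ch) ch.q k1) (hR2 : R.2 ≤ ff (chP2 ch) ch.q k2) :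
    ∃ (𝒱1 : Type) (𝒱2 : Type) (i1 : Fintype 𝒱1) (i2 : Fintype 𝒱2)
        (pV : 𝒲 → 𝒱1 × 𝒱2 → ℝ) (pX : 𝒲 → 𝒱1 → 𝒱2 → 𝒳 → ℝ),
        R ∈ regionOutI ch 𝒱1 𝒱2 i1 i2 pV pX := by
  obtain ⟨ι, i1, m1, hm1, hs1, hk11, hk12⟩ := mem_KK_iff (chP1_sum ch) hk1
  obtain ⟨κ, i2, m2, hm2, hs2, hk21, hk22⟩ := mem_KK_iff (chP2_sum ch) hk2
  have hι : Nonempty ι := by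
    by_contra h
    rw [not_nonempty_iff] at h
    simp at hs1
  have hκ : Nonempty κ := by
    by_contra h
    rw [not_nonempty_iff] at h
    simp at hs2
  have hX : Nonempty 𝒳 := by
    by_contra h
    rw [not_nonempty_iff] at h
    simp at hs2
  obtain ⟨i0⟩ := hι
  obtain ⟨j0⟩ := hκ
  obtain ⟨x0⟩ := hX
  let r : 𝒲 → ι → κ → 𝒳 → ℝ := fun w i j x => m1 i (w, x) * m2 j (w, x) / k1.1 (w, x)
  have hk0 : ∀ a, 0 ≤ k1.1 a := fun a => by
    rw [← hk11]; exact Finset.sum_nonneg fun i _ => hm1 i a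
  have hr0 : ∀ w i j x, 0 ≤ r w i j x := fun w i j x =>
    div_nonneg (mul_nonneg (hm1 _ _) (hm2 _ _)) (hk0 _)
  have hr1 : ∀ w i x, ∑ j, r w i j x = m1 i (w, x) := fun w i x =>
    split_sum (fun i => m1 i (w, x)) (fun j => m2 j (w, x)) _ (fun i => hm1 i _) (hk11 _)
      (by rw [hk21, h12]) i
  have hr2 : ∀ w j x, ∑ i, r w i j x = m2 j (w, x) := fun w j x => by
    have := split_sum (fun j => m2 j (w, x)) (fun i => m1 i (w, x)) (k1.1 (w, x))
      (fun j => hm2 j _) (by rw [hk21, h12]) (hk11 _) j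
    rw [← this]
    refine Finset.sum_congr rfl fun i _ => ?_
    simp only [r, mul_comm]
  let s : 𝒲 → ι → κ → ℝ := fun w i j => ∑ x, r w i j x
  have hs0 : ∀ w i j, 0 ≤ s w i j := fun w i j => Finset.sum_nonneg fun x _ => hr0 w i j x
  have hsq : ∀ w, ∑ v : ι × κ, s w v.1 v.2 = ch.q w := by
    intro w
    rw [Fintype.sum_prod_type, ← hq, mW]
    simp only [← hk11, s]
    rw [Finset.sum_comm (s := (Finset.univ : Finset 𝒳))]
    refine Finset.sum_congr rfl fun i _ => ?_
    rw [Finset.sum_comm]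
    simp only [hr1]
  let pV : 𝒲 → ι × κ → ℝ := fun w v =>
    if ch.q w = 0 then (if v = (i0, j0) then 1 else 0) else s w v.1 v.2 / ch.q w
  let pX : 𝒲 → ι → κ → 𝒳 → ℝ := fun w i j x =>
    if s w i j = 0 then (if x = x0 then 1 else 0) else r w i j x / s w i j
  have hpV : ∀ w, IsPMF (pV w) := by
    intro w
    by_cases h : ch.q w = 0
    · simp only [pV, h, if_true]
      exact ⟨fun v => by dsimp only; split_ifs <;> norm_num, by simp⟩
    · simp only [pV, h, if_false]
      exact ⟨fun v => div_nonneg (hs0 _ _ _) (ch.q_pmf.1 w), by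
        rw [← Finset.sum_div, hsq, div_self h]⟩
  have hpX : ∀ w v1 v2, IsPMF (pX w v1 v2) := by
    intro w i j
    by_cases h : s w i j = 0
    · simp only [pX, h, if_true]
      exact ⟨fun v => by dsimp only; split_ifs <;> norm_num, by simp⟩
    · simp only [pX, h, if_false]
      exact ⟨fun x => div_nonneg (hr0 _ _ _ _) (hs0 _ _ _), by
        rw [← Finset.sum_div]; exact div_self h⟩
  have hprod : ∀ w i j x, ch.q w * pV w (i, j) * pX w i j x = r w i j x := by
    intro w i j x
    have hq1 : ch.q w * pV w (i, j) = s w i j := by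
      by_cases h : ch.q w = 0
      · have h2 := hsq w
        rw [h] at h2
        have := (Finset.sum_eq_zero_iff_of_nonneg (fun v _ => hs0 w v.1 v.2)).1 h2 (i, j)
          (Finset.mem_univ _)
        rw [h, zero_mul]; exact this.symm
      · simp only [pV, h, if_false]
        exact mul_div_cancel₀ _ h
    rw [hq1]
    by_cases h : s w i j = 0
    · have := (Finset.sum_eq_zero_iff_of_nonneg (fun x _ => hr0 w i j x)).1 h x
          (Finset.mem_univ _)
      rw [h, zero_mul]; exact this.symm
    · simp only [pX, h, if_false]
      exact mul_div_cancel₀ _ h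
  refine ⟨ι, κ, i1, i2, pV, pX, hpV, hpX, h0, h0', hR1.trans_eq ?_, hR2.trans_eq ?_⟩
  · symm
    refine mutInfo_diff (chP1_sum ch) ch.q _ _ _ _ m1 k1 hk11 hk12 hq fun h => ?_
    simp only [jointP1, Fintype.sum_prod_type, hprod, chP1]
    rw [Finset.sum_comm]
    refine Finset.sum_congr rfl fun i _ => Finset.sum_congr rfl fun w _ => ?_
    rw [Finset.sum_comm]
    refine Finset.sum_congr rfl fun x _ => ?_
    rw [← hr1, Finset.sum_mul]
    refine Finset.sum_congr rfl fun j _ => ?_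
    simp only [Finset.mul_sum, Finset.sum_mul, mul_assoc]
  · symm
    refine mutInfo_diff (chP2_sum ch) ch.q _ _ _ _ m2 k2 hk21 hk22 (by rw [← h12]; exact hq)
      fun h => ?_
    simp only [jointP1, Fintype.sum_prod_type, hprod, chP2]
    have : ∀ (f : ι → κ → 𝒳 → ℝ), ∑ i, ∑ j, ∑ x, f i j x = ∑ j, ∑ x, ∑ i, f i j x := by
      intro f
      rw [Finset.sum_comm]
      refine Finset.sum_congr rfl fun j _ => ?_
      rw [Finset.sum_comm]
    simp only [fun w : 𝒲 => this (fun i j x => ∑ y1, ∑ y2, r w i j x * ch.Q x w (y1, y2) * h j w y2)]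
    rw [Finset.sum_comm]
    refine Finset.sum_congr rfl fun j _ => Finset.sum_congr rfl fun w _ =>
      Finset.sum_congr rfl fun x _ => ?_
    rw [← hr2, Finset.sum_mul]
    refine Finset.sum_congr rfl fun i _ => ?_
    rw [Finset.sum_comm]
    simp only [Finset.mul_sum, Finset.sum_mul, mul_assoc]

/-- The convexified region is closed. -/
lemma isClosed_DD (ch : SDBC 𝒳 𝒴1 𝒴2 𝒲) :
    IsClosed {R : ℝ × ℝ | ∃ k1 ∈ KK (chP1 ch), ∃ k2 ∈ KK (chP2 ch), k1.1 = k2.1 ∧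
      (∀ w, mW k1.1 w = ch.q w) ∧ R.1 ≤ ff (chP1 ch) ch.q k1 ∧ R.2 ≤ ff (chP2 ch) ch.q k2} := by
  let K := KK (chP1 ch) ×ˢ KK (chP2 ch)
  have hK : IsCompact K := (KK_compact _).prod (KK_compact _)
  have : CompactSpace K := isCompact_iff_compactSpace.1 hK
  let A : Set (K × (ℝ × ℝ)) := {z | z.1.1.1.1 = z.1.1.2.1 ∧
      (∀ w, mW z.1.1.1.1 w = ch.q w) ∧ z.2.1 ≤ ff (chP1 ch) ch.q z.1.1.1 ∧
      z.2.2 ≤ ff (chP2 ch) ch.q z.1.1.2}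
  have hA : IsClosed A := by
    refine IsClosed.inter ?_ (IsClosed.inter ?_ (IsClosed.inter ?_ ?_))
    · exact isClosed_eq (by fun_prop) (by fun_prop)
    · show IsClosed {z : K × (ℝ × ℝ) | ∀ w, mW z.1.1.1.1 w = ch.q w}
      simp only [Set.ofPred_forall]
      exact isClosed_iInter fun w =>
        isClosed_eq ((mW_continuous w).comp (by fun_prop)) continuous_const
    · exact isClosed_le (by fun_prop) ((ff_continuous _ _).comp (by fun_prop))
    · exact isClosed_le (by fun_prop) ((ff_continuous _ _).comp (by fun_prop))
  have := isClosedMap_snd_of_compactSpace (X := K) (Y := ℝ × ℝ) A hA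
  convert this using 1
  ext R
  constructor
  · rintro ⟨k1, h1, k2, h2, h⟩
    exact ⟨(⟨(k1, k2), h1, h2⟩, R), h, rfl⟩
  · rintro ⟨⟨⟨⟨k1, k2⟩, h1, h2⟩, R'⟩, h, rfl⟩
    exact ⟨k1, h1, k2, h2, h⟩

end Direct

/-! ### Converse -/

section Converse

lemma sum_prod_eq_one {N : ℕ} {𝒵 : Type*} [Fintype 𝒵] (Q : Fin N → 𝒵 → ℝ)
    (hQ : ∀ i, ∑ a, Q i a = 1) : ∑ z : Fin N → 𝒵, ∏ i, Q i (z i) = 1 := by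
  rw [← Fintype.piFinset_univ, ← Finset.prod_univ_sum]
  simp [hQ]

lemma resample {N : ℕ} {𝒵 : Type*} [Fintype 𝒵] (Q : Fin N → 𝒵 → ℝ) (n : Fin N)
    (hQ : ∑ a, Q n a = 1) (F : (Fin N → 𝒵) → ℝ)
    (hF : ∀ z a, F (Function.update z n a) = F z) (h : 𝒵 → ℝ) :
    ∑ z : Fin N → 𝒵, (∏ i, Q i (z i)) * F z * h (z n) =
      ∑ z : Fin N → 𝒵, (∏ i, Q i (z i)) * F z * (∑ a, Q n a * h a) := by
  have hL : ∑ z : Fin N → 𝒵, (∏ i, Q i (z i)) * F z * h (z n) =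
      ∑ u : (Fin N → 𝒵) × 𝒵, (∏ i, Q i (u.1 i)) * F u.1 * h (u.1 n) * Q n u.2 := by
    rw [Fintype.sum_prod_type]
    simp only [← Finset.mul_sum, hQ, mul_one]
  have hR : ∑ z : Fin N → 𝒵, (∏ i, Q i (z i)) * F z * (∑ a, Q n a * h a) =
      ∑ u : (Fin N → 𝒵) × 𝒵, (∏ i, Q i (u.1 i)) * F u.1 * (Q n u.2 * h u.2) := by
    rw [Fintype.sum_prod_type]
    simp only [← Finset.mul_sum]
  rw [hL, hR]
  let e : (Fin N → 𝒵) × 𝒵 ≃ (Fin N → 𝒵) × 𝒵 :=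
    { toFun := fun u => (Function.update u.1 n u.2, u.1 n)
      invFun := fun u => (Function.update u.1 n u.2, u.1 n)
      left_inv := fun u => by simp
      right_inv := fun u => by simp }
  refine Fintype.sum_equiv e _ _ fun u => ?_
  simp only [e, Equiv.coe_fn_mk, hF]
  have h1 : ∀ z : Fin N → 𝒵, ∏ i, Q i (z i) = Q n (z n) * ∏ i ∈ Finset.univ.erase n, Q i (z i) :=
    fun z => (Finset.mul_prod_erase Finset.univ (fun i => Q i (z i)) (Finset.mem_univ n)).symm
  have h2 : ∏ i ∈ Finset.univ.erase n, Q i (Function.update u.1 n u.2 i) =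
      ∏ i ∈ Finset.univ.erase n, Q i (u.1 i) :=
    Finset.prod_congr rfl fun i hi => by
      rw [Function.update_of_ne (Finset.ne_of_mem_erase hi)]
  rw [h1, h1, h2, Function.update_self]
  ring

lemma resample_one {N : ℕ} {𝒵 : Type*} [Fintype 𝒵] (q : 𝒵 → ℝ) (n : Fin N)
    (hq : ∑ a, q a = 1) (h : 𝒵 → ℝ) :
    ∑ z : Fin N → 𝒵, (∏ i, q (z i)) * h (z n) = ∑ a, q a * h a := by
  have := resample (fun _ : Fin N => q) n hq (fun _ => 1) (fun _ _ => rfl) h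
  simp only [mul_one] at this
  rw [this, ← Finset.sum_mul, sum_prod_eq_one (fun _ : Fin N => q) (fun _ => hq), one_mul]

lemma distRV_marg_fst {Ω α β : Type*} [Fintype Ω] [Fintype α] (p : Ω → ℝ)
    (A : Ω → α) (B : Ω → β) (b : β) :
    ∑ a, distRV p (fun ω => (A ω, B ω)) (a, b) = distRV p B b := by
  simp only [distRV_eq_mul, dlt_prod]
  rw [Finset.sum_comm]
  refine Finset.sum_congr rfl fun ω _ => ?_
  have := sum_mul_dlt_right (fun _ => p ω * dlt (B ω) b) (A ω)
  rw [← this]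
  exact Finset.sum_congr rfl fun a _ => by ring

lemma distRV_marg_snd {Ω α β : Type*} [Fintype Ω] [Fintype β] (p : Ω → ℝ)
    (A : Ω → α) (B : Ω → β) (a : α) :
    ∑ b, distRV p (fun ω => (A ω, B ω)) (a, b) = distRV p A a := by
  simp only [distRV_eq_mul, dlt_prod]
  rw [Finset.sum_comm]
  refine Finset.sum_congr rfl fun ω _ => ?_
  have := sum_mul_dlt_right (fun _ => p ω * dlt (A ω) a) (B ω)
  rw [← this]
  exact Finset.sum_congr rfl fun a _ => by ring

lemma logb_prod_sum {N : ℕ} {α : Type*} (f : α → ℝ) (y : Fin N → α) (h : ∀ i, f (y i) ≠ 0) :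
    Real.logb 2 (∏ i, f (y i)) = ∑ i, Real.logb 2 (f (y i)) :=
  Real.logb_prod _ _ fun i _ => h i

/-- Entropy of uniform message and i.i.d. state. -/
lemma ent_MW {Ω : Type} [Fintype Ω] {N K : ℕ} (hK : 0 < K)
    {q : 𝒲 → ℝ} (hq : IsPMF q) (p : Ω → ℝ) (M : Ω → Fin K) (W : Ω → Fin N → 𝒲)
    (hMW : ∀ g : Fin K → (Fin N → 𝒲) → ℝ, ∑ ω, p ω * g (M ω) (W ω) =
      ∑ m, ∑ w, (K : ℝ)⁻¹ * (∏ i, q (w i)) * g m w) :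
    entRV p (fun ω => (M ω, W ω)) = Real.logb 2 K + N * ∑ w, phi (q w) := by
  have hK' : (K : ℝ) ≠ 0 := by positivity
  have hd : ∀ m w, distRV p (fun ω => (M ω, W ω)) (m, w) = (K : ℝ)⁻¹ * ∏ i, q (w i) := by
    intro m w
    rw [distRV_eq_mul, hMW (fun m' w' => dlt (m', w') (m, w))]
    simp only [dlt_prod]
    simp only [mul_comm (dlt _ m), ← mul_assoc, ← Finset.sum_mul, sum_mul_dlt]
  rw [entRV_eq]
  simp only [hd]
  rw [hMW (fun m w => -Real.logb 2 ((K : ℝ)⁻¹ * ∏ i, q (w i)))]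
  have hpt : ∀ w : Fin N → 𝒲, (K : ℝ)⁻¹ * (∏ i, q (w i)) * -Real.logb 2 ((K : ℝ)⁻¹ * ∏ i, q (w i))
      = (K : ℝ)⁻¹ * ((∏ i, q (w i)) * Real.logb 2 K +
        ∑ i, (∏ i, q (w i)) * (-Real.logb 2 (q (w i)))) := by
    intro w
    by_cases h0 : ∏ i, q (w i) = 0
    · simp [h0]
    · have : ∀ i, q (w i) ≠ 0 := fun i => (Finset.prod_ne_zero_iff.1 h0) i (Finset.mem_univ _)
      rw [Real.logb_mul (inv_ne_zero hK') h0, Real.logb_inv, logb_prod_sum q w this,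
        ← Finset.mul_sum, Finset.sum_neg_distrib]
      ring
  simp only [hpt]
  rw [Finset.sum_const, Finset.card_univ, Fintype.card_fin, nsmul_eq_mul, ← Finset.mul_sum,
    ← mul_assoc, mul_inv_cancel₀ hK', one_mul, Finset.sum_add_distrib, ← Finset.sum_mul,
    sum_prod_eq_one (fun _ : Fin N => q) (fun _ => hq.2), one_mul, Finset.sum_comm]
  simp only [fun i : Fin N => resample_one q i hq.2 (fun a => -Real.logb 2 (q a))]
  simp [phi]

/-- Combined Fano and subadditivity bound. -/
lemma ent_MY {𝒴 Ω : Type} [Fintype 𝒴] [Fintype Ω] {N K : ℕ} (hN : 0 < N) (hK : 0 < K)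
    (p : Ω → ℝ) (hp : IsPMF p) (M : Ω → Fin K) (Y : Ω → Fin N → 𝒴)
    (dec : (Fin N → 𝒴) → Fin K) (ε : ℝ)
    (hPe : (∑ ω, if dec (Y ω) ≠ M ω then p ω else 0) ≤ ε) (ybar : 𝒴 → ℝ)
    (hy : ∀ b, ybar b = (N : ℝ)⁻¹ * ∑ n, distRV p (fun ω => Y ω n) b) :
    entRV p (fun ω => (M ω, Y ω)) ≤ 1 + ε * Real.logb 2 K + N * ∑ b, phi (ybar b) := by
  have hN' : (0 : ℝ) < N := by exact_mod_cast hN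
  have hK' : (0 : ℝ) < K := by exact_mod_cast hK
  have hK1 : (1 : ℝ) ≤ K := by exact_mod_cast hK
  have hlK : 0 ≤ Real.logb 2 K := Real.logb_nonneg (by norm_num) hK1
  have hy0 : ∀ b, 0 ≤ ybar b := fun b => by
    rw [hy]
    exact mul_nonneg (by positivity) (Finset.sum_nonneg fun n _ => distRV_nonneg hp.1 _ b)
  have hy1 : ∑ b, ybar b = 1 := by
    simp only [hy, ← Finset.mul_sum]
    rw [Finset.sum_comm]
    simp only [sum_distRV, hp.2]
    simp [hN'.ne']
  have hypos : ∀ ω, 0 < p ω → ∀ i, 0 < ybar (Y ω i) := by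
    intro ω hω i
    rw [hy]
    refine mul_pos (by positivity) ?_
    have h1 : p ω ≤ distRV p (fun ω => Y ω i) (Y ω i) := by
      have := Finset.single_le_sum (f := fun ω' => if Y ω' i = Y ω i then p ω' else 0)
        (fun ω' _ => by split_ifs <;> simp [hp.1 ω']) (Finset.mem_univ ω)
      simpa [distRV] using this
    have h2 := Finset.single_le_sum (f := fun n => distRV p (fun ω => Y ω n) (Y ω i))
      (fun n _ => distRV_nonneg hp.1 _ _) (Finset.mem_univ i)
    linarith
  let c : Fin K → (Fin N → 𝒴) → ℝ := fun m y => 1 / 2 * dlt (dec y) m + 1 / (2 * K)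
  have hc0 : ∀ m y, 0 < c m y := by
    intro m y
    have h1 : 0 ≤ dlt (dec y) m := by unfold dlt; split_ifs <;> norm_num
    have h2 : (0 : ℝ) < 1 / (2 * K) := by positivity
    simp only [c]; linarith
  have hc1 : ∀ y, ∑ m, c m y = 1 := by
    intro y
    simp only [c, Finset.sum_add_distrib, ← Finset.mul_sum]
    have : ∑ m, dlt (dec y) m = 1 := by
      simpa using sum_mul_dlt_right (fun _ => (1 : ℝ)) (dec y)
    rw [this]
    simp
    field_simp
    norm_num
  have hg := gibbs hp (fun ω => (M ω, Y ω)) (fun a => c a.1 a.2 * ∏ i, ybar (a.2 i))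
    (fun a => mul_nonneg (hc0 _ _).le (Finset.prod_nonneg fun i _ => hy0 _))
    (by
      rw [Fintype.sum_prod_type, Finset.sum_comm]
      simp only [← Finset.sum_mul, hc1, one_mul]
      rw [sum_prod_eq_one (fun _ : Fin N => ybar) (fun _ => hy1)])
    (fun ω hω => mul_pos (hc0 _ _) (Finset.prod_pos fun i _ => hypos ω hω i))
  refine hg.trans ?_
  have hpt : ∀ ω, p ω * (-Real.logb 2 (c (M ω) (Y ω) * ∏ i, ybar (Y ω i))) ≤
      p ω + (if dec (Y ω) ≠ M ω then p ω else 0) * Real.logb 2 K +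
        ∑ i, p ω * (-Real.logb 2 (ybar (Y ω i))) := by
    intro ω
    rcases (hp.1 ω).eq_or_lt with h0 | h0
    · simp [← h0]
    · have h1 : -Real.logb 2 (c (M ω) (Y ω)) ≤
          1 + (if dec (Y ω) ≠ M ω then 1 else 0) * Real.logb 2 K := by
        by_cases hd : dec (Y ω) = M ω
        · have h2 : (2 : ℝ)⁻¹ ≤ c (M ω) (Y ω) := by
            have : (0 : ℝ) < 1 / (2 * K) := by positivity
            simp only [c, hd, dlt, if_true]; linarith
          have h3 := Real.logb_le_logb_of_le (b := 2) (by norm_num) (by norm_num) h2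
          rw [Real.logb_inv, Real.logb_self_eq_one (by norm_num)] at h3
          simp [hd]; linarith
        · have h2 : c (M ω) (Y ω) = (2 * (K : ℝ))⁻¹ := by
            simp [c, hd, dlt]
          rw [h2, Real.logb_inv, Real.logb_mul (by norm_num) hK'.ne',
            Real.logb_self_eq_one (by norm_num)]
          simp [hd]
      rw [Real.logb_mul (hc0 _ _).ne'
        (Finset.prod_pos fun i _ => hypos ω h0 i).ne',
        logb_prod_sum ybar _ fun i => (hypos ω h0 i).ne', ← Finset.mul_sum,
        Finset.sum_neg_distrib]
      have h4 := mul_le_mul_of_nonneg_left h1 h0.le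
      have h5 : p ω * (if dec (Y ω) ≠ M ω then 1 else 0) = if dec (Y ω) ≠ M ω then p ω else 0 := by
        simp
      rw [← h5]
      linarith
  refine (Finset.sum_le_sum fun ω _ => hpt ω).trans ?_
  rw [Finset.sum_add_distrib, Finset.sum_add_distrib, hp.2, ← Finset.sum_mul]
  have h6 : ∑ ω, ∑ i, p ω * (-Real.logb 2 (ybar (Y ω i))) = N * ∑ b, phi (ybar b) := by
    rw [Finset.sum_comm]
    have : ∀ i, ∑ ω, p ω * (-Real.logb 2 (ybar (Y ω i))) =
        ∑ b, distRV p (fun ω => Y ω i) b * (-Real.logb 2 (ybar b)) := fun i =>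
      (sum_distRV_mul p (fun ω => Y ω i) (fun b => -Real.logb 2 (ybar b))).symm
    simp only [this]
    rw [Finset.sum_comm, Finset.mul_sum]
    refine Finset.sum_congr rfl fun b _ => ?_
    rw [← Finset.sum_mul]
    have : ∑ n, distRV p (fun ω => Y ω n) b = N * ybar b := by
      rw [hy]; field_simp
    rw [this, phi]; ring
  rw [h6]
  have := mul_le_mul_of_nonneg_right hPe hlK
  linarith

end Converse

section Converse2

/-- The auxiliary variable: message, past outputs, future states. -/
def auxV {𝒴 𝒲 : Type} {N K : ℕ} (n : Fin N) (m : Fin K) (w : Fin N → 𝒲) (y : Fin N → 𝒴) :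
    Fin K × (Fin N → Option (𝒴 ⊕ 𝒲)) :=
  (m, fun i => if i < n then some (Sum.inl (y i)) else if i = n then none
    else some (Sum.inr (w i)))

/-- Interpolation between states and outputs. -/
def auxZ {𝒴 𝒲 : Type} {N K : ℕ} (n : ℕ) (m : Fin K) (w : Fin N → 𝒲) (y : Fin N → 𝒴) :
    Fin K × (Fin N → 𝒴 ⊕ 𝒲) :=
  (m, fun i => if i.val < n then Sum.inl (y i) else Sum.inr (w i))

lemma auxV_update {𝒴 𝒲 : Type} {N K : ℕ} (n : Fin N) (m : Fin K) (w : Fin N → 𝒲)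
    (y : Fin N → 𝒴) (a : 𝒴) : auxV n m w (Function.update y n a) = auxV n m w y := by
  unfold auxV
  congr 1
  funext i
  by_cases h : i < n
  · simp [h, Function.update_of_ne h.ne]
  · simp [h]

lemma auxVW_iff {𝒴 𝒲 : Type} {N K : ℕ} (n : Fin N) (m m' : Fin K) (w w' : Fin N → 𝒲)
    (y y' : Fin N → 𝒴) :
    (auxV n m w y, w n) = (auxV n m' w' y', w' n) ↔ auxZ n m w y = auxZ n m' w' y' := by
  simp only [auxV, auxZ, Prod.mk.injEq, funext_iff]
  constructor
  · rintro ⟨⟨hm, h⟩, hw⟩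
    refine ⟨hm, fun i => ?_⟩
    have hi := h i
    rcases lt_trichotomy i n with h1 | h1 | h1
    · have h1' : i.val < n.val := h1
      simpa [h1, h1'] using hi
    · subst h1; simpa using hw
    · have h1' : ¬ i.val < n.val := by have : n.val < i.val := h1; omega
      simpa [h1', h1.not_gt, h1.ne'] using hi
  · rintro ⟨hm, h⟩
    refine ⟨⟨hm, fun i => ?_⟩, by simpa using h n⟩
    have hi := h i
    rcases lt_trichotomy i n with h1 | h1 | h1
    · have h1' : i.val < n.val := h1
      simpa [h1, h1'] using hi
    · simp [h1]
    · have h1' : ¬ i.val < n.val := by have : n.val < i.val := h1; omega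
      simpa [h1', h1.not_gt, h1.ne'] using hi

lemma auxVY_iff {𝒴 𝒲 : Type} {N K : ℕ} (n : Fin N) (m m' : Fin K) (w w' : Fin N → 𝒲)
    (y y' : Fin N → 𝒴) :
    (auxV n m w y, y n) = (auxV n m' w' y', y' n) ↔
      auxZ (n + 1) m w y = auxZ (n + 1) m' w' y' := by
  simp only [auxV, auxZ, Prod.mk.injEq, funext_iff]
  constructor
  · rintro ⟨⟨hm, h⟩, hw⟩
    refine ⟨hm, fun i => ?_⟩
    have hi := h i
    rcases lt_trichotomy i n with h1 | h1 | h1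
    · have h1' : i.val < n.val + 1 := by have : i.val < n.val := h1; omega
      simpa [h1, h1'] using hi
    · subst h1; simpa using hw
    · have h1' : ¬ i.val < n.val + 1 := by have : n.val < i.val := h1; omega
      simpa [h1', h1.not_gt, h1.ne'] using hi
  · rintro ⟨hm, h⟩
    refine ⟨⟨hm, fun i => ?_⟩, by simpa using h n⟩
    have hi := h i
    rcases lt_trichotomy i n with h1 | h1 | h1
    · have h1' : i.val < n.val + 1 := by have : i.val < n.val := h1; omega
      simpa [h1, h1'] using hi
    · simp [h1]
    · have h1' : ¬ i.val < n.val + 1 := by have : n.val < i.val := h1; omega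
      simpa [h1', h1.not_gt, h1.ne'] using hi

/-- Time-averaged law of the state and the input. -/
def pbar {Ω : Type} [Fintype Ω] {N : ℕ} (p : Ω → ℝ) (W : Ω → Fin N → 𝒲) (X : Ω → Fin N → 𝒳) :
    𝒲 × 𝒳 → ℝ := fun a => (N : ℝ)⁻¹ * ∑ n, distRV p (fun ω => (W ω n, X ω n)) a

lemma user_converse {𝒴 Ω : Type} [Fintype 𝒴] [Fintype Ω] {N K : ℕ} (hN : 0 < N) (hK : 0 < K)
    {P : 𝒳 → 𝒲 → 𝒴 → ℝ} (hP : ∀ x w, ∑ y, P x w y = 1) {q : 𝒲 → ℝ} (hq : IsPMF q)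
    (p : Ω → ℝ) (hp : IsPMF p) (M : Ω → Fin K) (W : Ω → Fin N → 𝒲) (X : Ω → Fin N → 𝒳)
    (Y : Ω → Fin N → 𝒴)
    (hMW : ∀ g : Fin K → (Fin N → 𝒲) → ℝ, ∑ ω, p ω * g (M ω) (W ω) =
      ∑ m, ∑ w, (K : ℝ)⁻¹ * (∏ i, q (w i)) * g m w)
    (hMk : ∀ (n : Fin N) (F : Fin K → (Fin N → 𝒲) → (Fin N → 𝒴) → ℝ),
      (∀ m w y a, F m w (Function.update y n a) = F m w y) → ∀ b,
      ∑ ω, p ω * (F (M ω) (W ω) (Y ω) * dlt (Y ω n) b) =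
        ∑ ω, p ω * (F (M ω) (W ω) (Y ω) * P (X ω n) (W ω n) b))
    (dec : (Fin N → 𝒴) → Fin K) (ε : ℝ)
    (hPe : (∑ ω, if dec (Y ω) ≠ M ω then p ω else 0) ≤ ε) :
    ∃ t, (pbar p W X, t) ∈ KK P ∧ (∀ w, mW (pbar p W X) w = q w) ∧
      (1 - ε) * Real.logb 2 K - 1 ≤ N * ff P q (pbar p W X, t) := by
  have hN' : (N : ℝ) ≠ 0 := by positivity
  have hK' : (K : ℝ) ≠ 0 := by positivity
  have hWn : ∀ n w, distRV p (fun ω => W ω n) w = q w := by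
    intro n w
    rw [distRV_eq_mul, hMW (fun _ w' => dlt (w' n) w)]
    simp only [mul_assoc, ← Finset.mul_sum]
    rw [resample_one q n hq.2 (fun a => dlt a w), sum_mul_dlt]
    simp [hK']
  have hpW : ∀ w, mW (pbar p W X) w = q w := by
    intro w
    simp only [mW, pbar, ← Finset.mul_sum]
    rw [Finset.sum_comm]
    simp only [distRV_marg_snd, hWn]
    simp [hN']
  let V : Fin N → Ω → Fin K × (Fin N → Option (𝒴 ⊕ 𝒲)) := fun n ω => auxV n (M ω) (W ω) (Y ω)
  let m0 : Fin N → Fin K × (Fin N → Option (𝒴 ⊕ 𝒲)) → 𝒲 × 𝒳 → ℝ := fun n v a =>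
    distRV p (fun ω => (V n ω, (W ω n, X ω n))) (v, a)
  let A : ℕ → ℝ := fun n => entRV p (fun ω => auxZ n (M ω) (W ω) (Y ω))
  have hm0W : ∀ n v w, mW (m0 n v) w = distRV p (fun ω => (V n ω, W ω n)) (v, w) := by
    intro n v w
    simp only [mW, m0]
    rw [← distRV_marg_snd p (fun ω => (V n ω, W ω n)) (fun ω => X ω n) (v, w)]
    refine Finset.sum_congr rfl fun x _ => ?_
    simp only [distRV_eq_mul, dlt_prod, mul_assoc]
  have hm0Y : ∀ n v y, mY P (m0 n v) y = distRV p (fun ω => (V n ω, Y ω n)) (v, y) := by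
    intro n v y
    rw [distRV_eq_mul]
    simp only [dlt_prod]
    have := hMk n (fun m w y => dlt (auxV n m w y) v)
      (fun m w y a => by simp only [auxV_update]) y
    simp only [V]
    rw [this]
    simp only [mY, m0, distRV_eq_mul, dlt_prod, V, Finset.sum_mul]
    rw [Finset.sum_comm]
    refine Finset.sum_congr rfl fun ω _ => ?_
    have h2 := sum_mul_dlt_right (fun a : 𝒲 × 𝒳 => p ω * (dlt (auxV n (M ω) (W ω) (Y ω)) v *
      P a.2 a.1 y)) (W ω n, X ω n)
    rw [← h2]
    exact Finset.sum_congr rfl fun a _ => by ring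
  have hGG : ∀ n : Fin N, ∑ v, GG P (m0 n v) = A n - A (n + 1) := by
    intro n
    have h1 : A n = entRV p (fun ω => (V n ω, W ω n)) :=
      (entRV_congr p _ _ fun ω ω' => auxVW_iff n _ _ _ _ _ _).symm
    have h2 : A (n + 1) = entRV p (fun ω => (V n ω, Y ω n)) :=
      (entRV_congr p _ _ fun ω ω' => auxVY_iff n _ _ _ _ _ _).symm
    rw [h1, h2]
    simp only [GG, Finset.sum_sub_distrib, hm0W, hm0Y, entRV_eq_phi]
    rw [Fintype.sum_prod_type
        (f := fun a => phi (distRV p (fun ω => (V n ω, W ω n)) a)),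
      Fintype.sum_prod_type
        (f := fun a => phi (distRV p (fun ω => (V n ω, Y ω n)) a))]
  let m : Fin N × (Fin K × (Fin N → Option (𝒴 ⊕ 𝒲))) → 𝒲 × 𝒳 → ℝ := fun u =>
    (N : ℝ)⁻¹ • m0 u.1 u.2
  have hsum : ∑ u, m u = pbar p W X := by
    funext a
    rw [Finset.sum_apply, Fintype.sum_prod_type]
    simp only [m, Pi.smul_apply, smul_eq_mul, ← Finset.mul_sum, m0, pbar]
    congr 1
    refine Finset.sum_congr rfl fun n _ => ?_
    exact distRV_marg_fst p (V n) (fun ω => (W ω n, X ω n)) a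
  have hsum1 : ∑ u, ∑ a, m u a = 1 := by
    rw [Finset.sum_comm]
    simp only [← Finset.sum_apply, hsum]
    rw [← sum_mW]
    simp only [hpW, hq.2]
  have hG : ∑ u, GG P (m u) = (N : ℝ)⁻¹ * (A 0 - A N) := by
    simp only [m, GG_smul hP, ← Finset.mul_sum]
    rw [Fintype.sum_prod_type]
    simp only [hGG]
    rw [Fin.sum_univ_eq_sum_range (fun n => A n - A (n + 1)), Finset.sum_range_sub']
  have hmem := mem_KK hP m (fun u a => mul_nonneg (by positivity)
    (distRV_nonneg hp.1 _ _)) hsum1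
  rw [hsum, hG] at hmem
  refine ⟨_, hmem, hpW, ?_⟩
  have hA0 : A 0 = Real.logb 2 K + N * ∑ w, phi (q w) := by
    rw [← ent_MW hK hq p M W hMW]
    refine entRV_congr p _ _ fun ω ω' => ?_
    simp [auxZ, funext_iff]
  have hAN : A N = entRV p (fun ω => (M ω, Y ω)) := by
    refine entRV_congr p _ _ fun ω ω' => ?_
    simp [auxZ, funext_iff]
  have hyb : ∀ b, mY P (pbar p W X) b = (N : ℝ)⁻¹ * ∑ n, distRV p (fun ω => Y ω n) b := by
    intro b
    simp only [mY, pbar, mul_assoc, ← Finset.mul_sum, Finset.sum_mul]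
    congr 1
    rw [Finset.sum_comm]
    refine Finset.sum_congr rfl fun n _ => ?_
    rw [distRV_eq_mul, sum_distRV_mul p (fun ω => (W ω n, X ω n)) (fun a => P a.2 a.1 b)]
    have := hMk n (fun _ _ _ => 1) (fun _ _ _ _ => rfl) b
    simp only [one_mul] at this
    exact this.symm
  have hMY := ent_MY hN hK p hp M Y dec ε hPe (mY P (pbar p W X)) hyb
  rw [← hAN] at hMY
  simp only [ff]
  rw [mul_add, ← mul_assoc, mul_inv_cancel₀ hN', one_mul, hA0, mul_sub]
  linarith

end Converse2

section Final

lemma jointI_sum (ch : SDBC 𝒳 𝒴1 𝒴2 𝒲) {N K1 K2 : ℕ} (c : CodeI 𝒳 𝒴1 𝒴2 𝒲 N K1 K2)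
    (g : Fin K1 → Fin K2 → (Fin N → 𝒲) → (Fin N → 𝒴1) → (Fin N → 𝒴2) → ℝ) :
    ∑ ω, jointI ch c ω * g ω.1 ω.2.1 ω.2.2.1 ω.2.2.2.1 ω.2.2.2.2 =
      ∑ m1, ∑ m2, ∑ w : Fin N → 𝒲, (K1 : ℝ)⁻¹ * (K2 : ℝ)⁻¹ * (∏ n, ch.q (w n)) *
        ∑ z : Fin N → 𝒴1 × 𝒴2, (∏ n, ch.Q (c.enc m1 m2 w n) (w n) (z n)) *
          g m1 m2 w (fun i => (z i).1) (fun i => (z i).2) := by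
  rw [Fintype.sum_prod_type]
  refine Finset.sum_congr rfl fun m1 _ => ?_
  rw [Fintype.sum_prod_type]
  refine Finset.sum_congr rfl fun m2 _ => ?_
  rw [Fintype.sum_prod_type]
  refine Finset.sum_congr rfl fun w _ => ?_
  rw [Finset.mul_sum]
  refine (Fintype.sum_equiv (Equiv.arrowProdEquivProdArrow (Fin N) (fun _ => 𝒴1) (fun _ => 𝒴2))
    _ _ fun z => ?_).symm
  simp only [jointI, mul_assoc]
  rfl

lemma jointI_nonneg (ch : SDBC 𝒳 𝒴1 𝒴2 𝒲) {N K1 K2 : ℕ} (c : CodeI 𝒳 𝒴1 𝒴2 𝒲 N K1 K2) (ω) :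
    0 ≤ jointI ch c ω := by
  unfold jointI
  refine mul_nonneg (mul_nonneg (by positivity) ?_) ?_
  · exact Finset.prod_nonneg fun i _ => ch.q_pmf.1 _
  · exact Finset.prod_nonneg fun i _ => ch.Q_nonneg _ _ _

lemma jointI_MW (ch : SDBC 𝒳 𝒴1 𝒴2 𝒲) {N K1 K2 : ℕ} (c : CodeI 𝒳 𝒴1 𝒴2 𝒲 N K1 K2)
    (g : Fin K1 → Fin K2 → (Fin N → 𝒲) → ℝ) :
    ∑ ω, jointI ch c ω * g ω.1 ω.2.1 ω.2.2.1 =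
      ∑ m1, ∑ m2, ∑ w : Fin N → 𝒲, (K1 : ℝ)⁻¹ * (K2 : ℝ)⁻¹ * (∏ n, ch.q (w n)) * g m1 m2 w := by
  rw [jointI_sum ch c (fun m1 m2 w _ _ => g m1 m2 w)]
  refine Finset.sum_congr rfl fun m1 _ => Finset.sum_congr rfl fun m2 _ =>
    Finset.sum_congr rfl fun w _ => ?_
  rw [← Finset.sum_mul, sum_prod_eq_one (fun n => ch.Q (c.enc m1 m2 w n) (w n))
    (fun n => ch.Q_sum _ _), one_mul]

lemma jointI_MW1 (ch : SDBC 𝒳 𝒴1 𝒴2 𝒲) {N K1 K2 : ℕ} (hK2 : 0 < K2)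
    (c : CodeI 𝒳 𝒴1 𝒴2 𝒲 N K1 K2) (g : Fin K1 → (Fin N → 𝒲) → ℝ) :
    ∑ ω, jointI ch c ω * g ω.1 ω.2.2.1 =
      ∑ m, ∑ w : Fin N → 𝒲, (K1 : ℝ)⁻¹ * (∏ n, ch.q (w n)) * g m w := by
  have hK : (K2 : ℝ) ≠ 0 := by positivity
  rw [jointI_MW ch c (fun m1 _ w => g m1 w)]
  refine Finset.sum_congr rfl fun m1 _ => ?_
  rw [Finset.sum_const, Finset.card_univ, Fintype.card_fin, nsmul_eq_mul, Finset.mul_sum]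
  refine Finset.sum_congr rfl fun w _ => ?_
  field_simp

lemma jointI_MW2 (ch : SDBC 𝒳 𝒴1 𝒴2 𝒲) {N K1 K2 : ℕ} (hK1 : 0 < K1)
    (c : CodeI 𝒳 𝒴1 𝒴2 𝒲 N K1 K2) (g : Fin K2 → (Fin N → 𝒲) → ℝ) :
    ∑ ω, jointI ch c ω * g ω.2.1 ω.2.2.1 =
      ∑ m, ∑ w : Fin N → 𝒲, (K2 : ℝ)⁻¹ * (∏ n, ch.q (w n)) * g m w := by
  have hK : (K1 : ℝ) ≠ 0 := by positivity
  rw [jointI_MW ch c (fun _ m2 w => g m2 w), Finset.sum_const, Finset.card_univ, Fintype.card_fin,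
    nsmul_eq_mul, Finset.mul_sum]
  refine Finset.sum_congr rfl fun m2 _ => ?_
  rw [Finset.mul_sum]
  refine Finset.sum_congr rfl fun w _ => ?_
  field_simp

lemma jointI_pmf (ch : SDBC 𝒳 𝒴1 𝒴2 𝒲) {N K1 K2 : ℕ} (hK1 : 0 < K1) (hK2 : 0 < K2)
    (c : CodeI 𝒳 𝒴1 𝒴2 𝒲 N K1 K2) : IsPMF (jointI ch c) := by
  refine ⟨jointI_nonneg ch c, ?_⟩
  have hK : (K1 : ℝ) ≠ 0 := by positivity
  have := jointI_MW1 ch hK2 c (fun _ _ => 1)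
  simp only [mul_one, ← Finset.mul_sum] at this
  rw [this, sum_prod_eq_one (fun _ => ch.q) (fun _ => ch.q_pmf.2)]
  simp [hK]

lemma jointI_Mk1 (ch : SDBC 𝒳 𝒴1 𝒴2 𝒲) {N K1 K2 : ℕ}
    (c : CodeI 𝒳 𝒴1 𝒴2 𝒲 N K1 K2) (n : Fin N) (F : Fin K1 → (Fin N → 𝒲) → (Fin N → 𝒴1) → ℝ)
    (hF : ∀ m w y a, F m w (Function.update y n a) = F m w y) (b : 𝒴1) :
    ∑ ω, jointI ch c ω * (F ω.1 ω.2.2.1 ω.2.2.2.1 * dlt (ω.2.2.2.1 n) b) =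
      ∑ ω, jointI ch c ω * (F ω.1 ω.2.2.1 ω.2.2.2.1 *
        chP1 ch (c.enc ω.1 ω.2.1 ω.2.2.1 n) (ω.2.2.1 n) b) := by
  rw [jointI_sum ch c (fun m1 _ w y1 _ => F m1 w y1 * dlt (y1 n) b),
    jointI_sum ch c (fun m1 m2 w y1 _ => F m1 w y1 * chP1 ch (c.enc m1 m2 w n) (w n) b)]
  refine Finset.sum_congr rfl fun m1 _ => Finset.sum_congr rfl fun m2 _ =>
    Finset.sum_congr rfl fun w _ => ?_
  congr 1
  have := resample (fun n => ch.Q (c.enc m1 m2 w n) (w n)) n (ch.Q_sum _ _)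
    (fun z => F m1 w (fun i => (z i).1)) (fun z a => by
      have : (fun i => (Function.update z n a i).1) = Function.update (fun i => (z i).1) n a.1 := by
        funext i
        by_cases h : i = n
        · subst h; simp
        · simp [Function.update_of_ne h]
      rw [this, hF]) (fun z => dlt z.1 b)
  simp only [mul_assoc] at this
  rw [this]
  refine Finset.sum_congr rfl fun z _ => ?_
  congr 2
  rw [Fintype.sum_prod_type, chP1]
  simp only [← Finset.sum_mul]
  rw [sum_mul_dlt (fun y1 => ∑ y2, ch.Q (c.enc m1 m2 w n) (w n) (y1, y2)) b]

lemma jointI_Mk2 (ch : SDBC 𝒳 𝒴1 𝒴2 𝒲) {N K1 K2 : ℕ}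
    (c : CodeI 𝒳 𝒴1 𝒴2 𝒲 N K1 K2) (n : Fin N) (F : Fin K2 → (Fin N → 𝒲) → (Fin N → 𝒴2) → ℝ)
    (hF : ∀ m w y a, F m w (Function.update y n a) = F m w y) (b : 𝒴2) :
    ∑ ω, jointI ch c ω * (F ω.2.1 ω.2.2.1 ω.2.2.2.2 * dlt (ω.2.2.2.2 n) b) =
      ∑ ω, jointI ch c ω * (F ω.2.1 ω.2.2.1 ω.2.2.2.2 *
        chP2 ch (c.enc ω.1 ω.2.1 ω.2.2.1 n) (ω.2.2.1 n) b) := by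
  rw [jointI_sum ch c (fun _ m2 w _ y2 => F m2 w y2 * dlt (y2 n) b),
    jointI_sum ch c (fun m1 m2 w _ y2 => F m2 w y2 * chP2 ch (c.enc m1 m2 w n) (w n) b)]
  refine Finset.sum_congr rfl fun m1 _ => Finset.sum_congr rfl fun m2 _ =>
    Finset.sum_congr rfl fun w _ => ?_
  congr 1
  have := resample (fun n => ch.Q (c.enc m1 m2 w n) (w n)) n (ch.Q_sum _ _)
    (fun z => F m2 w (fun i => (z i).2)) (fun z a => by
      have : (fun i => (Function.update z n a i).2) = Function.update (fun i => (z i).2) n a.2 := by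
        funext i
        by_cases h : i = n
        · subst h; simp
        · simp [Function.update_of_ne h]
      rw [this, hF]) (fun z => dlt z.2 b)
  simp only [mul_assoc] at this
  rw [this]
  refine Finset.sum_congr rfl fun z _ => ?_
  congr 2
  rw [Fintype.sum_prod_type_right, chP2]
  simp only [← Finset.sum_mul]
  rw [sum_mul_dlt (fun y2 => ∑ y1, ch.Q (c.enc m1 m2 w n) (w n) (y1, y2)) b]

lemma rate_bound {N K : ℕ} {R δ f : ℝ} (hN : 0 < N) (hR : 0 ≤ R) (hδ : δ ≤ 1)
    (hNδ : 1 ≤ δ * N)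
    (hK : (2 : ℝ) ^ ((N : ℝ) * R) ≤ (K : ℝ)) (h : (1 - δ) * Real.logb 2 K - 1 ≤ N * f) :
    R - δ * R - δ ≤ f := by
  have hN' : (0 : ℝ) < N := by exact_mod_cast hN
  have h1 := Real.logb_le_logb_of_le (b := 2) (by norm_num) (by positivity) hK
  rw [Real.logb_rpow (by norm_num) (by norm_num)] at h1
  have h2 := mul_le_mul_of_nonneg_left h1 (by linarith : 0 ≤ 1 - δ)
  have h3 : N * (R - δ * R - δ) ≤ N * f := by nlinarith
  exact le_of_mul_le_mul_left h3 hN'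

lemma achievable_mem (ch : SDBC 𝒳 𝒴1 𝒴2 𝒲) {R : ℝ × ℝ} (hR : AchievableI ch R.1 R.2) :
    R ∈ {R : ℝ × ℝ | ∃ k1 ∈ KK (chP1 ch), ∃ k2 ∈ KK (chP2 ch), k1.1 = k2.1 ∧
      (∀ w, mW k1.1 w = ch.q w) ∧ R.1 ≤ ff (chP1 ch) ch.q k1 ∧
      R.2 ≤ ff (chP2 ch) ch.q k2} := by
  obtain ⟨h1, h2, hA⟩ := hR
  have ht : Filter.Tendsto (fun k : ℕ => 1 / ((k : ℝ) + 1)) Filter.atTop (nhds 0) :=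
    tendsto_one_div_add_atTop_nhds_zero_nat
  have hlim : Filter.Tendsto (fun k : ℕ =>
      ((R.1 - 1 / ((k : ℝ) + 1) * R.1 - 1 / ((k : ℝ) + 1),
        R.2 - 1 / ((k : ℝ) + 1) * R.2 - 1 / ((k : ℝ) + 1)) : ℝ × ℝ)) Filter.atTop (nhds R) := by
    have h : ∀ r : ℝ, Filter.Tendsto (fun k : ℕ =>
        r - 1 / ((k : ℝ) + 1) * r - 1 / ((k : ℝ) + 1)) Filter.atTop (nhds r) := by
      intro r
      have := ((tendsto_const_nhds (x := r)).sub (ht.mul_const r)).sub ht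
      simpa using this
    exact (h R.1).prodMk_nhds (h R.2)
  refine (isClosed_DD ch).mem_of_tendsto hlim (Filter.Eventually.of_forall fun k => ?_)
  have hkpos : (0 : ℝ) < (k : ℝ) + 1 := by positivity
  set δ : ℝ := 1 / ((k : ℝ) + 1) with hδ
  have hδ0 : 0 < δ := by positivity
  have hδ1 : δ ≤ 1 := by
    rw [hδ, div_le_one hkpos]
    have : (0 : ℝ) ≤ k := by positivity
    linarith
  obtain ⟨N0, hN0⟩ := hA δ hδ0
  obtain ⟨N, hNN, hNk⟩ : ∃ N, N0 ≤ N ∧ k + 1 ≤ N :=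
    ⟨max N0 (k + 1), le_max_left _ _, le_max_right _ _⟩
  obtain ⟨K1, K2, c, hK1, hK2, hPe⟩ := hN0 N hNN
  have hN : 0 < N := by omega
  have hNδ : 1 ≤ δ * N := by
    have : ((k : ℝ) + 1) ≤ N := by exact_mod_cast hNk
    rw [hδ, one_div_mul_eq_div, le_div_iff₀ hkpos]
    linarith
  have hK1' : 0 < K1 := by
    have : (0 : ℝ) < K1 := lt_of_lt_of_le (by positivity) hK1
    exact_mod_cast this
  have hK2' : 0 < K2 := by
    have : (0 : ℝ) < K2 := lt_of_lt_of_le (by positivity) hK2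
    exact_mod_cast this
  have hpmf := jointI_pmf ch hK1' hK2' c
  obtain ⟨t1, ht1, hW, hb1⟩ := user_converse hN hK1' (chP1_sum ch) ch.q_pmf (jointI ch c) hpmf
    (fun ω => ω.1) (fun ω => ω.2.2.1) (fun ω n => c.enc ω.1 ω.2.1 ω.2.2.1 n)
    (fun ω => ω.2.2.2.1) (jointI_MW1 ch hK2' c) (jointI_Mk1 ch c) c.dec1 δ
    ((le_max_left _ _).trans hPe)
  obtain ⟨t2, ht2, -, hb2⟩ := user_converse hN hK2' (chP2_sum ch) ch.q_pmf (jointI ch c) hpmf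
    (fun ω => ω.2.1) (fun ω => ω.2.2.1) (fun ω n => c.enc ω.1 ω.2.1 ω.2.2.1 n)
    (fun ω => ω.2.2.2.2) (jointI_MW2 ch hK1' c) (jointI_Mk2 ch c) c.dec2 δ
    ((le_max_right _ _).trans hPe)
  exact ⟨_, ht1, _, ht2, rfl, hW, rate_bound hN h1 hδ1 hNδ hK1 hb1,
    rate_bound hN h2 hδ1 hNδ hK2 hb2⟩

end Final

/-- **Theorem 2 (outer bound for Class I channels).**
The capacity region `C1` is contained in the union, over all distributions
`p1 ∈ P1` (finite auxiliary alphabets `𝒱1, 𝒱2` with conditional pmfs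
`p(v1,v2|w)` and `p(x|w,v1,v2)`), of the regions `R_{1,out}(p1)`. -/
theorem classI_outer_bound (ch : SDBC 𝒳 𝒴1 𝒴2 𝒲) :
    CapacityI ch ⊆
      ⋃ (𝒱1 : Type) (𝒱2 : Type) (i1 : Fintype 𝒱1) (i2 : Fintype 𝒱2)
        (pV : 𝒲 → 𝒱1 × 𝒱2 → ℝ) (pX : 𝒲 → 𝒱1 → 𝒱2 → 𝒳 → ℝ),
        regionOutI ch 𝒱1 𝒱2 i1 i2 pV pX := by
  intro R hR
  have hD := closure_minimal (fun R hR => achievable_mem ch hR) (isClosed_DD ch) hR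
  have hpos : IsClosed {R : ℝ × ℝ | 0 ≤ R.1 ∧ 0 ≤ R.2} :=
    (isClosed_le continuous_const continuous_fst).inter
      (isClosed_le continuous_const continuous_snd)
  have hP := closure_minimal (fun (R : ℝ × ℝ) (hR : AchievableI ch R.1 R.2) =>
    (⟨hR.1, hR.2.1⟩ : 0 ≤ R.1 ∧ 0 ≤ R.2)) hpos hR
  obtain ⟨k1, hk1, k2, hk2, h12, hq, h1, h2⟩ := hD
  simp only [Set.mem_iUnion]
  exact mem_region ch hk1 hk2 h12 hq R hP.1 hP.2 h1 h2
end
end
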